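/- arXiv:1708.04660 — 6 statements merged into one kernel-verified Lean document; each statement's English description precedes it below -/
import Mathlib

section
/- Let n ≥ 5 and let u ∈ C⁴((0,∞)) be a positive function satisfying the radial biharmonic equation u''''(r) + (2(n-1)/r) u'''(r) + ((n-1)(n-3)/r²) u''(r) - ((n-1)(n-3)/r³) u'(r) = u(r)^{(n+4)/(n-4)} for all r > 0. Assume u is unbounded as r → 0⁺ (so that 0 is a non-removable singularity), and that u is not identically equal to u_s, where u_s(r) = (n²(n-4)²/16)^{(n-4)/8} r^{-(n-4)/2}. Then u - u_s changes sign infinitely many times on (0,∞): there exists a strictly monotone sequence (ρ_k)_{k∈ℕ} in (0,∞) such that u(ρ_k) - u_s(ρ_k) ≠ 0 for every k and the sign of u(ρ_k) - u_s(ρ_k) alternates in k. -/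
open Real

/-- `x₀, x₁, x₂, x₃` are a function and its first three derivatives, and the fourth derivative
of `x₀` equals `a * x₂ + G`. -/
structure IsSolutionChain (a : ℝ) (G x₀ x₁ x₂ x₃ : ℝ → ℝ) : Prop where
  d₀ : ∀ t, HasDerivAt x₀ (x₁ t) t
  d₁ : ∀ t, HasDerivAt x₁ (x₂ t) t
  d₂ : ∀ t, HasDerivAt x₂ (x₃ t) t
  d₃ : ∀ t, HasDerivAt x₃ (a * x₂ t + G t) t

/-- `x₀` and its first three derivatives all tend to infinity. -/
def AllTendToInfinity (x₀ x₁ x₂ x₃ : ℝ → ℝ) : Prop :=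
  ∀ M : ℝ, ∃ S : ℝ, ∀ s, S ≤ s → M ≤ x₀ s ∧ M ≤ x₁ s ∧ M ≤ x₂ s ∧ M ≤ x₃ s

theorem IsSolutionChain.reverse {a : ℝ} {G x₀ x₁ x₂ x₃ : ℝ → ℝ}
    (h : IsSolutionChain a G x₀ x₁ x₂ x₃) :
    IsSolutionChain a (fun s => G (-s)) (fun s => x₀ (-s)) (fun s => -x₁ (-s))
      (fun s => x₂ (-s)) (fun s => -x₃ (-s)) where
  d₀ t := ((h.d₀ (-t)).scomp t (hasDerivAt_neg t)).congr_deriv (by simp)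
  d₁ t := ((h.d₁ (-t)).scomp t (hasDerivAt_neg t)).neg.congr_deriv (by simp)
  d₂ t := ((h.d₂ (-t)).scomp t (hasDerivAt_neg t)).congr_deriv (by simp)
  d₃ t := ((h.d₃ (-t)).scomp t (hasDerivAt_neg t)).neg.congr_deriv (by simp)

theorem IsSolutionChain.sub_const_mul {a : ℝ} {G x₀ x₁ x₂ x₃ : ℝ → ℝ}
    (h : IsSolutionChain a G x₀ x₁ x₂ x₃) (e l : ℝ) :
    IsSolutionChain a (fun s => e * G s) (fun s => e * (x₀ s - l)) (fun s => e * x₁ s)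
      (fun s => e * x₂ s) (fun s => e * x₃ s) where
  d₀ t := ((h.d₀ t).sub_const l).const_mul e
  d₁ t := (h.d₁ t).const_mul e
  d₂ t := (h.d₂ t).const_mul e
  d₃ t := ((h.d₃ t).const_mul e).congr_deriv (by ring)

theorem le_of_hasDerivAt_nonneg {f f' : ℝ → ℝ} {S : ℝ}
    (hf : ∀ s, S ≤ s → HasDerivAt f (f' s) s) (h : ∀ s, S ≤ s → 0 ≤ f' s)
    {s t : ℝ} (hs : S ≤ s) (hst : s ≤ t) : f s ≤ f t := by
  refine monotoneOn_of_deriv_nonneg (convex_Ici S)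
    (fun x hx => (hf x hx).continuousAt.continuousWithinAt)
    (fun x hx => (hf x (interior_subset hx)).differentiableAt.differentiableWithinAt)
    (fun x hx => ?_) hs (hs.trans hst) hst
  rw [(hf x (interior_subset hx)).deriv]
  exact h x (interior_subset hx)

theorem le_of_hasDerivAt_nonneg_Icc {f f' : ℝ → ℝ} {S T : ℝ}
    (hf : ∀ s, HasDerivAt f (f' s) s) (h : ∀ s ∈ Set.Ioo S T, 0 ≤ f' s)
    {s : ℝ} (hs : s ∈ Set.Icc S T) : f S ≤ f s := by
  refine monotoneOn_of_deriv_nonneg (convex_Icc S T)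
    (fun x hx => (hf x).continuousAt.continuousWithinAt)
    (fun x hx => (hf x).differentiableAt.differentiableWithinAt)
    (fun x hx => ?_) (Set.left_mem_Icc.2 (hs.1.trans hs.2)) hs hs.1
  rw [(hf x).deriv]
  exact h x (by simpa using hx)

theorem lt_of_hasDerivAt_pos_Icc {f f' : ℝ → ℝ} {S T : ℝ}
    (hf : ∀ s, HasDerivAt f (f' s) s) (h : ∀ s ∈ Set.Ioo S T, 0 < f' s)
    {s : ℝ} (hs : s ∈ Set.Ioc S T) : f S < f s := by
  refine strictMonoOn_of_deriv_pos (convex_Icc S T)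
    (fun x hx => (hf x).continuousAt.continuousWithinAt)
    (fun x hx => ?_) (Set.left_mem_Icc.2 (hs.1.le.trans hs.2)) ⟨hs.1.le, hs.2⟩ hs.1
  rw [(hf x).deriv]
  exact h x (by simpa using hx)

theorem hasDerivAt_exp_mul (γ s : ℝ) : HasDerivAt (fun s => exp (γ * s)) (γ * exp (γ * s)) s := by
  have := ((hasDerivAt_id s).const_mul γ).exp
  simpa [mul_comm] using this

theorem exp_mul_le_of_deriv {k k' : ℝ → ℝ} {κ S : ℝ}
    (hk : ∀ s, S ≤ s → HasDerivAt k (k' s) s) (h : ∀ s, S ≤ s → κ * k s ≤ k' s)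
    {s : ℝ} (hs : S ≤ s) : k S * exp (-κ * S) * exp (κ * s) ≤ k s := by
  have h1 := le_of_hasDerivAt_nonneg (f := fun s => k s * exp (-κ * s))
    (fun s hs => (hk s hs).mul (hasDerivAt_exp_mul (-κ) s))
    (fun s hs => by
      have := mul_nonneg (sub_nonneg.2 (h s hs)) (exp_pos (-κ * s)).le
      linarith) le_rfl hs
  calc _ ≤ k s * exp (-κ * s) * exp (κ * s) := by gcongr
    _ = k s := by rw [mul_assoc, ← exp_add]; simp

theorem eventually_exp_le_of_deriv {f f' : ℝ → ℝ} {γ κ c S : ℝ} (hκ : 0 < κ + γ) (hc : 0 < c)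
    (hf : ∀ s, S ≤ s → HasDerivAt f (f' s) s)
    (h : ∀ s, S ≤ s → c * exp (κ * s) ≤ f' s + γ * f s) :
    ∃ c' > 0, ∃ S' ≥ S, ∀ s, S' ≤ s → c' * exp (κ * s) ≤ f s := by
  set d := c / (2 * (κ + γ)) with hd
  have hd0 : 0 < d := by positivity
  have hcd : c = 2 * d * (κ + γ) := by rw [hd]; field_simp
  set F := fun s => f s * exp (γ * s) - 2 * d * exp ((κ + γ) * s) with hF
  have key : ∀ s, S ≤ s → F S ≤ F s := fun s hs =>
    le_of_hasDerivAt_nonneg (f := F)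
      (fun s hs => ((hf s hs).mul (hasDerivAt_exp_mul γ s)).sub
        ((hasDerivAt_exp_mul (κ + γ) s).const_mul (2 * d)))
      (fun s hs => by
        have h1 := mul_le_mul_of_nonneg_right (h s hs) (exp_pos (γ * s)).le
        have h2 : exp ((κ + γ) * s) = exp (κ * s) * exp (γ * s) := by
          rw [← exp_add]; ring_nf
        rw [h2]
        rw [hcd] at h1
        linarith) le_rfl hs
  have hlim : Filter.Tendsto (fun s => d * exp ((κ + γ) * s)) Filter.atTop Filter.atTop :=
    (tendsto_exp_atTop.comp (Filter.tendsto_id.const_mul_atTop hκ)).const_mul_atTop hd0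
  obtain ⟨S', hS'⟩ := Filter.eventually_atTop.1
    ((hlim.eventually_ge_atTop (-F S)).and (Filter.eventually_ge_atTop S))
  refine ⟨d, hd0, max S S', le_max_left _ _, fun s hs => ?_⟩
  have h1 := key s (le_trans (le_max_left _ _) hs)
  have h2 := (hS' s (le_trans (le_max_right _ _) hs)).1
  have h3 : exp ((κ + γ) * s) = exp (κ * s) * exp (γ * s) := by
    rw [← exp_add]; ring_nf
  have h4 : d * exp (κ * s) * exp (γ * s) ≤ f s * exp (γ * s) := by
    have : F s = f s * exp (γ * s) - 2 * d * exp ((κ + γ) * s) := rfl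
    rw [h3] at h2 this
    linarith
  exact le_of_mul_le_mul_right h4 (exp_pos _)

theorem exists_forall_le_of_exp_le {f : ℝ → ℝ} {c κ S : ℝ} (hc : 0 < c) (hκ : 0 < κ)
    (h : ∀ s, S ≤ s → c * exp (κ * s) ≤ f s) (M : ℝ) : ∃ S' ≥ S, ∀ s, S' ≤ s → M ≤ f s := by
  have hlim : Filter.Tendsto (fun s => c * exp (κ * s)) Filter.atTop Filter.atTop :=
    (tendsto_exp_atTop.comp (Filter.tendsto_id.const_mul_atTop hκ)).const_mul_atTop hc
  obtain ⟨S', hS'⟩ := Filter.eventually_atTop.1 (hlim.eventually_ge_atTop M)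
  exact ⟨max S S', le_max_left _ _, fun s hs =>
    (hS' s (le_trans (le_max_right _ _) hs)).trans (h s (le_trans (le_max_left _ _) hs))⟩

theorem exists_forall_le_of_deriv_ge {f f' : ℝ → ℝ} {c S : ℝ} (hc : 0 < c)
    (hf : ∀ s, HasDerivAt f (f' s) s) (h : ∀ s, S ≤ s → c ≤ f' s) (M : ℝ) :
    ∃ S' ≥ S, ∀ s, S' ≤ s → M ≤ f s := by
  refine ⟨max S (S + (M - f S) / c), le_max_left _ _, fun s hs => ?_⟩
  have h1 := le_of_hasDerivAt_nonneg (f := fun s => f s - c * s)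
    (fun s _ => (hf s).sub ((hasDerivAt_id s).const_mul c))
    (fun s hs => by have := h s hs; simp; linarith) le_rfl (le_trans (le_max_left _ _) hs)
  have h2 := le_trans (le_max_right _ _) hs
  have h3 : (M - f S) / c ≤ s - S := by linarith
  rw [div_le_iff₀ hc] at h3
  linarith

theorem IsSolutionChain.allTendToInfinity {b : ℝ} {G x₀ x₁ x₂ x₃ : ℝ → ℝ} {S : ℝ} (hb : 0 < b)
    (h : IsSolutionChain (b ^ 2) G x₀ x₁ x₂ x₃) (hG : ∀ s, S ≤ s → 0 ≤ G s)
    (hS : 0 < x₃ S + b * x₂ S) : AllTendToInfinity x₀ x₁ x₂ x₃ := by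
  have e := fun s (hs : S ≤ s) => exp_mul_le_of_deriv (k := fun s => x₃ s + b * x₂ s) (κ := b)
    (fun s _ => (h.d₃ s).add ((h.d₂ s).const_mul b))
    (fun s hs => by have := hG s hs; nlinarith) hs
  have hc : 0 < (x₃ S + b * x₂ S) * exp (-b * S) := by positivity
  obtain ⟨c2, hc2, S2, hS2, e2⟩ := eventually_exp_le_of_deriv (by positivity) hc
    (fun s _ => h.d₂ s) e
  obtain ⟨c1, hc1, S1, hS1, e1⟩ := eventually_exp_le_of_deriv (γ := 0) (κ := b) (by simpa) hc2
    (fun s _ => h.d₁ s) (fun s hs => by simpa using e2 s hs)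
  obtain ⟨c0, hc0, S0, hS0, e0⟩ := eventually_exp_le_of_deriv (γ := 0) (κ := b) (by simpa) hc1
    (fun s _ => h.d₀ s) (fun s hs => by simpa using e1 s hs)
  obtain ⟨c3, hc3, S3, hS3, e3⟩ := eventually_exp_le_of_deriv (γ := 0) (κ := b) (by simpa)
    (show 0 < b ^ 2 * c2 by positivity) (fun s (_ : S2 ≤ s) => h.d₃ s) (fun s hs => by
      have := hG s (hS2.le.trans hs)
      have := mul_le_mul_of_nonneg_left (e2 s hs) (sq_nonneg b)
      linarith)
  intro M
  obtain ⟨T0, -, f0⟩ := exists_forall_le_of_exp_le hc0 hb e0 M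
  obtain ⟨T1, -, f1⟩ := exists_forall_le_of_exp_le hc1 hb e1 M
  obtain ⟨T2, -, f2⟩ := exists_forall_le_of_exp_le hc2 hb e2 M
  obtain ⟨T3, -, f3⟩ := exists_forall_le_of_exp_le hc3 hb e3 M
  refine ⟨max (max T0 T1) (max T2 T3), fun s hs => ?_⟩
  simp only [max_le_iff] at hs
  exact ⟨f0 s hs.1.1, f1 s hs.1.2, f2 s hs.2.1, f3 s hs.2.2⟩

/-- A nonnegative solution with uniformly positive forcing tends to infinity. -/
theorem IsSolutionChain.allTendToInfinity_of_le {b δ : ℝ} {G x₀ x₁ x₂ x₃ : ℝ → ℝ} {S : ℝ}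
    (hb : 0 < b) (h : IsSolutionChain (b ^ 2) G x₀ x₁ x₂ x₃) (hδ : 0 < δ)
    (hG : ∀ s, S ≤ s → δ ≤ G s) (hx : ∀ s, S ≤ s → 0 ≤ x₀ s) :
    AllTendToInfinity x₀ x₁ x₂ x₃ := by
  by_cases hh : ∃ s, S ≤ s ∧ 0 < x₃ s + b * x₂ s
  · obtain ⟨s, hs, hp⟩ := hh
    exact h.allTendToInfinity hb (fun t ht => hδ.le.trans (hG t (hs.trans ht))) hp
  push Not at hh
  exfalso
  have h1 : ∀ s, S ≤ s → x₃ s + b * x₂ s + δ / b ≤ 0 := by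
    intro s hs
    by_contra! hp
    have e := fun t (ht : s ≤ t) => exp_mul_le_of_deriv
      (k := fun s => x₃ s + b * x₂ s + δ / b) (κ := b)
      (fun s _ => ((h.d₃ s).add ((h.d₂ s).const_mul b)).add_const (δ / b))
      (fun t ht => by
        have := hG t (hs.trans ht)
        have h3 : b * (δ / b) = δ := by field_simp
        nlinarith) ht
    obtain ⟨S', hS', e'⟩ := exists_forall_le_of_exp_le (by positivity) hb e (1 + δ / b)
    have := e' S' le_rfl
    have := hh S' (hs.trans hS')
    linarith
  set c := δ / (b * b) with hcdef
  have hc : 0 < c := by positivity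
  have hcb : δ / b = b * c := by rw [hcdef]; field_simp
  have h2 : ∀ s, S ≤ s → (x₂ s + c) ≤ (x₂ S + c) * exp (b * S) * exp (-b * s) := by
    intro s hs
    have := exp_mul_le_of_deriv (k := fun s => -(x₂ s + c)) (κ := -b)
      (fun s _ => ((h.d₂ s).add_const c).neg)
      (fun s hs => by
        have := h1 s hs
        rw [hcb] at this
        linarith) hs
    simp only [neg_neg] at this
    linarith
  have hlim : Filter.Tendsto (fun s => (x₂ S + c) * exp (b * S) * exp (-b * s))
      Filter.atTop (nhds 0) := by
    have : Filter.Tendsto (fun s => exp (-b * s)) Filter.atTop (nhds 0) :=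
      tendsto_exp_atBot.comp (Filter.tendsto_id.const_mul_atTop_of_neg (by linarith))
    simpa using this.const_mul ((x₂ S + c) * exp (b * S))
  obtain ⟨S', hS'⟩ := Filter.eventually_atTop.1 (hlim.eventually_le_const (half_pos hc))
  obtain ⟨T, hT, e1⟩ := exists_forall_le_of_deriv_ge (f := fun s => -x₁ s)
    (S := max S S') (half_pos hc) (fun s => (h.d₁ s).neg)
    (fun s hs => by
      have := h2 s (le_trans (le_max_left _ _) hs)
      have := hS' s (le_trans (le_max_right _ _) hs)
      linarith) 1
  obtain ⟨T', hT', e0⟩ := exists_forall_le_of_deriv_ge (f := fun s => -x₀ s)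
    (S := T) one_pos (fun s => (h.d₀ s).neg) e1 1
  have := e0 T' le_rfl
  have := hx T' (by exact le_trans (le_max_left _ _) (hT.le.trans hT'))
  linarith

/-- Alternative for nonnegative solutions on a half-line with nonnegative forcing. -/
theorem IsSolutionChain.alternative {b : ℝ} {G x₀ x₁ x₂ x₃ : ℝ → ℝ} {S : ℝ}
    (hb : 0 < b) (h : IsSolutionChain (b ^ 2) G x₀ x₁ x₂ x₃)
    (hG : ∀ s, S ≤ s → 0 ≤ G s) (hx : ∀ s, S ≤ s → 0 ≤ x₀ s)
    (hB : ¬ AllTendToInfinity x₀ x₁ x₂ x₃) :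
    (x₁ S ≤ 0 ∧ 0 ≤ x₂ S ∧ x₃ S + b * x₂ S ≤ 0) ∨
    ∃ s₀, S ≤ s₀ ∧ 0 < x₀ s₀ ∧ ∀ s, s₀ ≤ s → 0 ≤ x₁ s := by
  have hh : ∀ s, S ≤ s → x₃ s + b * x₂ s ≤ 0 := by
    intro s hs
    by_contra! hp
    exact hB (h.allTendToInfinity hb (fun t ht => hG t (hs.trans ht)) hp)
  by_cases hq : ∃ s, S ≤ s ∧ x₂ s < 0
  · right
    obtain ⟨s₁, hs₁, hq⟩ := hq
    have h2 : ∀ s, s₁ ≤ s → x₂ s < 0 := by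
      intro s hs
      have := exp_mul_le_of_deriv (k := fun s => -x₂ s) (κ := -b)
        (fun s _ => (h.d₂ s).neg)
        (fun s hs => by
          have := hh s (hs₁.trans hs)
          linarith) hs
      simp only [neg_neg] at this
      have h3 : 0 < -x₂ s₁ * exp (b * s₁) * exp (-b * s) := by
        have : 0 < -x₂ s₁ := by linarith
        positivity
      linarith
    have h1 : ∀ s, s₁ ≤ s → 0 ≤ x₁ s := by
      intro s hs
      by_contra! hp
      obtain ⟨T, hT, e⟩ := exists_forall_le_of_deriv_ge (f := fun s => -x₀ s)
        (S := s) (c := -x₁ s) (by linarith) (fun s => (h.d₀ s).neg) (fun t ht => by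
          have := le_of_hasDerivAt_nonneg (f := fun s => -x₁ s) (S := s₁)
            (fun s _ => (h.d₁ s).neg) (fun s hs => by have := h2 s hs; linarith) hs ht
          exact this) 1
      have := e T le_rfl
      have := hx T (hs₁.trans (hs.trans hT))
      linarith
    refine ⟨s₁ + 1, by linarith, ?_, fun s hs => h1 s (by linarith)⟩
    by_contra! hp
    have h0 : ∀ s ∈ Set.Icc s₁ (s₁ + 1), x₀ s = 0 := by
      intro s hs
      have := le_of_hasDerivAt_nonneg (f := x₀) (fun s _ => h.d₀ s) h1 hs.1 hs.2
      exact le_antisymm (by linarith) (hx s (hs₁.trans hs.1))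
    have h1' : ∀ s ∈ Set.Ioo s₁ (s₁ + 1), x₁ s = 0 := by
      intro s hs
      refine (h.d₀ s).unique (HasDerivAt.congr_of_eventuallyEq (hasDerivAt_const s 0) ?_)
      filter_upwards [Ioo_mem_nhds hs.1 hs.2] with t ht
      exact h0 t ⟨ht.1.le, ht.2.le⟩
    have hm : s₁ + 1 / 2 ∈ Set.Ioo s₁ (s₁ + 1) := ⟨by linarith, by linarith⟩
    have : x₂ (s₁ + 1 / 2) = 0 := by
      refine (h.d₁ _).unique (HasDerivAt.congr_of_eventuallyEq (hasDerivAt_const _ 0) ?_)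
      filter_upwards [Ioo_mem_nhds hm.1 hm.2] with t ht
      exact h1' t ht
    have := h2 _ hm.1.le
    linarith
  · push Not at hq
    by_cases h1 : x₁ S ≤ 0
    · exact Or.inl ⟨h1, hq S le_rfl, hh S le_rfl⟩
    · right
      push Not at h1
      have h1' : ∀ s, S ≤ s → x₁ S ≤ x₁ s := fun s hs =>
        le_of_hasDerivAt_nonneg (fun s _ => h.d₁ s) hq le_rfl hs
      obtain ⟨T, hT, e⟩ := exists_forall_le_of_deriv_ge h1 h.d₀ h1' 1
      exact ⟨T, hT, by linarith [e T le_rfl], fun s hs => h1.le.trans (h1' s (hT.le.trans hs))⟩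

/-- Forward invariance: increasing positive data lead to growth. -/
theorem IsSolutionChain.allTendToInfinity_of_data {b : ℝ} {G x₀ x₁ x₂ x₃ : ℝ → ℝ} {S : ℝ}
    (hb : 0 < b) (h : IsSolutionChain (b ^ 2) G x₀ x₁ x₂ x₃)
    (hG : ∀ s, 0 < x₀ s → 0 < G s) (h0 : 0 < x₀ S) (h1 : 0 ≤ x₁ S) (h2 : 0 ≤ x₂ S)
    (h3 : 0 ≤ x₃ S) : AllTendToInfinity x₀ x₁ x₂ x₃ := by
  have step : ∀ T, S ≤ T → (∀ s ∈ Set.Ico S T, 0 < x₀ s) → x₀ S ≤ x₀ T ∧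
      (S < T → 0 < x₃ T + b * x₂ T) := by
    intro T hT hx
    have hGI : ∀ s ∈ Set.Ioo S T, 0 < G s := fun s hs => hG s (hx s ⟨hs.1.le, hs.2⟩)
    have hS : 0 ≤ x₃ S + b * x₂ S := by positivity
    have p3 : ∀ s ∈ Set.Ioc S T, 0 < x₃ s + b * x₂ s := by
      intro s hs
      have := lt_of_hasDerivAt_pos_Icc
        (f := fun s => (x₃ s + b * x₂ s) * exp (-b * s))
        (fun s => ((h.d₃ s).add ((h.d₂ s).const_mul b)).mul (hasDerivAt_exp_mul (-b) s))
        (fun s hs => by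
          have := mul_pos (hGI s hs) (exp_pos (-b * s))
          simp only [Pi.add_apply]
          linarith) hs
      have h4 : 0 < (x₃ s + b * x₂ s) * exp (-b * s) :=
        lt_of_le_of_lt (mul_nonneg hS (exp_pos _).le) this
      exact pos_of_mul_pos_left h4 (exp_pos _).le
    have p2 : ∀ s ∈ Set.Icc S T, 0 ≤ x₂ s := by
      intro s hs
      have := le_of_hasDerivAt_nonneg_Icc (f := fun s => x₂ s * exp (b * s))
        (fun s => (h.d₂ s).mul (hasDerivAt_exp_mul b s))
        (fun s hs => by
          have := mul_pos (p3 s ⟨hs.1, hs.2.le⟩) (exp_pos (b * s))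
          linarith) hs
      have h4 : 0 ≤ x₂ s * exp (b * s) := le_trans (mul_nonneg h2 (exp_pos _).le) this
      exact nonneg_of_mul_nonneg_left h4 (exp_pos _)
    have p1 : ∀ s ∈ Set.Icc S T, 0 ≤ x₁ s := fun s hs =>
      h1.trans (le_of_hasDerivAt_nonneg_Icc h.d₁ (fun s hs => p2 s ⟨hs.1.le, hs.2.le⟩) hs)
    exact ⟨le_of_hasDerivAt_nonneg_Icc h.d₀ (fun s hs => p1 s ⟨hs.1.le, hs.2.le⟩)
      (Set.right_mem_Icc.2 hT), fun hlt => p3 T ⟨hlt, le_rfl⟩⟩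
  have hpos : ∀ s, S ≤ s → 0 < x₀ s := by
    by_contra! hc
    obtain ⟨s, hs, hc⟩ := hc
    set A := {t | S ≤ t ∧ x₀ t ≤ 0} with hA
    have hcont : Continuous x₀ := continuous_iff_continuousAt.2 fun t => (h.d₀ t).continuousAt
    have hcl : IsClosed A := isClosed_Ici.inter (isClosed_le hcont continuous_const)
    have hbd : BddBelow A := ⟨S, fun t ht => ht.1⟩
    have hm := hcl.csInf_mem ⟨s, hs, hc⟩ hbd
    have := (step (sInf A) hm.1 (fun t ht => by
      by_contra! hn
      have := csInf_le hbd (show t ∈ A from ⟨ht.1, hn⟩)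
      linarith [ht.2])).1
    linarith [hm.2]
  exact h.allTendToInfinity (S := S + 1) hb (fun s hs => (hG s (hpos s (by linarith))).le)
    ((step (S + 1) (by linarith) (fun s hs => hpos s hs.1)).2 (by linarith))

theorem quartic_le_of_le_fourth_deriv {a c t : ℝ} {G x₀ x₁ x₂ x₃ : ℝ → ℝ}
    (h : IsSolutionChain a G x₀ x₁ x₂ x₃) (hc : ∀ s, t ≤ s → c ≤ a * x₂ s + G s)
    (h0 : 0 ≤ x₀ t) (h1 : 0 ≤ x₁ t) (h2 : 0 ≤ x₂ t) (h3 : 0 ≤ x₃ t) {s : ℝ} (hs : t ≤ s) :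
    c * (s - t) ^ 4 / 24 ≤ x₀ s := by
  have hp : ∀ (k : ℕ) (s : ℝ), HasDerivAt (fun s => (s - t) ^ (k + 1)) ((k + 1) * (s - t) ^ k) s :=
    fun k s => (((hasDerivAt_id s).sub_const t).pow (k + 1)).congr_deriv (by simp)
  have p3 : ∀ s, t ≤ s → c * (s - t) ≤ x₃ s := fun s hs => by
    have := le_of_hasDerivAt_nonneg (f := fun s => x₃ s - c * (s - t) ^ (0 + 1))
      (fun s _ => (h.d₃ s).sub ((hp 0 s).const_mul c))
      (fun s hs => by have := hc s hs; simp; linarith) le_rfl hs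
    norm_num at this
    linarith
  have p2 : ∀ s, t ≤ s → c * (s - t) ^ 2 / 2 ≤ x₂ s := fun s hs => by
    have := le_of_hasDerivAt_nonneg (f := fun s => x₂ s - c / 2 * (s - t) ^ (1 + 1))
      (fun s _ => (h.d₂ s).sub ((hp 1 s).const_mul (c / 2)))
      (fun s hs => by have := p3 s hs; norm_num; linarith) le_rfl hs
    norm_num at this
    linarith
  have p1 : ∀ s, t ≤ s → c * (s - t) ^ 3 / 6 ≤ x₁ s := fun s hs => by
    have := le_of_hasDerivAt_nonneg (f := fun s => x₁ s - c / 6 * (s - t) ^ (2 + 1))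
      (fun s _ => (h.d₁ s).sub ((hp 2 s).const_mul (c / 6)))
      (fun s hs => by have := p2 s hs; norm_num; linarith) le_rfl hs
    norm_num at this
    linarith
  have := le_of_hasDerivAt_nonneg (f := fun s => x₀ s - c / 24 * (s - t) ^ (3 + 1))
    (fun s _ => (h.d₀ s).sub ((hp 3 s).const_mul (c / 24)))
    (fun s hs => by have := p1 s hs; norm_num; linarith) le_rfl hs
  norm_num at this
  linarith

/-- Superlinear fourth-order growth is incompatible with global existence. -/
theorem IsSolutionChain.not_allTendToInfinity {a K p : ℝ} {y₀ y₁ y₂ y₃ : ℝ → ℝ}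
    (ha : 0 ≤ a) (hp : 1 < p)
    (h : IsSolutionChain a (fun t => y₀ t ^ p - K * y₀ t) y₀ y₁ y₂ y₃) :
    ¬ AllTendToInfinity y₀ y₁ y₂ y₃ := by
  intro hB
  set L : ℝ := (16 : ℝ) ^ (1 / (p - 1)) with hL
  have hp1 : 0 < p - 1 := by linarith
  have hL1 : 1 < L := one_lt_rpow (by norm_num) (by positivity)
  have hL0 : 0 < L := by linarith
  have hLp : L ^ (p - 1) = 16 := by
    rw [hL, ← rpow_mul (by norm_num)]
    field_simp
    simp
  obtain ⟨B, hB1, hBK, hBL⟩ : ∃ B : ℝ, 1 ≤ B ∧ 2 * K ≤ B ^ (p - 1) ∧ 768 * L ≤ B ^ (p - 1) :=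
    ((Filter.eventually_ge_atTop 1).and
      (((tendsto_rpow_atTop hp1).eventually_ge_atTop (2 * K)).and
        ((tendsto_rpow_atTop hp1).eventually_ge_atTop (768 * L)))).exists
  have hB0 : 0 < B := by linarith
  obtain ⟨S, hS⟩ := hB B
  have hpow : ∀ x : ℝ, 0 < x → x ^ p = x * x ^ (p - 1) := fun x hx => by
    rw [← rpow_one_add' hx.le (by linarith)]; ring_nf
  have hmono : ∀ s t, S ≤ s → s ≤ t → y₀ s ≤ y₀ t := fun s t hs hst =>
    le_of_hasDerivAt_nonneg (fun s _ => h.d₀ s) (fun s hs => hB0.le.trans (hS s hs).2.1) hs hst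
  have step : ∀ t s, S ≤ t → t ≤ s → y₀ t ^ p / 2 * (s - t) ^ 4 / 24 ≤ y₀ s := by
    intro t s ht hs
    obtain ⟨q0, q1, q2, q3⟩ := hS t ht
    refine quartic_le_of_le_fourth_deriv h (fun r hr => ?_) (by linarith) (by linarith)
      (by linarith) (by linarith) hs
    obtain ⟨r0, r1, r2, r3⟩ := hS r (ht.trans hr)
    have e1 : 0 ≤ a * y₂ r := mul_nonneg ha (by linarith)
    have e2 : y₀ t ^ p ≤ y₀ r ^ p :=
      rpow_le_rpow (by linarith) (hmono t r ht hr) (by linarith)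
    have e3 : B ^ (p - 1) ≤ y₀ r ^ (p - 1) := rpow_le_rpow hB0.le r0 hp1.le
    have e4 : y₀ r * (2 * K) ≤ y₀ r ^ p := by
      rw [hpow _ (by linarith)]
      exact mul_le_mul_of_nonneg_left (hBK.trans e3) (by linarith)
    linarith
  have hseq : ∀ k : ℕ, B * L ^ k ≤ y₀ (S + 1 - (1 / 2) ^ k) := by
    intro k
    induction k with
    | zero => simpa using (hS S le_rfl).1
    | succ k ih =>
      have hk : (1 / 2 : ℝ) ^ k ≤ 1 := pow_le_one₀ (by norm_num) (by norm_num)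
      have hk0 : (0 : ℝ) < (1 / 2) ^ k := by positivity
      have hs : (1 / 2 : ℝ) ^ (k + 1) = (1 / 2) ^ k / 2 := by ring
      have e := step (S + 1 - (1 / 2) ^ k) (S + 1 - (1 / 2) ^ (k + 1)) (by linarith)
        (by rw [hs]; linarith)
      refine le_trans ?_ e
      have hx : 0 < B * L ^ k := by positivity
      have e1 : (B * L ^ k) ^ p ≤ y₀ (S + 1 - (1 / 2) ^ k) ^ p :=
        rpow_le_rpow hx.le ih (by linarith)
      have e2 : (B * L ^ k) ^ (p - 1) = B ^ (p - 1) * 16 ^ k := by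
        rw [mul_rpow hB0.le (by positivity), ← hLp, ← rpow_natCast, ← rpow_natCast,
          ← rpow_mul hL0.le, ← rpow_mul hL0.le, mul_comm (k : ℝ)]
      rw [hpow _ hx, e2] at e1
      have e3 : (S + 1 - (1 / 2) ^ (k + 1) - (S + 1 - (1 / 2) ^ k)) ^ 4
          = ((16 : ℝ) ^ k)⁻¹ / 16 := by
        have : ((1 / 2 : ℝ) ^ k) ^ 4 = ((16 : ℝ) ^ k)⁻¹ := by
          rw [← pow_mul, mul_comm, pow_mul, ← inv_pow]; norm_num
        rw [← this, hs]; ring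
      rw [e3]
      have hi : (0 : ℝ) < ((16 : ℝ) ^ k)⁻¹ := by positivity
      have hi1 : (16 : ℝ) ^ k * ((16 : ℝ) ^ k)⁻¹ = 1 := mul_inv_cancel₀ (by positivity)
      calc B * L ^ (k + 1) = B * L ^ k * (768 * L) / 768 := by ring
        _ ≤ B * L ^ k * B ^ (p - 1) / 768 := by gcongr
        _ = B * L ^ k * (B ^ (p - 1) * 16 ^ k) / 2 * (((16 : ℝ) ^ k)⁻¹ / 16) / 24 := by
          linear_combination (-(B * L ^ k * B ^ (p - 1) / 768)) * hi1
        _ ≤ _ := by gcongr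
  obtain ⟨k, hk⟩ := pow_unbounded_of_one_lt (y₀ (S + 1)) hL1
  have hk1 : (1 / 2 : ℝ) ^ k ≤ 1 := pow_le_one₀ (by norm_num) (by norm_num)
  have hk0 : (0 : ℝ) < (1 / 2) ^ k := by positivity
  have e1 := hmono (S + 1 - (1 / 2) ^ k) (S + 1) (by linarith) (by linarith)
  have e2 : 1 * L ^ k ≤ B * L ^ k := by gcongr
  linarith [hseq k]

theorem exists_le_exp_of_deriv_aux {f f' : ℝ → ℝ} {γ κ C S : ℝ} (hκ : κ ≠ γ)
    (hf : ∀ s, HasDerivAt f (f' s) s)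
    (h : ∀ s, S ≤ s → f' s + γ * f s ≤ C * exp (-κ * s)) :
    ∃ D ≥ 0, ∀ s, S ≤ s → f s * exp (γ * s) ≤ D + C / (γ - κ) * exp ((γ - κ) * s) := by
  have hne : γ - κ ≠ 0 := sub_ne_zero.2 hκ.symm
  refine ⟨|f S * exp (γ * S) - C / (γ - κ) * exp ((γ - κ) * S)|, abs_nonneg _, fun s hs => ?_⟩
  have := le_of_hasDerivAt_nonneg
    (f := fun s => C / (γ - κ) * exp ((γ - κ) * s) - f s * exp (γ * s))
    (fun s _ => ((hasDerivAt_exp_mul (γ - κ) s).const_mul (C / (γ - κ))).sub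
      ((hf s).mul (hasDerivAt_exp_mul γ s)))
    (fun s hs => by
      have h1 := mul_le_mul_of_nonneg_right (h s hs) (exp_pos (γ * s)).le
      have h2 : exp ((γ - κ) * s) = exp (-κ * s) * exp (γ * s) := by
        rw [← exp_add]; ring_nf
      have h3 : C / (γ - κ) * ((γ - κ) * exp ((γ - κ) * s)) = C * exp ((γ - κ) * s) := by
        field_simp
      rw [h3, h2]
      linarith) le_rfl hs
  have := le_abs_self (f S * exp (γ * S) - C / (γ - κ) * exp ((γ - κ) * S))
  linarith

theorem exists_le_exp_of_deriv_of_lt {f f' : ℝ → ℝ} {γ κ C S : ℝ} (hC : 0 ≤ C) (hκ : γ < κ)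
    (hf : ∀ s, HasDerivAt f (f' s) s)
    (h : ∀ s, S ≤ s → f' s + γ * f s ≤ C * exp (-κ * s)) :
    ∃ D ≥ 0, ∀ s, S ≤ s → f s ≤ D * exp (-γ * s) := by
  obtain ⟨D, hD, e⟩ := exists_le_exp_of_deriv_aux hκ.ne' hf h
  refine ⟨D, hD, fun s hs => ?_⟩
  have h1 : C / (γ - κ) * exp ((γ - κ) * s) ≤ 0 :=
    mul_nonpos_of_nonpos_of_nonneg (div_nonpos_of_nonneg_of_nonpos hC (by linarith)) (exp_pos _).le
  calc f s = f s * exp (γ * s) * exp (-γ * s) := by rw [mul_assoc, ← exp_add]; simp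
    _ ≤ D * exp (-γ * s) := by gcongr; linarith [e s hs]

theorem exists_le_exp_of_deriv_of_gt {f f' : ℝ → ℝ} {γ κ C S : ℝ} (hC : 0 ≤ C) (hκ : κ < γ)
    (hf : ∀ s, HasDerivAt f (f' s) s)
    (h : ∀ s, S ≤ s → f' s + γ * f s ≤ C * exp (-κ * s)) :
    ∃ D ≥ 0, ∀ s, S ≤ s → f s ≤ D * exp (-κ * s) := by
  obtain ⟨D, hD, e⟩ := exists_le_exp_of_deriv_aux hκ.ne hf h
  have hpos : 0 < γ - κ := by linarith
  refine ⟨D * exp (-(γ - κ) * S) + C / (γ - κ), by positivity, fun s hs => ?_⟩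
  have h1 : 1 ≤ exp (-(γ - κ) * S) * exp ((γ - κ) * s) := by
    rw [← exp_add]
    exact one_le_exp (by nlinarith)
  have h2 := mul_le_mul_of_nonneg_left h1 hD
  calc f s = f s * exp (γ * s) * exp (-γ * s) := by rw [mul_assoc, ← exp_add]; simp
    _ ≤ ((D * exp (-(γ - κ) * S) + C / (γ - κ)) * exp ((γ - κ) * s)) * exp (-γ * s) := by
      refine mul_le_mul_of_nonneg_right ?_ (exp_pos _).le
      linarith [e s hs]
    _ = _ := by rw [mul_assoc, ← exp_add]; ring_nf

/-- Positive solutions decaying to zero decay at the rate of the removable singularities. -/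
theorem IsSolutionChain.exists_le_exp {β : ℝ} (hβ : 0 < β) {y₀ y₁ y₂ y₃ : ℝ → ℝ} {S : ℝ}
    (h : IsSolutionChain ((β + 2) ^ 2 + β ^ 2)
      (fun t => y₀ t ^ (1 + 4 / β) - (β + 2) ^ 2 * β ^ 2 * y₀ t) y₀ y₁ y₂ y₃)
    (hpos : ∀ s, 0 < y₀ s) (h1 : ∀ s, S ≤ s → y₁ s ≤ 0)
    (hzero : ∀ ε > 0, ∃ s, S ≤ s ∧ y₀ s < ε) :
    ∃ D, ∃ S', ∀ s, S' ≤ s → y₀ s ≤ D * exp (-β * s) := by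
  set p := 1 + 4 / β with hp
  obtain ⟨α, hα⟩ : ∃ α, α = β + 2 := ⟨_, rfl⟩
  rw [← hα] at h
  have hα0 : 0 < α := by linarith
  have hp0 : 0 < p := by positivity
  have hanti : ∀ s t, S ≤ s → s ≤ t → y₀ t ≤ y₀ s := fun s t hs hst => by
    have := le_of_hasDerivAt_nonneg (fun s _ => (h.d₀ s).neg)
      (fun s hs => by have := h1 s hs; linarith) hs hst
    simp only [Pi.neg_apply] at this
    linarith
  have hantip : ∀ s t, S ≤ s → s ≤ t → y₀ t ^ p ≤ y₀ s ^ p := fun s t hs hst =>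
    rpow_le_rpow (hpos t).le (hanti s t hs hst) hp0.le
  have hpp : ∀ s, 0 < y₀ s ^ p := fun s => rpow_pos_of_pos (hpos s) p
  have dm3 : ∀ γ s, HasDerivAt (fun s => y₁ s + γ * y₀ s) (y₂ s + γ * y₁ s) s :=
    fun γ s => (h.d₁ s).add ((h.d₀ s).const_mul γ)
  have dm2 : ∀ s, HasDerivAt (fun s => y₂ s + (α + β) * y₁ s + α * β * y₀ s)
      (y₃ s + (α + β) * y₂ s + α * β * y₁ s) s :=
    fun s => ((h.d₂ s).add ((h.d₁ s).const_mul _)).add ((h.d₀ s).const_mul _)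
  have dm1 : ∀ s, HasDerivAt (fun s => y₃ s + α * y₂ s + -β ^ 2 * y₁ s + -(α * β ^ 2) * y₀ s)
      (α * (y₃ s + α * y₂ s + -β ^ 2 * y₁ s + -(α * β ^ 2) * y₀ s) + y₀ s ^ p) s :=
    fun s => ((((h.d₃ s).add ((h.d₂ s).const_mul _)).add ((h.d₁ s).const_mul _)).add
      ((h.d₀ s).const_mul _)).congr_deriv (by ring)
  have m1 : ∀ s, S ≤ s →
      0 ≤ y₃ s + α * y₂ s + -β ^ 2 * y₁ s + -(α * β ^ 2) * y₀ s + y₀ s ^ p / α := by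
    intro s₁ hs₁
    by_contra! hn
    have hdiv : α * (y₀ s₁ ^ p / α) = y₀ s₁ ^ p := by field_simp
    have e := fun s (hs : s₁ ≤ s) => exp_mul_le_of_deriv (κ := α)
      (fun s _ => ((dm1 s).add_const (y₀ s₁ ^ p / α)).neg)
      (fun s hs => by
        have := hantip s₁ s hs₁ hs
        simp only [Pi.neg_apply]
        linarith) hs
    simp only [Pi.neg_apply] at e
    have hd : 0 ≤ y₀ s₁ ^ p / α := (div_pos (hpp _) hα0).le
    obtain ⟨c2, hc2, S2, hS2, e2⟩ := eventually_exp_le_of_deriv (γ := -β) (κ := α)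
      (by linarith) (mul_pos (neg_pos.2 hn) (exp_pos _))
      (fun s (_ : s₁ ≤ s) => (dm2 s).neg) (fun s hs => by
        have := e s hs
        simp only [Pi.neg_apply]
        linarith)
    simp only [Pi.neg_apply] at e2
    obtain ⟨c3, hc3, S3, hS3, e3⟩ := eventually_exp_le_of_deriv (γ := α) (κ := α)
      (by linarith) hc2 (fun s _ => (dm3 β s).neg) (fun s hs => by
        have := e2 s hs
        simp only [Pi.neg_apply]
        linarith)
    simp only [Pi.neg_apply] at e3
    obtain ⟨c4, hc4, S4, hS4, e4⟩ := eventually_exp_le_of_deriv (γ := β) (κ := α)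
      (by linarith) hc3 (fun s _ => (h.d₀ s).neg) (fun s hs => by
        have := e3 s hs
        simp only [Pi.neg_apply]
        linarith)
    have := e4 S4 le_rfl
    have := hpos S4
    have : 0 < c4 * exp (α * S4) := by positivity
    simp only [Pi.neg_apply] at *
    linarith
  have m2 : ∀ s, S ≤ s → y₂ s + (α + β) * y₁ s + α * β * y₀ s ≤ y₀ s ^ p / (α * β) := by
    intro s₁ hs₁
    by_contra! hn
    have hdiv : β * (y₀ s₁ ^ p / (α * β)) = y₀ s₁ ^ p / α := by field_simp
    have e := fun s (hs : s₁ ≤ s) => exp_mul_le_of_deriv (κ := β)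
      (fun s _ => (dm2 s).sub_const (y₀ s₁ ^ p / (α * β)))
      (fun s hs => by
        have := hantip s₁ s hs₁ hs
        have := m1 s (hs₁.trans hs)
        have : y₀ s ^ p / α ≤ y₀ s₁ ^ p / α := by gcongr
        linarith) hs
    have hd : 0 ≤ y₀ s₁ ^ p / (α * β) := (div_pos (hpp _) (by positivity)).le
    obtain ⟨c3, hc3, S3, hS3, e3⟩ := eventually_exp_le_of_deriv (γ := α) (κ := β)
      (by linarith) (mul_pos (sub_pos.2 hn) (exp_pos _))
      (fun s (_ : s₁ ≤ s) => dm3 β s) (fun s hs => by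
        have := e s hs
        linarith)
    obtain ⟨c4, hc4, S4, hS4, e4⟩ := eventually_exp_le_of_deriv (γ := β) (κ := β)
      (by linarith) hc3 (fun s _ => h.d₀ s) (fun s hs => e3 s hs)
    obtain ⟨T, hT, e5⟩ := exists_forall_le_of_exp_le hc4 hβ e4 (y₀ S + 1)
    have hST : S ≤ T := hs₁.trans (hS3.le.trans (hS4.le.trans hT))
    linarith [e5 T le_rfl, hanti S T le_rfl hST]
  set β' := β * (β + 1) / (β + 4) with hβ'
  have hβ'0 : 0 < β' := by positivity
  have hβ'lt : β' < β := by
    rw [hβ', div_lt_iff₀ (by linarith)]; nlinarith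
  have hpβ : p * β' = β + 1 := by rw [hp, hβ']; field_simp
  have hαβ : 0 < α * β := by positivity
  set ε := (α - β') * (β - β') with hε
  have hε0 : 0 < ε := mul_pos (by linarith) (by linarith)
  have hp1 : 0 < p - 1 := by rw [hp]; simp; positivity
  obtain ⟨S₁, hS₁, hy1⟩ := hzero ((ε * (α * β)) ^ (1 / (p - 1))) (by positivity)
  have small : ∀ s, S₁ ≤ s → y₀ s ^ p / (α * β) ≤ ε * y₀ s := by
    intro s hs
    have hle : y₀ s ≤ (ε * (α * β)) ^ (1 / (p - 1)) := (hanti S₁ s hS₁ hs).trans hy1.le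
    have e1 : y₀ s ^ (p - 1) ≤ ε * (α * β) := by
      have := rpow_le_rpow (hpos s).le hle hp1.le
      rwa [← rpow_mul (by positivity), one_div_mul_cancel hp1.ne', rpow_one] at this
    have e2 : y₀ s ^ p = y₀ s * y₀ s ^ (p - 1) := by
      rw [← rpow_one_add' (hpos s).le (by linarith)]; ring_nf
    rw [div_le_iff₀ hαβ, e2]
    have := mul_le_mul_of_nonneg_left e1 (hpos s).le
    linarith
  obtain ⟨C1, hC1, f1⟩ := exists_le_exp_of_deriv_of_lt (γ := α + β - β') (κ := α + β - β' + 1)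
    (S := S₁) le_rfl (by linarith) (dm3 β') (fun s hs => by
      have := m2 s (hS₁.trans hs)
      have := small s hs
      rw [hε] at this
      simp only [zero_mul]
      linarith)
  obtain ⟨C2, hC2, f2⟩ := exists_le_exp_of_deriv_of_lt (γ := β') (κ := α + β - β')
    hC1 (by linarith) h.d₀ f1
  obtain ⟨C4, hC4, f4⟩ := exists_le_exp_of_deriv_of_gt (γ := α) (κ := β + 1)
    (C := C2 ^ p / (α * β)) (S := S₁) (by positivity) (by linarith) (dm3 β) (fun s hs => by
      have e1 := m2 s (hS₁.trans hs)
      have e2 := rpow_le_rpow (hpos s).le (f2 s hs) hp0.le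
      rw [mul_rpow hC2 (exp_pos _).le, ← exp_mul,
        show -β' * s * p = -(β + 1) * s by rw [← hpβ]; ring] at e2
      have e3 : y₀ s ^ p / (α * β) ≤ C2 ^ p * exp (-(β + 1) * s) / (α * β) := by gcongr
      rw [mul_div_right_comm] at e3
      linarith)
  obtain ⟨C5, -, f5⟩ := exists_le_exp_of_deriv_of_lt (γ := β) (κ := β + 1)
    hC4 (by linarith) h.d₀ f4
  exact ⟨C5, S₁, f5⟩

theorem IsSolutionChain.eq_const_of_eq {a K p l T : ℝ} {y₀ y₁ y₂ y₃ : ℝ → ℝ}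
    (hp : 1 ≤ p) (hl : 0 < l) (hK : l ^ p = K * l)
    (h : IsSolutionChain a (fun t => y₀ t ^ p - K * y₀ t) y₀ y₁ y₂ y₃)
    (hpos : ∀ t, 0 < y₀ t) (h0 : y₀ T = l) (h1 : y₁ T = 0) (h2 : y₂ T = 0) (h3 : y₃ T = 0)
    {t : ℝ} (ht : T ≤ t) : y₀ t = l := by
  have hcont : Continuous y₀ := continuous_iff_continuousAt.2 fun t => (h.d₀ t).continuousAt
  obtain ⟨R, hR⟩ := (isCompact_Icc (a := T) (b := t)).bddAbove_image hcont.continuousOn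
  have hR' : ∀ s ∈ Set.Icc T t, y₀ s ≤ R := fun s hs => hR (Set.mem_image_of_mem _ hs)
  have hlR : l ≤ R := h0 ▸ hR' T (Set.left_mem_Icc.2 ht)
  have hlip : ∀ s ∈ Set.Icc T t, |y₀ s ^ p - l ^ p| ≤ p * R ^ (p - 1) * |y₀ s - l| := by
    intro s hs
    refine (convex_Icc 0 R).norm_image_sub_le_of_norm_hasDerivWithin_le
      (f := fun x => x ^ p) (fun x hx => (hasDerivAt_rpow_const (Or.inr hp)).hasDerivWithinAt)
      (fun x hx => ?_) ⟨hl.le, hlR⟩ ⟨(hpos s).le, hR' s hs⟩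
    have hx0 : 0 ≤ x ^ (p - 1) := rpow_nonneg hx.1 _
    rw [norm_of_nonneg (by positivity)]
    gcongr
    · exact hx.1
    · exact hx.2
  set M := p * R ^ (p - 1) + |K| + |a| + 1 with hM
  have hpR : 0 ≤ p * R ^ (p - 1) := mul_nonneg (by linarith) (rpow_nonneg (by linarith) _)
  have hM1 : 1 ≤ M := by
    have := abs_nonneg K
    have := abs_nonneg a
    linarith
  have hd : ∀ s, HasDerivAt (fun s => (y₀ s - l, y₁ s, y₂ s, y₃ s))
      (y₁ s, y₂ s, y₃ s, a * y₂ s + (y₀ s ^ p - K * y₀ s)) s := fun s =>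
    ((h.d₀ s).sub_const l).prodMk ((h.d₁ s).prodMk ((h.d₂ s).prodMk (h.d₃ s)))
  have := eq_zero_of_abs_deriv_le_mul_abs_self_of_eq_zero_right (K := M) (a := T) (b := t)
    (fun s _ => (hd s).continuousAt.continuousWithinAt) (fun s _ => (hd s).hasDerivWithinAt)
    (by simp [h0, h1, h2, h3]) (fun s hs => by
      simp only [Prod.norm_mk, norm_eq_abs]
      set N := max |y₀ s - l| (max |y₁ s| (max |y₂ s| |y₃ s|)) with hN
      have n0 : |y₀ s - l| ≤ N := le_max_left _ _
      have n1 : |y₁ s| ≤ N := (le_max_left _ _).trans (le_max_right _ _)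
      have n2 : |y₂ s| ≤ N :=
        (le_max_left _ _).trans ((le_max_right _ _).trans (le_max_right _ _))
      have n3 : |y₃ s| ≤ N :=
        (le_max_right _ _).trans ((le_max_right _ _).trans (le_max_right _ _))
      have hN0 : 0 ≤ N := (abs_nonneg _).trans n0
      have hNM : N ≤ M * N := le_mul_of_one_le_left hN0 hM1
      refine max_le (n1.trans hNM) (max_le (n2.trans hNM) (max_le (n3.trans hNM) ?_))
      have e : a * y₂ s + (y₀ s ^ p - K * y₀ s)
          = a * y₂ s + ((y₀ s ^ p - l ^ p) - K * (y₀ s - l)) := by rw [hK]; ring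
      rw [e]
      calc _ ≤ |a * y₂ s| + (|y₀ s ^ p - l ^ p| + |K * (y₀ s - l)|) :=
            (abs_add_le _ _).trans (by gcongr; exact abs_sub _ _)
        _ ≤ |a| * N + (p * R ^ (p - 1) * N + |K| * N) := by
            rw [abs_mul, abs_mul]
            have := hlip s ⟨hs.1, hs.2.le⟩
            gcongr
            exact this.trans (by gcongr)
        _ ≤ M * N := by rw [hM]; linarith) t (Set.right_mem_Icc.2 ht)
  have := congrArg Prod.fst this
  simpa [sub_eq_zero] using this

/-- A positive solution that is eventually on one side of the constant solution `l` at `-∞`,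
and that is not controlled by `exp (β t)` there, is identically `l`. -/
theorem IsSolutionChain.eq_const_of_one_sided {β l e T : ℝ} (hβ : 0 < β) (hl : 0 < l)
    (hlp : l ^ (4 / β) = (β + 2) ^ 2 * β ^ 2) (he : e = 1 ∨ e = -1)
    {v₀ v₁ v₂ v₃ : ℝ → ℝ}
    (h : IsSolutionChain ((β + 2) ^ 2 + β ^ 2)
      (fun t => v₀ t ^ (1 + 4 / β) - (β + 2) ^ 2 * β ^ 2 * v₀ t) v₀ v₁ v₂ v₃)
    (hpos : ∀ t, 0 < v₀ t) (hsing : ∀ D T : ℝ, ∃ t < T, D * exp (β * t) < v₀ t)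
    (hT : ∀ t ≤ T, 0 ≤ e * (v₀ t - l)) : ∀ t, v₀ t = l := by
  set K := (β + 2) ^ 2 * β ^ 2 with hK
  set p := 1 + 4 / β with hp
  have hq : 0 < 4 / β := by positivity
  have hp1 : 1 < p := by linarith
  have hpow : ∀ x : ℝ, 0 < x → x ^ p - K * x = x * (x ^ (4 / β) - l ^ (4 / β)) := fun x hx => by
    rw [hp, rpow_add hx, rpow_one, hlp]; ring
  have hlK : l ^ p = K * l := by
    have := hpow l hl
    rw [sub_self, mul_zero] at this
    linarith
  have hGpos : ∀ x : ℝ, 0 < x → 0 < e * (x - l) → 0 < e * (x ^ p - K * x) := by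
    intro x hx hxl
    rw [hpow x hx]
    rcases he with rfl | rfl
    · have := rpow_lt_rpow hl.le (show l < x by linarith) hq
      rw [one_mul]
      exact mul_pos hx (by linarith)
    · have := rpow_lt_rpow hx.le (show x < l by linarith) hq
      have := mul_pos hx (sub_pos.2 this)
      linarith
  have hGnn : ∀ x : ℝ, 0 < x → 0 ≤ e * (x - l) → 0 ≤ e * (x ^ p - K * x) := by
    intro x hx hxl
    rcases hxl.lt_or_eq with hlt | heq
    · exact (hGpos x hx hlt).le
    · have : x = l := by
        rcases he with rfl | rfl <;> linarith
      rw [this, hlK]; simp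
  have hnb : ∀ {w₀ w₁ w₂ w₃ : ℝ → ℝ}, IsSolutionChain ((β + 2) ^ 2 + β ^ 2)
      (fun t => w₀ t ^ p - K * w₀ t) w₀ w₁ w₂ w₃ → (∀ t, 0 < w₀ t) →
      ¬ AllTendToInfinity (fun s => e * (w₀ s - l)) (fun s => e * w₁ s) (fun s => e * w₂ s)
        (fun s => e * w₃ s) := by
    intro w₀ w₁ w₂ w₃ hw hwpos hB
    rcases he with rfl | rfl
    · refine hw.not_allTendToInfinity (by positivity) hp1 fun M => ?_
      obtain ⟨S, hS⟩ := hB M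
      refine ⟨S, fun s hs => ?_⟩
      have := hS s hs
      simp only [one_mul] at this
      exact ⟨by linarith, this.2⟩
    · obtain ⟨S, hS⟩ := hB l
      linarith [hwpos S, (hS S le_rfl).1]
  obtain ⟨b, hb, hb2⟩ : ∃ b : ℝ, 0 < b ∧ (β + 2) ^ 2 + β ^ 2 = b ^ 2 :=
    ⟨√((β + 2) ^ 2 + β ^ 2), by positivity, by rw [sq_sqrt (by positivity)]⟩
  by_contra! hne
  obtain ⟨T', hT', hneT⟩ : ∃ t ≤ T, v₀ t ≠ l := by
    by_contra! hall
    have z1 : ∀ t < T, v₁ t = 0 := fun t ht => by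
      refine (h.d₀ t).unique (HasDerivAt.congr_of_eventuallyEq (hasDerivAt_const t l) ?_)
      filter_upwards [Iio_mem_nhds ht] with s hs
      exact hall s hs.le
    have z2 : ∀ t < T, v₂ t = 0 := fun t ht => by
      refine (h.d₁ t).unique (HasDerivAt.congr_of_eventuallyEq (hasDerivAt_const t 0) ?_)
      filter_upwards [Iio_mem_nhds ht] with s hs
      exact z1 s hs
    have z3 : ∀ t < T, v₃ t = 0 := fun t ht => by
      refine (h.d₂ t).unique (HasDerivAt.congr_of_eventuallyEq (hasDerivAt_const t 0) ?_)
      filter_upwards [Iio_mem_nhds ht] with s hs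
      exact z2 s hs
    obtain ⟨t, ht⟩ := hne
    rcases le_total t (T - 1) with hle | hle
    · exact ht (hall t (by linarith))
    · exact ht (h.eq_const_of_eq hp1.le hl hlK hpos (hall (T - 1) (by linarith))
        (z1 _ (by linarith)) (z2 _ (by linarith)) (z3 _ (by linarith)) hle)
  have hT'pos : 0 < e * (v₀ T' - l) := by
    refine lt_of_le_of_ne (hT T' hT') (Ne.symm (mul_ne_zero ?_ (sub_ne_zero.2 hneT)))
    rcases he with rfl | rfl <;> norm_num
  have hx := h.sub_const_mul e l
  have hr := h.reverse
  have hz := hr.sub_const_mul e l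
  have hnz := hnb hr (fun t => hpos (-t))
  rw [hb2] at hx hz
  have hznn : ∀ s, -T' ≤ s → 0 ≤ e * (v₀ (-s) - l) := fun s hs => hT (-s) (by linarith)
  rcases hz.alternative (S := -T') hb
    (fun s hs => hGnn _ (hpos _) (hznn s hs)) hznn hnz with ⟨i1, i2, i3⟩ | ⟨s₀, hs₀, hs0, hs1⟩
  · simp only [neg_neg] at i1 i2 i3
    have hbe : 0 ≤ b * (e * v₂ T') := mul_nonneg hb.le i2
    exact hnb h hpos (hx.allTendToInfinity_of_data (S := T') hb (fun s hs => hGpos _ (hpos s) hs)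
      hT'pos (by linarith) i2 (by linarith))
  · have hz0 : ∀ s, s₀ ≤ s → e * (v₀ (-s₀) - l) ≤ e * (v₀ (-s) - l) := fun s hs =>
      le_of_hasDerivAt_nonneg (fun s _ => hz.d₀ s) hs1 le_rfl hs
    have hδ := hGpos _ (hpos (-s₀)) hs0
    have hnn : ∀ s, s₀ ≤ s → 0 ≤ e * (v₀ (-s) - l) := fun s hs => hs0.le.trans (hz0 s hs)
    rcases he with rfl | rfl
    · refine hnz (hz.allTendToInfinity_of_le hb hδ (fun s hs => ?_) hnn)
      have h1 := hz0 s hs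
      simp only [hpow _ (hpos _), one_mul] at hs0 h1 hδ ⊢
      have h2 := rpow_le_rpow (hpos (-s₀)).le (show v₀ (-s₀) ≤ v₀ (-s) by linarith) hq.le
      have h3 := rpow_le_rpow hl.le (show l ≤ v₀ (-s₀) by linarith) hq.le
      exact mul_le_mul (by linarith) (by linarith) (by linarith) (hpos _).le
    · by_cases hsmall : ∀ ε > 0, ∃ s, s₀ ≤ s ∧ v₀ (-s) < ε
      · obtain ⟨D, S', hD⟩ := hr.exists_le_exp hβ (fun s => hpos (-s))
          (fun s hs => by have := hs1 s hs; linarith) hsmall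
        obtain ⟨t, ht, hlt⟩ := hsing D (-S')
        have := hD (-t) (by linarith)
        simp only [neg_neg, neg_mul_neg] at this
        linarith
      · push Not at hsmall
        obtain ⟨ε, hε, hεs⟩ := hsmall
        have h3 := rpow_lt_rpow (hpos (-s₀)).le (show v₀ (-s₀) < l by linarith) hq
        refine hnz (hz.allTendToInfinity_of_le hb
          (mul_pos hε (sub_pos.2 h3)) (fun s hs => ?_) hnn)
        have h1 := hz0 s hs
        simp only [hpow _ (hpos _)]
        have h2 := rpow_le_rpow (hpos (-s)).le (show v₀ (-s) ≤ v₀ (-s₀) by linarith) hq.le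
        have := mul_le_mul (hεs s hs)
          (show l ^ (4 / β) - v₀ (-s₀) ^ (4 / β) ≤ l ^ (4 / β) - v₀ (-s) ^ (4 / β) by linarith)
          (by linarith) (hpos _).le
        linarith

theorem hasDerivAt_iteratedDeriv_of_contDiffOn {u : ℝ → ℝ} {s : Set ℝ} {m k : ℕ}
    (hu : ContDiffOn ℝ m u s) (hs : IsOpen s) (hk : k < m) {r : ℝ} (hr : r ∈ s) :
    HasDerivAt (iteratedDeriv k u) (iteratedDeriv (k + 1) u r) r := by
  have h1 : DifferentiableAt ℝ (iteratedDeriv k u) r :=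
    (((hu.differentiableOn_iteratedDerivWithin (by exact_mod_cast hk) hs.uniqueDiffOn).congr
      (fun x hx => (iteratedDerivWithin_of_isOpen hs hx).symm)) r hr).differentiableAt
      (hs.mem_nhds hr)
  rw [iteratedDeriv_succ]
  exact h1.hasDerivAt

theorem exists_alternating_of_sign_changes_near_zero {d : ℝ → ℝ}
    (hn : ∀ R > 0, ∃ r, 0 < r ∧ r < R ∧ d r < 0) (hp : ∀ R > 0, ∃ r, 0 < r ∧ r < R ∧ 0 < d r) :
    ∃ ρ : ℕ → ℝ, StrictAnti ρ ∧ (∀ k, 0 < ρ k) ∧ ∀ k, d (ρ k) * d (ρ (k + 1)) < 0 := by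
  have hstep : ∀ x : {r : ℝ // 0 < r ∧ d r ≠ 0},
      ∃ y : {r : ℝ // 0 < r ∧ d r ≠ 0}, y.1 < x.1 ∧ d x.1 * d y.1 < 0 := by
    rintro ⟨x, hx, hdx⟩
    rcases hdx.lt_or_gt with hlt | hgt
    · obtain ⟨r, hr, hrx, hdr⟩ := hp x hx
      exact ⟨⟨r, hr, hdr.ne'⟩, hrx, mul_neg_of_neg_of_pos hlt hdr⟩
    · obtain ⟨r, hr, hrx, hdr⟩ := hn x hx
      exact ⟨⟨r, hr, hdr.ne⟩, hrx, mul_neg_of_pos_of_neg hgt hdr⟩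
  choose f hf using hstep
  obtain ⟨r, hr, -, hdr⟩ := hn 1 one_pos
  refine ⟨fun k => (f^[k] ⟨r, hr, hdr.ne⟩).1, strictAnti_nat_of_succ_lt fun k => ?_,
    fun k => (f^[k] ⟨r, hr, hdr.ne⟩).2.1, fun k => ?_⟩
  · simp only [Function.iterate_succ_apply']
    exact (hf _).1
  · simp only [Function.iterate_succ_apply']
    exact (hf _).2

/-- The Emden–Fowler transform of a radial solution of the biharmonic equation. -/
theorem exists_isSolutionChain_of_radial {β : ℝ} (hβ : 0 < β) {u : ℝ → ℝ}
    (hreg : ContDiffOn ℝ 4 u (Set.Ioi (0 : ℝ))) (hpos : ∀ r : ℝ, 0 < r → 0 < u r)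
    (heq : ∀ r : ℝ, 0 < r →
      iteratedDeriv 4 u r + (2 * (2 * β + 3) / r) * iteratedDeriv 3 u r
        + ((2 * β + 3) * (2 * β + 1) / r ^ 2) * iteratedDeriv 2 u r
        - ((2 * β + 3) * (2 * β + 1) / r ^ 3) * deriv u r = u r ^ (1 + 4 / β)) :
    ∃ v₁ v₂ v₃ : ℝ → ℝ, IsSolutionChain ((β + 2) ^ 2 + β ^ 2)
      (fun t => (exp (β * t) * u (exp t)) ^ (1 + 4 / β)
        - (β + 2) ^ 2 * β ^ 2 * (exp (β * t) * u (exp t)))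
      (fun t => exp (β * t) * u (exp t)) v₁ v₂ v₃ := by
  have du : ∀ k < 4, ∀ t, HasDerivAt (fun t => iteratedDeriv k u (exp t))
      (iteratedDeriv (k + 1) u (exp t) * exp t) t := fun k hk t =>
    (hasDerivAt_iteratedDeriv_of_contDiffOn (m := 4) (by exact_mod_cast hreg) isOpen_Ioi hk
      (exp_pos t)).comp t (hasDerivAt_exp t)
  have d0 := du 0 (by norm_num)
  have d1 := du 1 (by norm_num)
  have d2 := du 2 (by norm_num)
  have d3 := du 3 (by norm_num)
  simp only [iteratedDeriv_zero, zero_add, Nat.reduceAdd] at d0 d1 d2 d3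
  have dr : ∀ (k : ℕ) t, HasDerivAt (fun t => exp t ^ (k + 1)) ((k + 1) * exp t ^ (k + 1)) t :=
    fun k t => ((hasDerivAt_exp t).pow (k + 1)).congr_deriv (by simp; ring)
  refine ⟨fun t => exp (β * t) * (β * u (exp t) + exp t ^ (0 + 1) * iteratedDeriv 1 u (exp t)),
    fun t => exp (β * t) * (β ^ 2 * u (exp t)
      + (2 * β + 1) * (exp t ^ (0 + 1) * iteratedDeriv 1 u (exp t))
      + exp t ^ (1 + 1) * iteratedDeriv 2 u (exp t)),
    fun t => exp (β * t) * (β ^ 3 * u (exp t)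
      + (3 * β ^ 2 + 3 * β + 1) * (exp t ^ (0 + 1) * iteratedDeriv 1 u (exp t))
      + (3 * β + 3) * (exp t ^ (1 + 1) * iteratedDeriv 2 u (exp t))
      + exp t ^ (2 + 1) * iteratedDeriv 3 u (exp t)), fun t => ?_, fun t => ?_, fun t => ?_,
      fun t => ?_⟩
  · exact ((hasDerivAt_exp_mul β t).mul (d0 t)).congr_deriv (by ring)
  · refine ((hasDerivAt_exp_mul β t).mul
      (((d0 t).const_mul β).add ((dr 0 t).mul (d1 t)))).congr_deriv ?_
    simp only [Pi.add_apply, Pi.mul_apply]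
    push_cast
    ring
  · refine ((hasDerivAt_exp_mul β t).mul
      ((((d0 t).const_mul (β ^ 2)).add (((dr 0 t).mul (d1 t)).const_mul (2 * β + 1))).add
        ((dr 1 t).mul (d2 t)))).congr_deriv ?_
    simp only [Pi.add_apply, Pi.mul_apply]
    push_cast
    ring
  · refine ((hasDerivAt_exp_mul β t).mul
      (((((d0 t).const_mul (β ^ 3)).add
        (((dr 0 t).mul (d1 t)).const_mul (3 * β ^ 2 + 3 * β + 1))).add
        (((dr 1 t).mul (d2 t)).const_mul (3 * β + 3))).add
        ((dr 2 t).mul (d3 t)))).congr_deriv ?_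
    have hode := heq (exp t) (exp_pos t)
    have hE : (exp (β * t) * u (exp t)) ^ (1 + 4 / β)
        = exp (β * t) * (exp t ^ 4 * u (exp t) ^ (1 + 4 / β)) := by
      rw [mul_rpow (exp_pos _).le (hpos _ (exp_pos t)).le, ← exp_mul, ← exp_nat_mul,
        ← mul_assoc, ← exp_add]
      congr 2
      field_simp
      push_cast
      ring
    rw [hE, ← hode, ← iteratedDeriv_one]
    simp only [Pi.add_apply, Pi.mul_apply]
    have := (exp_pos t).ne'
    push_cast
    field_simp
    ring

/-- For `n ≥ 5`, any positive `C⁴` solution `u` of the radial biharmonic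
equation `Δ²u = u^((n+4)/(n-4))` on `(0,∞)` that is unbounded near `0` (non-removable
singularity) and not identically equal to the special singular solution
`u_s(r) = (n²(n-4)²/16)^((n-4)/8) r^(-(n-4)/2)` is such that `u - u_s` changes sign
infinitely many times on `(0,∞)`. -/
theorem delaunay_sign_changes (n : ℕ) (hn : 5 ≤ n) (u : ℝ → ℝ)
    (hreg : ContDiffOn ℝ 4 u (Set.Ioi (0:ℝ)))
    (hpos : ∀ r : ℝ, 0 < r → 0 < u r)
    (heq : ∀ r : ℝ, 0 < r →
      iteratedDeriv 4 u r + (2 * ((n:ℝ) - 1) / r) * iteratedDeriv 3 u r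
        + (((n:ℝ) - 1) * ((n:ℝ) - 3) / r ^ 2) * iteratedDeriv 2 u r
        - (((n:ℝ) - 1) * ((n:ℝ) - 3) / r ^ 3) * deriv u r
      = u r ^ (((n:ℝ) + 4) / ((n:ℝ) - 4)))
    (hsing : ∀ M : ℝ, ∀ ε : ℝ, 0 < ε → ∃ r : ℝ, 0 < r ∧ r < ε ∧ M < u r)
    (hne : ∃ r : ℝ, 0 < r ∧
      u r ≠ ((n:ℝ)^2 * ((n:ℝ) - 4)^2 / 16) ^ (((n:ℝ) - 4) / 8) * r ^ (-(((n:ℝ) - 4) / 2))) :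
    ∃ ρ : ℕ → ℝ, (StrictMono ρ ∨ StrictAnti ρ) ∧ (∀ k, 0 < ρ k) ∧
      ∀ k : ℕ,
        (u (ρ k) - ((n:ℝ)^2 * ((n:ℝ) - 4)^2 / 16) ^ (((n:ℝ) - 4) / 8)
            * (ρ k) ^ (-(((n:ℝ) - 4) / 2)))
        * (u (ρ (k+1)) - ((n:ℝ)^2 * ((n:ℝ) - 4)^2 / 16) ^ (((n:ℝ) - 4) / 8)
            * (ρ (k+1)) ^ (-(((n:ℝ) - 4) / 2))) < 0 := by
  have hn5 : (5 : ℝ) ≤ n := by exact_mod_cast hn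
  obtain ⟨β, hβn⟩ : ∃ β : ℝ, (n : ℝ) = 2 * β + 4 := ⟨((n : ℝ) - 4) / 2, by ring⟩
  have hβ : 0 < β := by linarith
  rw [hβn] at hne heq ⊢
  rw [show (2 * β + 4) ^ 2 * (2 * β + 4 - 4) ^ 2 / 16 = (β + 2) ^ 2 * β ^ 2 by ring,
    show (2 * β + 4 - 4) / 8 = β / 4 by ring, show (2 * β + 4 - 4) / 2 = β by ring] at hne ⊢
  set l := ((β + 2) ^ 2 * β ^ 2) ^ (β / 4) with hl
  have hl0 : 0 < l := by positivity
  have hlp : l ^ (4 / β) = (β + 2) ^ 2 * β ^ 2 := by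
    rw [hl, ← rpow_mul (by positivity)]
    field_simp
    simp
  obtain ⟨v₁, v₂, v₃, hv⟩ := exists_isSolutionChain_of_radial hβ hreg hpos (fun r hr => by
    have := heq r hr
    rw [show (2 * β + 4 + 4) / (2 * β + 4 - 4) = 1 + 4 / β by field_simp; ring,
      show 2 * β + 4 - 1 = 2 * β + 3 by ring, show 2 * β + 4 - 3 = 2 * β + 1 by ring] at this
    exact this)
  have hvd : ∀ t, exp (β * t) * u (exp t) - l
      = exp (β * t) * (u (exp t) - l * exp t ^ (-β)) := fun t => by
    have : exp (β * t) * exp t ^ (-β) = 1 := by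
      rw [← exp_mul, ← exp_add]; ring_nf; simp
    linear_combination l * this
  have key : ∀ e : ℝ, e = 1 ∨ e = -1 → ∀ R > 0,
      ∃ r, 0 < r ∧ r < R ∧ e * (u r - l * r ^ (-β)) < 0 := by
    intro e he R hR
    by_contra! hc
    have := hv.eq_const_of_one_sided (T := log R - 1) hβ hl0 hlp he
      (fun t => mul_pos (exp_pos _) (hpos _ (exp_pos t)))
      (fun D T => by
        obtain ⟨r, hr, hrT, hD⟩ := hsing D (exp T) (exp_pos T)
        refine ⟨log r, (log_lt_iff_lt_exp hr).2 hrT, ?_⟩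
        rw [exp_log hr, mul_comm]
        exact mul_lt_mul_of_pos_left hD (exp_pos _))
      (fun t ht => by
        rw [hvd, mul_left_comm]
        exact mul_nonneg (exp_pos _).le
          (hc _ (exp_pos t) ((lt_log_iff_exp_lt hR).1 (by linarith))))
    obtain ⟨r, hr, hur⟩ := hne
    have h1 := hvd (log r)
    rw [this, sub_self, exp_log hr] at h1
    exact hur (sub_eq_zero.1 ((mul_eq_zero.1 h1.symm).resolve_left (exp_pos _).ne'))
  obtain ⟨ρ, h1, h2, h3⟩ := exists_alternating_of_sign_changes_near_zero
    (d := fun r => u r - l * r ^ (-β))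
    (fun R hR => by simpa using key 1 (Or.inl rfl) R hR)
    (fun R hR => by simpa using key (-1) (Or.inr rfl) R hR)
  exact ⟨ρ, Or.inr h1, h2, h3⟩
end

section
/- Let n ≥ 5 and let v ∈ C⁴(ℝ) be a positive solution of equation (∗). Assume it is NOT the case that both v(t) → 0 as t → +∞ and v(t) → 0 as t → -∞. Then the set {t ∈ ℝ : v'(t) = 0} is infinite. -/
open Filter Topology Set

section Growth

variable {f f' f'' : ℝ → ℝ}

/-- Mean value inequality on a half-line. -/
theorem mul_sub_le_sub_of_le_hasDerivAt {c T : ℝ}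
    (hf : ∀ t, T ≤ t → HasDerivAt f (f' t) t) (h : ∀ t, T ≤ t → c ≤ f' t) {a b : ℝ}
    (ha : T ≤ a) (hab : a ≤ b) : c * (b - a) ≤ f b - f a := by
  refine Convex.mul_sub_le_image_sub_of_le_deriv (convex_Ici T)
    (fun t ht => (hf t ht).continuousAt.continuousWithinAt)
    (fun t ht => (hf t (interior_subset ht)).differentiableAt.differentiableWithinAt)
    (fun t ht => ?_) a ha b (ha.trans hab) hab
  rw [(hf t (interior_subset ht)).deriv]
  exact h t (interior_subset ht)

theorem tendsto_atTop_of_eventually_le_hasDerivAt {c : ℝ} (hc : 0 < c)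
    (hf : ∀ t, HasDerivAt f (f' t) t) (h : ∀ᶠ t in atTop, c ≤ f' t) :
    Tendsto f atTop atTop := by
  obtain ⟨T, hT⟩ := eventually_atTop.1 h
  have hlin : Tendsto (fun t => f T + c * (t - T)) atTop atTop :=
    tendsto_atTop_add_const_left _ _
      ((tendsto_atTop_add_const_right _ (-T) tendsto_id).const_mul_atTop hc)
  refine tendsto_atTop_mono' _ ?_ hlin
  filter_upwards [eventually_ge_atTop T] with t ht
  linarith [mul_sub_le_sub_of_le_hasDerivAt (fun t _ => hf t) hT le_rfl ht]

theorem tendsto_atTop_of_eventually_le_second_hasDerivAt {c : ℝ} (hc : 0 < c)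
    (hf : ∀ t, HasDerivAt f (f' t) t) (hf' : ∀ t, HasDerivAt f' (f'' t) t)
    (h : ∀ᶠ t in atTop, c ≤ f'' t) : Tendsto f atTop atTop :=
  tendsto_atTop_of_eventually_le_hasDerivAt one_pos hf
    ((tendsto_atTop_of_eventually_le_hasDerivAt hc hf' h).eventually_ge_atTop 1)

/-- Solutions of `q' + c q ≥ c M` are eventually above any level below `M`. -/
theorem eventually_le_of_hasDerivAt_add {c M N : ℝ} (hc : 0 < c)
    (hf : ∀ t, HasDerivAt f (f' t) t) (h : ∀ᶠ t in atTop, c * M ≤ f' t + c * f t)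
    (hN : N < M) : ∀ᶠ t in atTop, N ≤ f t := by
  obtain ⟨T, hT⟩ := eventually_atTop.1 h
  have hder : ∀ t, HasDerivAt (fun t => (f t - M) * Real.exp (c * t))
      ((f' t + c * f t - c * M) * Real.exp (c * t)) t := by
    intro t
    have h1 := ((hf t).sub_const M).mul (((hasDerivAt_id t).const_mul c).exp)
    refine h1.congr_deriv ?_
    simp only [id]
    ring
  have hlim : Tendsto (fun t => (f T - M) * Real.exp (c * T) * Real.exp (-(c * t))) atTop
      (𝓝 0) := by
    have h1 : Tendsto (fun t : ℝ => Real.exp (-(c * t))) atTop (𝓝 0) :=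
      Real.tendsto_exp_neg_atTop_nhds_zero.comp (tendsto_id.const_mul_atTop hc)
    simpa using h1.const_mul ((f T - M) * Real.exp (c * T))
  filter_upwards [eventually_ge_atTop T,
    hlim.eventually (lt_mem_nhds (show N - M < 0 by linarith))] with t ht h2
  have h1 := mul_sub_le_sub_of_le_hasDerivAt (c := 0) (T := T) (fun t _ => hder t)
    (fun s hs => mul_nonneg (by linarith [hT s hs]) (Real.exp_pos _).le) le_rfl ht
  have h3 : (f T - M) * Real.exp (c * T) ≤ (f t - M) * Real.exp (c * t) := by linarith
  have h4 := mul_le_mul_of_nonneg_right h3 (Real.exp_pos (-(c * t))).le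
  rw [mul_assoc (f t - M), ← Real.exp_add, add_neg_cancel, Real.exp_zero, mul_one] at h4
  linarith

/-- Solutions of `y' - c y ≥ - c M` that are frequently above `N > M` tend to infinity. -/
theorem tendsto_atTop_of_hasDerivAt_sub {c M N : ℝ} (hc : 0 < c)
    (hf : ∀ t, HasDerivAt f (f' t) t) (h : ∀ᶠ t in atTop, -(c * M) ≤ f' t - c * f t)
    (hN : M < N) (hfr : ∃ᶠ t in atTop, N ≤ f t) : Tendsto f atTop atTop := by
  obtain ⟨T, hT⟩ := eventually_atTop.1 h
  obtain ⟨a, haN, haT⟩ := (hfr.and_eventually (eventually_ge_atTop T)).exists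
  have hder : ∀ t, HasDerivAt (fun t => (f t - M) * Real.exp (-(c * t)))
      ((f' t - c * f t + c * M) * Real.exp (-(c * t))) t := by
    intro t
    have h1 := ((hf t).sub_const M).mul (((hasDerivAt_id t).const_mul c).neg.exp)
    refine h1.congr_deriv ?_
    simp only [id, Pi.neg_apply]
    ring
  have hlim : Tendsto (fun t => (f a - M) * Real.exp (-(c * a)) * Real.exp (c * t) + M)
      atTop atTop :=
    tendsto_atTop_add_const_right _ _
      ((Real.tendsto_exp_atTop.comp (tendsto_id.const_mul_atTop hc)).const_mul_atTop
        (mul_pos (by linarith) (Real.exp_pos _)))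
  refine tendsto_atTop_mono' _ ?_ hlim
  filter_upwards [eventually_ge_atTop a] with t ht
  have h1 := mul_sub_le_sub_of_le_hasDerivAt (c := 0) (T := T) (fun t _ => hder t)
    (fun s hs => mul_nonneg (by linarith [hT s hs]) (Real.exp_pos _).le) haT ht
  have h3 : (f a - M) * Real.exp (-(c * a)) ≤ (f t - M) * Real.exp (-(c * t)) := by linarith
  have h4 := mul_le_mul_of_nonneg_right h3 (Real.exp_pos (c * t)).le
  rw [mul_assoc (f t - M), ← Real.exp_add, neg_add_cancel, Real.exp_zero, mul_one] at h4
  linarith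

theorem tendsto_zero_of_hasDerivAt_add {c : ℝ} (hc : 0 < c)
    (hf : ∀ t, HasDerivAt f (f' t) t)
    (h : Tendsto (fun t => f' t + c * f t) atTop (𝓝 0)) : Tendsto f atTop (𝓝 0) := by
  refine Metric.tendsto_nhds.2 fun ε hε => ?_
  have hcε : 0 < c * (ε / 4) := by positivity
  have h1 := eventually_le_of_hasDerivAt_add (M := -(ε / 4)) (N := -(ε / 2)) hc hf
    (by filter_upwards [h.eventually (lt_mem_nhds (show -(c * (ε / 4)) < 0 by linarith))]
          with t ht using by linarith) (by linarith)
  have h2 := eventually_le_of_hasDerivAt_add (M := -(ε / 4)) (N := -(ε / 2)) hc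
    (fun t => (hf t).neg)
    (by filter_upwards [h.eventually (gt_mem_nhds hcε)]
          with t ht using by rw [Pi.neg_apply]; linarith) (by linarith)
  filter_upwards [h1, h2] with t h3 h4
  simp only [Pi.neg_apply] at h4
  rw [Real.dist_eq, sub_zero, abs_lt]
  constructor <;> linarith

theorem tendsto_zero_or_atTop_or_atBot_of_hasDerivAt_sub {c : ℝ} (hc : 0 < c)
    (hf : ∀ t, HasDerivAt f (f' t) t)
    (h : Tendsto (fun t => f' t - c * f t) atTop (𝓝 0)) :
    Tendsto f atTop (𝓝 0) ∨ Tendsto f atTop atTop ∨ Tendsto f atTop atBot := by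
  by_cases h0 : Tendsto f atTop (𝓝 0)
  · exact Or.inl h0
  refine Or.inr ?_
  rw [Metric.tendsto_nhds] at h0
  push Not at h0
  obtain ⟨ε, hε, hfr⟩ := h0
  have hcε : 0 < c * (ε / 2) := by positivity
  have hfr' : ∃ᶠ t in atTop, ε ≤ f t ∨ ε ≤ -f t := by
    refine hfr.mono fun t ht => ?_
    rw [Real.dist_eq, sub_zero] at ht
    exact le_abs.1 ht
  rcases frequently_or_distrib.1 hfr' with h1 | h1
  · refine Or.inl (tendsto_atTop_of_hasDerivAt_sub (M := ε / 2) hc hf ?_ (by linarith) h1)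
    filter_upwards [h.eventually (lt_mem_nhds (show -(c * (ε / 2)) < 0 by linarith))]
      with t ht using ht.le
  · refine Or.inr (tendsto_neg_atTop_iff.1
      (tendsto_atTop_of_hasDerivAt_sub (M := ε / 2) hc (fun t => (hf t).neg) ?_
        (by linarith) h1))
    filter_upwards [h.eventually (gt_mem_nhds hcε)] with t ht
    linarith

theorem eventually_const_mul_rpow_le {v v' : ℝ → ℝ} {k s : ℝ} (hk : 0 < k) (hs : 1 ≤ s)
    (hv : ∀ t, HasDerivAt v (v' t) t) (hvtop : Tendsto v atTop atTop)
    (hf : ∀ t, HasDerivAt f (f' t) t)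
    (h : ∀ᶠ t in atTop, 0 ≤ f t ∧ k * (v t ^ (s - 1) * v' t) ≤ f' t) :
    ∃ k' > 0, ∀ᶠ t in atTop, k' * v t ^ s ≤ f t := by
  have hs0 : 0 < s := by linarith
  obtain ⟨T, hT⟩ := eventually_atTop.1 h
  have hder : ∀ t, HasDerivAt (fun t => f t - k / s * v t ^ s)
      (f' t - k * (v t ^ (s - 1) * v' t)) t := by
    intro t
    have h1 := (hf t).sub (((hv t).rpow_const (Or.inr hs)).const_mul (k / s))
    refine h1.congr_deriv ?_
    field_simp
  refine ⟨k / s / 2, by positivity, ?_⟩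
  have hlarge := ((tendsto_rpow_atTop hs0).comp hvtop).eventually_ge_atTop (2 * v T ^ s)
  filter_upwards [eventually_ge_atTop T, hlarge] with t ht h2
  have h1 := mul_sub_le_sub_of_le_hasDerivAt (c := 0) (T := T) (fun t _ => hder t)
    (fun s hs => by linarith [(hT s hs).2]) le_rfl ht
  simp only [Function.comp] at h2
  have h3 : k / s / 2 * (2 * v T ^ s) ≤ k / s / 2 * v t ^ s :=
    mul_le_mul_of_nonneg_left h2 (by positivity)
  linarith [(hT T le_rfl).1]

theorem not_eventually_const_mul_rpow_le_hasDerivAt {v v' : ℝ → ℝ} {k s : ℝ} (hk : 0 < k)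
    (hs : 1 < s) (hv : ∀ t, HasDerivAt v (v' t) t) (hpos : ∀ t, 0 < v t) :
    ¬ ∀ᶠ t in atTop, k * v t ^ s ≤ v' t := by
  intro h
  have hder : ∀ t, HasDerivAt (fun t => -(v t ^ (1 - s))) ((s - 1) * (v t ^ (-s) * v' t)) t := by
    intro t
    refine ((hv t).rpow_const (p := 1 - s) (Or.inl (hpos t).ne')).neg.congr_deriv ?_
    rw [show 1 - s - 1 = -s by ring]
    ring
  have htop : Tendsto (fun t => -(v t ^ (1 - s))) atTop atTop := by
    refine tendsto_atTop_of_eventually_le_hasDerivAt (c := (s - 1) * k)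
      (mul_pos (by linarith) hk) hder ?_
    filter_upwards [h] with t ht
    have h1 := mul_le_mul_of_nonneg_left ht (Real.rpow_pos_of_pos (hpos t) (-s)).le
    have h2 : v t ^ (-s) * (k * v t ^ s) = k := by
      rw [mul_left_comm, ← Real.rpow_add (hpos t), neg_add_cancel, Real.rpow_zero, mul_one]
    rw [h2] at h1
    exact mul_le_mul_of_nonneg_left h1 (by linarith)
  obtain ⟨t, ht⟩ := (htop.eventually_ge_atTop 0).exists
  linarith [Real.rpow_pos_of_pos (hpos t) (1 - s)]

end Growth

/-- `v` is a positive solution of `v'''' = c² v'' - B v + v ^ p`, with successive derivatives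
`v₁`, `v₂`, `v₃`. -/
structure IsPositiveSolution (c B p : ℝ) (v v₁ v₂ v₃ : ℝ → ℝ) : Prop where
  pos : ∀ t, 0 < v t
  hasDerivAt : ∀ t, HasDerivAt v (v₁ t) t
  hasDerivAt₁ : ∀ t, HasDerivAt v₁ (v₂ t) t
  hasDerivAt₂ : ∀ t, HasDerivAt v₂ (v₃ t) t
  hasDerivAt₃ : ∀ t, HasDerivAt v₃ (c ^ 2 * v₂ t - B * v t + v t ^ p) t

namespace IsPositiveSolution

variable {c B p : ℝ} {v v₁ v₂ v₃ : ℝ → ℝ}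

theorem comp_neg (h : IsPositiveSolution c B p v v₁ v₂ v₃) :
    IsPositiveSolution c B p (fun t => v (-t)) (fun t => -v₁ (-t)) (fun t => v₂ (-t))
      (fun t => -v₃ (-t)) where
  pos t := h.pos _
  hasDerivAt t := by
    simpa [Function.comp_def] using (h.hasDerivAt (-t)).comp t (hasDerivAt_neg t)
  hasDerivAt₁ t := by
    simpa using ((h.hasDerivAt₁ (-t)).comp t (hasDerivAt_neg t)).fun_neg
  hasDerivAt₂ t := by
    simpa [Function.comp_def] using (h.hasDerivAt₂ (-t)).comp t (hasDerivAt_neg t)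
  hasDerivAt₃ t := by
    have := ((h.hasDerivAt₃ (-t)).comp t (hasDerivAt_neg t)).fun_neg
    simp only [mul_neg, mul_one, neg_neg] at this
    exact this

theorem hasDerivAt_sub (h : IsPositiveSolution c B p v v₁ v₂ v₃) (t : ℝ) :
    HasDerivAt (fun t => v₃ t - c * v₂ t)
      (c ^ 2 * v₂ t - B * v t + v t ^ p - c * v₃ t) t :=
  (h.hasDerivAt₃ t).sub ((h.hasDerivAt₂ t).const_mul c)

theorem not_tendsto_atBot (h : IsPositiveSolution c B p v v₁ v₂ v₃) :
    ¬ Tendsto v atTop atBot := fun hb => by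
  obtain ⟨t, ht⟩ := (hb.eventually_le_atBot 0).exists
  exact (h.pos t).not_ge ht

theorem not_eventually_le_neg (h : IsPositiveSolution c B p v v₁ v₂ v₃) {ε : ℝ} (hε : 0 < ε) :
    ¬ ∀ᶠ t in atTop, v₂ t ≤ -ε := fun hb =>
  h.not_tendsto_atBot (tendsto_neg_atTop_iff.1
    (tendsto_atTop_of_eventually_le_second_hasDerivAt hε (fun t => (h.hasDerivAt t).neg)
      (fun t => (h.hasDerivAt₁ t).neg)
      (by filter_upwards [hb] with t ht using by linarith)))

theorem eventually_mul_le_rpow (hp : 1 < p) (hv : Tendsto v atTop atTop) (K : ℝ) :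
    ∀ᶠ t in atTop, K * v t ≤ v t ^ p := by
  filter_upwards [((tendsto_rpow_atTop (show 0 < p - 1 by linarith)).comp hv).eventually_ge_atTop K,
    hv.eventually_gt_atTop 0] with t h1 h2
  calc K * v t ≤ v t ^ (p - 1) * v t := mul_le_mul_of_nonneg_right h1 h2.le
    _ = v t ^ p := by
      rw [← Real.rpow_add_one h2.ne', sub_add_cancel]

/-- All derivatives of an unbounded monotone solution would tend to infinity. -/
theorem tendsto_derivs_atTop (h : IsPositiveSolution c B p v v₁ v₂ v₃) (hc : 0 < c)
    (hp : 1 < p) (hv : Tendsto v atTop atTop) :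
    Tendsto v₁ atTop atTop ∧ Tendsto v₂ atTop atTop ∧ Tendsto v₃ atTop atTop := by
  have hq : Tendsto (fun t => v₃ t - c * v₂ t) atTop atTop := by
    refine tendsto_atTop.2 fun N => ?_
    refine eventually_le_of_hasDerivAt_add (M := N + 1) hc h.hasDerivAt_sub ?_ (by linarith)
    filter_upwards [eventually_mul_le_rpow hp hv (B + 1),
      hv.eventually_ge_atTop (c * (N + 1))] with t h1 h2
    linarith
  have h2 : Tendsto v₂ atTop atTop := by
    refine tendsto_atTop_of_hasDerivAt_sub (M := -2) (N := -1) hc h.hasDerivAt₂ ?_ (by norm_num)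
      fun hb => h.not_eventually_le_neg one_pos ?_
    · filter_upwards [hq.eventually_ge_atTop (c * 2)] with t ht
      linarith
    · filter_upwards [hb] with t ht using (not_le.1 ht).le
  refine ⟨tendsto_atTop_of_eventually_le_hasDerivAt one_pos h.hasDerivAt₁
    (h2.eventually_ge_atTop 1), h2, ?_⟩
  refine (hq.atTop_add_atTop (h2.const_mul_atTop hc)).congr fun t => ?_
  ring

theorem not_tendsto_atTop (h : IsPositiveSolution c B p v v₁ v₂ v₃) (hc : 0 < c)
    (hp : 1 < p) : ¬ Tendsto v atTop atTop := by
  intro hv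
  obtain ⟨hv₁, hv₂, hv₃⟩ := h.tendsto_derivs_atTop hc hp hv
  have e₁ := hv₁.eventually_gt_atTop 0
  have e₂ := hv₂.eventually_gt_atTop 0
  have e₃ := hv₃.eventually_gt_atTop 0
  obtain ⟨k₁, hk₁, b₁⟩ := eventually_const_mul_rpow_le (k := 1 / 2) (s := p + 1)
    (by norm_num) (by linarith) h.hasDerivAt hv
    (fun t => (h.hasDerivAt₃ t).mul (h.hasDerivAt₁ t)) (by
      filter_upwards [e₁, e₂, e₃, eventually_mul_le_rpow hp hv (2 * B)] with t h1 h2 h3 h4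
      refine ⟨(mul_pos h3 h1).le, ?_⟩
      rw [add_sub_cancel_right]
      have h5 : 1 / 2 * v t ^ p ≤ c ^ 2 * v₂ t - B * v t + v t ^ p := by
        have : 0 ≤ c ^ 2 * v₂ t := by positivity
        linarith
      have h6 := mul_le_mul_of_nonneg_right h5 h1.le
      have h7 : 0 ≤ v₃ t * v₂ t := by positivity
      linarith)
  obtain ⟨k₂, hk₂, b₂⟩ := eventually_const_mul_rpow_le (k := k₁) (s := p + 2)
    hk₁ (by linarith) h.hasDerivAt hv
    (fun t => (h.hasDerivAt₂ t).mul ((h.hasDerivAt₁ t).pow 2)) (by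
      filter_upwards [e₁, e₂, e₃, b₁] with t h1 h2 h3 h4
      refine ⟨by simp only [Pi.mul_apply, Pi.pow_apply]; positivity, ?_⟩
      rw [show p + 2 - 1 = p + 1 by ring]
      simp only [Pi.mul_apply, Pi.pow_apply] at h4 ⊢
      have h6 := mul_le_mul_of_nonneg_right h4 h1.le
      have h7 : 0 ≤ v₂ t ^ 2 * v₁ t := by positivity
      norm_num
      nlinarith)
  obtain ⟨k₃, hk₃, b₃⟩ := eventually_const_mul_rpow_le (k := 4 * k₂) (s := p + 3)
    (by positivity) (by linarith) h.hasDerivAt hv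
    (fun t => (h.hasDerivAt₁ t).pow 4) (by
      filter_upwards [e₁, e₂, b₂] with t h1 h2 h4
      refine ⟨by simp only [Pi.pow_apply]; positivity, ?_⟩
      rw [show p + 3 - 1 = p + 2 by ring]
      simp only [Pi.mul_apply, Pi.pow_apply] at h4 ⊢
      have h6 := mul_le_mul_of_nonneg_right h4 h1.le
      norm_num
      nlinarith)
  refine not_eventually_const_mul_rpow_le_hasDerivAt (k := k₃ ^ (1 / 4 : ℝ))
    (s := (p + 3) / 4) (by positivity) (by linarith) h.hasDerivAt h.pos ?_
  filter_upwards [e₁, b₃] with t h1 h2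
  simp only [Pi.pow_apply] at h2
  refine le_of_pow_le_pow_left₀ (n := 4) (by norm_num) h1.le (le_trans (le_of_eq ?_) h2)
  rw [mul_pow, ← Real.rpow_natCast, ← Real.rpow_natCast (_ ^ ((p + 3) / 4)),
    ← Real.rpow_mul hk₃.le, ← Real.rpow_mul (h.pos t).le]
  norm_num

/-- If a positive solution converges, its limit is an equilibrium and its derivatives tend to
zero. -/
theorem tendsto_derivs_zero (h : IsPositiveSolution c B p v v₁ v₂ v₃) (hc : 0 < c)
    (hp : 1 < p) {L : ℝ} (hv : Tendsto v atTop (𝓝 L)) :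
    L ^ p = B * L ∧ Tendsto v₁ atTop (𝓝 0) ∧ Tendsto v₂ atTop (𝓝 0) ∧
      Tendsto v₃ atTop (𝓝 0) := by
  set M : ℝ := (L ^ p - B * L) / c ^ 2 with hM
  have hMc : c ^ 2 * M = L ^ p - B * L := by rw [hM]; field_simp
  have hg : Tendsto (fun t => -B * v t + v t ^ p - c ^ 2 * M) atTop (𝓝 0) := by
    have h1 := ((hv.const_mul (-B)).add (hv.rpow_const (p := p) (Or.inr (by linarith)))).sub_const
      (c ^ 2 * M)
    rwa [show -B * L + L ^ p - c ^ 2 * M = 0 by rw [hMc]; ring] at h1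
  have hq : Tendsto (fun t => v₃ t - c * (v₂ t + M)) atTop (𝓝 0) := by
    refine tendsto_zero_of_hasDerivAt_add hc
      (fun t => (h.hasDerivAt₃ t).sub (((h.hasDerivAt₂ t).add_const M).const_mul c)) ?_
    refine hg.congr fun t => ?_
    ring
  have hnotTop : ∀ ε > 0, ¬ ∀ᶠ t in atTop, ε ≤ v₂ t := fun ε hε hb =>
    not_tendsto_nhds_of_tendsto_atTop (tendsto_atTop_of_eventually_le_second_hasDerivAt hε
      h.hasDerivAt h.hasDerivAt₁ hb) L hv
  have hy : Tendsto (fun t => v₂ t + M) atTop (𝓝 0) := by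
    rcases tendsto_zero_or_atTop_or_atBot_of_hasDerivAt_sub hc
      (fun t => (h.hasDerivAt₂ t).add_const M) hq with h1 | h1 | h1
    · exact h1
    · refine absurd ?_ (hnotTop 1 one_pos)
      filter_upwards [h1.eventually_ge_atTop (1 + M)] with t ht
      linarith
    · refine absurd ?_ (h.not_eventually_le_neg one_pos)
      filter_upwards [h1.eventually_le_atBot (-1 + M)] with t ht
      linarith
  have hv₂M : Tendsto v₂ atTop (𝓝 (-M)) := by
    simpa using hy.sub_const M
  have hM0 : M = 0 := by
    rcases lt_trichotomy M 0 with h1 | h1 | h1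
    · refine absurd ?_ (hnotTop (-M / 2) (by linarith))
      exact hv₂M.eventually (le_mem_nhds (by linarith))
    · exact h1
    · refine absurd ?_ (h.not_eventually_le_neg (half_pos h1))
      exact hv₂M.eventually (ge_mem_nhds (by linarith))
  rw [hM0, neg_zero] at hv₂M
  simp only [hM0, add_zero, mul_zero] at hq hMc
  refine ⟨by linarith, ?_, hv₂M, ?_⟩
  · have hdiff : Tendsto (fun t => v (t + 1) - v t) atTop (𝓝 0) := by
      simpa using (hv.comp (tendsto_atTop_add_const_right _ 1 tendsto_id)).sub hv
    refine Metric.tendsto_nhds.2 fun ε hε => ?_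
    have hv₂' := hv₂M.eventually (Metric.ball_mem_nhds 0 (half_pos hε))
    obtain ⟨T, hT⟩ := eventually_atTop.1 hv₂'
    simp only [Real.dist_eq, sub_zero, abs_lt] at hT
    filter_upwards [eventually_ge_atTop T,
      hdiff.eventually (Metric.ball_mem_nhds 0 (half_pos hε))] with t ht hd
    simp only [Real.dist_eq, sub_zero, abs_lt] at hd ⊢
    obtain ⟨s, hs, hs'⟩ := exists_hasDerivAt_eq_slope v v₁ (show t < t + 1 by linarith)
      (fun x _ => (h.hasDerivAt x).continuousAt.continuousWithinAt) (fun x _ => h.hasDerivAt x)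
    rw [add_sub_cancel_left, div_one] at hs'
    have h1 := mul_sub_le_sub_of_le_hasDerivAt (fun x _ => h.hasDerivAt₁ x)
      (fun x hx => (hT x hx).1.le) ht hs.1.le
    have h2 := mul_sub_le_sub_of_le_hasDerivAt (f := fun x => -v₁ x) (c := -(ε / 2))
      (fun x _ => (h.hasDerivAt₁ x).neg)
      (fun x hx => (neg_le_neg (hT x hx).2.le)) ht hs.1.le
    have h3 : ε / 2 * (s - t) ≤ ε / 2 :=
      mul_le_of_le_one_right (by linarith) (by linarith [hs.2])
    constructor <;> linarith
  · have h1 := hq.add (hv₂M.const_mul c)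
    simpa using h1

/-- A positive solution with no critical points near `+∞` converges. -/
theorem exists_tendsto (h : IsPositiveSolution c B p v v₁ v₂ v₃) (hc : 0 < c) (hp : 1 < p)
    (hcrit : ∀ᶠ t in atTop, v₁ t ≠ 0) : ∃ L, 0 ≤ L ∧ Tendsto v atTop (𝓝 L) := by
  obtain ⟨T, hT⟩ := eventually_atTop.1 hcrit
  have heq : (fun t => v (max t T)) =ᶠ[atTop] v := by
    filter_upwards [eventually_ge_atTop T] with t ht
    rw [max_eq_left ht]
  have hcvg : ∃ L, Tendsto v atTop (𝓝 L) := by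
    rcases hasDerivWithinAt_forall_lt_or_forall_gt_of_forall_ne (convex_Ici T)
      (fun t _ => (h.hasDerivAt t).hasDerivWithinAt) hT with h1 | h1
    · have hanti : Antitone fun t => v (max t T) := fun a b hab => by
        have := mul_sub_le_sub_of_le_hasDerivAt (f := fun x => -v x) (c := 0)
          (fun x _ => (h.hasDerivAt x).neg) (fun x hx => by linarith [h1 x hx])
          (le_max_right a T) (max_le_max_right T hab)
        linarith
      rcases tendsto_atTop_of_antitone hanti with h2 | ⟨L, h2⟩
      · exact absurd (h2.congr' heq) h.not_tendsto_atBot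
      · exact ⟨L, h2.congr' heq⟩
    · have hmono : Monotone fun t => v (max t T) := fun a b hab => by
        have := mul_sub_le_sub_of_le_hasDerivAt (c := 0)
          (fun x _ => h.hasDerivAt x) (fun x hx => (h1 x hx).le)
          (le_max_right a T) (max_le_max_right T hab)
        linarith
      rcases tendsto_atTop_of_monotone hmono with h2 | ⟨L, h2⟩
      · exact absurd (h2.congr' heq) (h.not_tendsto_atTop hc hp)
      · exact ⟨L, h2.congr' heq⟩
  obtain ⟨L, hL⟩ := hcvg
  exact ⟨L, ge_of_tendsto' hL fun t => (h.pos t).le, hL⟩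

end IsPositiveSolution

/-- The potential of the conserved Hamiltonian of `v'''' = c² v'' - B v + v ^ p`. -/
noncomputable def hamiltonianPotential (B p x : ℝ) : ℝ := B * x ^ 2 / 2 - x ^ (p + 1) / (p + 1)

theorem hamiltonianPotential_zero {B p : ℝ} (hp : 1 < p) : hamiltonianPotential B p 0 = 0 := by
  simp [hamiltonianPotential, Real.zero_rpow (show p + 1 ≠ 0 by linarith)]

theorem hamiltonianPotential_eq {B p L : ℝ} (hL : 0 < L) (hLp : L ^ p = B * L) :
    hamiltonianPotential B p L = B * L ^ 2 / 2 - B * L ^ 2 / (p + 1) := by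
  rw [hamiltonianPotential, Real.rpow_add_one hL.ne', hLp]
  ring

theorem hamiltonianPotential_pos {B p L : ℝ} (hB : 0 < B) (hp : 1 < p) (hL : 0 < L)
    (hLp : L ^ p = B * L) : 0 < hamiltonianPotential B p L := by
  rw [hamiltonianPotential_eq hL hLp, sub_pos]
  exact div_lt_div_of_pos_left (by positivity) (by norm_num) (by linarith)

/-- The positive equilibrium is the strict maximum of the potential. -/
theorem hamiltonianPotential_lt {B p L x : ℝ} (hB : 0 < B) (hp : 1 < p) (hL : 0 < L)
    (hLp : L ^ p = B * L) (hx : 0 < x) (hxL : x ≠ L) :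
    hamiltonianPotential B p x < hamiltonianPotential B p L := by
  obtain ⟨s, rfl⟩ : ∃ s, x = L * s := ⟨x / L, by field_simp⟩
  have hs : 0 < s := pos_of_mul_pos_right hx hL.le
  have hs1 : s ^ 2 - 1 ≠ 0 := by
    intro h1
    have : s = 1 := by nlinarith
    exact hxL (by rw [this, mul_one])
  have h1 := one_add_mul_self_lt_rpow_one_add (s := s ^ 2 - 1) (by nlinarith [sq_nonneg s]) hs1
    (p := (p + 1) / 2) (by linarith)
  rw [add_sub_cancel, ← Real.rpow_natCast, ← Real.rpow_mul hs.le,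
    show ((2 : ℕ) : ℝ) * ((p + 1) / 2) = p + 1 by push_cast; ring, Real.rpow_natCast] at h1
  rw [hamiltonianPotential_eq hL hLp, hamiltonianPotential, Real.mul_rpow hL.le hs.le,
    Real.rpow_add_one hL.ne' p, hLp]
  have hp1 : 0 < p + 1 := by linarith
  have hBL : 0 < B * L ^ 2 / (p + 1) := by positivity
  have h2 := mul_lt_mul_of_pos_left h1 hBL
  have h3 : B * L ^ 2 / (p + 1) * (1 + (p + 1) / 2 * (s ^ 2 - 1))
      = B * L ^ 2 / (p + 1) + B * L ^ 2 * (s ^ 2 - 1) / 2 := by field_simp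
  have h4 : B * L * L * s ^ (p + 1) / (p + 1) = B * L ^ 2 / (p + 1) * s ^ (p + 1) := by ring
  rw [h4]
  linarith

theorem eq_of_rpow_eq_mul {B p x y : ℝ} (hp : 1 < p) (hx : 0 < x) (hy : 0 < y)
    (hxp : x ^ p = B * x) (hyp : y ^ p = B * y) : x = y := by
  have key : ∀ z : ℝ, 0 < z → z ^ p = B * z → z ^ (p - 1) = B := fun z hz hzp => by
    rw [Real.rpow_sub_one hz.ne', hzp]
    field_simp
  exact Real.rpow_left_injOn (show p - 1 ≠ 0 by linarith) hx.le hy.le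
    ((key x hx hxp).trans (key y hy hyp).symm)

namespace IsPositiveSolution

variable {c B p : ℝ} {v v₁ v₂ v₃ : ℝ → ℝ}

/-- Conservation of the Hamiltonian. -/
theorem hamiltonian_eq (h : IsPositiveSolution c B p v v₁ v₂ v₃) (hp : 1 < p) (s t : ℝ) :
    v₃ s * v₁ s - v₂ s ^ 2 / 2 - c ^ 2 * v₁ s ^ 2 / 2 + hamiltonianPotential B p (v s) =
      v₃ t * v₁ t - v₂ t ^ 2 / 2 - c ^ 2 * v₁ t ^ 2 / 2 + hamiltonianPotential B p (v t) := by
  have hder : ∀ t, HasDerivAt (fun t => v₃ t * v₁ t - v₂ t ^ 2 / 2 - c ^ 2 * v₁ t ^ 2 / 2 +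
      hamiltonianPotential B p (v t)) 0 t := by
    intro t
    unfold hamiltonianPotential
    have h1 := ((((h.hasDerivAt₃ t).mul (h.hasDerivAt₁ t)).sub
      (((h.hasDerivAt₂ t).pow 2).div_const 2)).sub
      ((((h.hasDerivAt₁ t).pow 2).const_mul (c ^ 2)).div_const 2)).add
      (((((h.hasDerivAt t).pow 2).const_mul B).div_const 2).sub
      (((h.hasDerivAt t).rpow_const (p := p + 1) (Or.inr (by linarith))).div_const (p + 1)))
    refine h1.congr_deriv ?_
    rw [add_sub_cancel_right]
    have hp1 : p + 1 ≠ 0 := by linarith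
    field_simp
    norm_num
    ring
  exact is_const_of_deriv_eq_zero (fun t => (hder t).differentiableAt)
    (fun t => (hder t).deriv) s t

/-- The energy of a convergent solution is the potential at its limit. -/
theorem hamiltonian_eq_of_tendsto (h : IsPositiveSolution c B p v v₁ v₂ v₃) (hc : 0 < c)
    (hp : 1 < p) {L : ℝ} (hv : Tendsto v atTop (𝓝 L)) (s : ℝ) :
    v₃ s * v₁ s - v₂ s ^ 2 / 2 - c ^ 2 * v₁ s ^ 2 / 2 + hamiltonianPotential B p (v s) =
      hamiltonianPotential B p L := by
  obtain ⟨-, h1, h2, h3⟩ := h.tendsto_derivs_zero hc hp hv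
  have hlim := (((h3.mul h1).sub ((h2.pow 2).div_const 2)).sub
    (((h1.pow 2).const_mul (c ^ 2)).div_const 2)).add
    ((((hv.pow 2).const_mul B).div_const 2).sub
      ((hv.rpow_const (p := p + 1) (Or.inr (by linarith))).div_const (p + 1)))
  refine tendsto_nhds_unique (tendsto_const_nhds.congr fun t => h.hamiltonian_eq hp s t)
    (hlim.trans (le_of_eq ?_))
  simp [hamiltonianPotential]

/-- A positive solution converging to the positive equilibrium at both ends is constant. -/
theorem eq_of_tendsto_of_tendsto (h : IsPositiveSolution c B p v v₁ v₂ v₃) (hc : 0 < c)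
    (hB : 0 < B) (hp : 1 < p) {L : ℝ} (hL : 0 < L) (hLp : L ^ p = B * L)
    (htop : Tendsto v atTop (𝓝 L)) (hbot : Tendsto v atBot (𝓝 L)) (t : ℝ) : v t = L := by
  have hcrit : ∀ x, v₁ x = 0 → v x = L := by
    intro x hx
    by_contra hne
    have h1 := h.hamiltonian_eq_of_tendsto hc hp htop x
    rw [hx] at h1
    linarith [hamiltonianPotential_lt hB hp hL hLp (h.pos x) hne, sq_nonneg (v₂ x)]
  have hcont : Continuous v :=
    continuous_iff_continuousAt.2 fun x => (h.hasDerivAt x).continuousAt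
  have hcoc : Tendsto v (cocompact ℝ) (𝓝 L) := by
    rw [cocompact_eq_atBot_atTop]
    exact hbot.sup htop
  rcases lt_trichotomy (v t) L with h1 | h1 | h1
  · obtain ⟨x, hx⟩ := hcont.exists_forall_le' t (hcoc.eventually (le_mem_nhds h1))
    have := hcrit x (IsLocalMin.hasDerivAt_eq_zero (Eventually.of_forall hx) (h.hasDerivAt x))
    linarith [hx t]
  · exact h1
  · obtain ⟨x, hx⟩ := hcont.exists_forall_ge' t (hcoc.eventually (ge_mem_nhds h1))
    have := hcrit x (IsLocalMax.hasDerivAt_eq_zero (Eventually.of_forall hx) (h.hasDerivAt x))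
    linarith [hx t]

theorem infinite_setOf_eq_zero (h : IsPositiveSolution c B p v v₁ v₂ v₃) (hc : 0 < c)
    (hB : 0 < B) (hp : 1 < p) (hlim : ¬ (Tendsto v atTop (𝓝 0) ∧ Tendsto v atBot (𝓝 0))) :
    {t | v₁ t = 0}.Infinite := by
  intro hfin
  have hne : ∀ᶠ t in cocompact ℝ, v₁ t ≠ 0 := hfin.isCompact.compl_mem_cocompact
  rw [cocompact_eq_atBot_atTop, eventually_sup] at hne
  obtain ⟨L, hL0, hL⟩ := h.exists_tendsto hc hp hne.2
  obtain ⟨L', hL'0, hL'⟩ := h.comp_neg.exists_tendsto hc hp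
    (by filter_upwards [tendsto_neg_atTop_atBot.eventually hne.1] with t ht
          using neg_ne_zero.2 ht)
  have hbot : Tendsto v atBot (𝓝 L') := by
    simpa [Function.comp_def] using hL'.comp tendsto_neg_atBot_atTop
  have hLp := (h.tendsto_derivs_zero hc hp hL).1
  have hL'p := (h.comp_neg.tendsto_derivs_zero hc hp hL').1
  have hE : hamiltonianPotential B p L = hamiltonianPotential B p L' := by
    rw [← h.hamiltonian_eq_of_tendsto hc hp hL 0,
      ← h.comp_neg.hamiltonian_eq_of_tendsto hc hp hL' 0]
    simp
  have hpos : 0 < L ∧ 0 < L' := by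
    rcases hL0.eq_or_lt with rfl | hLpos <;> rcases hL'0.eq_or_lt with rfl | hL'pos
    · exact absurd ⟨hL, hbot⟩ hlim
    · rw [hamiltonianPotential_zero hp] at hE
      exact absurd hE (hamiltonianPotential_pos hB hp hL'pos hL'p).ne
    · rw [hamiltonianPotential_zero hp] at hE
      exact absurd hE (hamiltonianPotential_pos hB hp hLpos hLp).ne'
    · exact ⟨hLpos, hL'pos⟩
  obtain rfl := eq_of_rpow_eq_mul hp hpos.1 hpos.2 hLp hL'p
  have hconst := h.eq_of_tendsto_of_tendsto hc hB hp hpos.1 hLp hL hbot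
  obtain rfl : v = fun _ => L := funext hconst
  obtain ⟨t, ht⟩ := hne.2.exists
  exact ht ((h.hasDerivAt t).unique (hasDerivAt_const t L))

end IsPositiveSolution

/-- For `n ≥ 5`, a positive `C⁴` solution `v` of
`v'''' + K₂ v'' + K₀ v = v^((n+4)/(n-4))` on `ℝ` which does not tend to `0` at both
`+∞` and `-∞` has infinitely many critical points. -/
theorem infinitely_many_critical_points (n : ℕ) (hn : 5 ≤ n) (v : ℝ → ℝ)
    (hreg : ContDiff ℝ 4 v) (hpos : ∀ t : ℝ, 0 < v t)
    (heq : ∀ t : ℝ,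
      iteratedDeriv 4 v t + (-(((n:ℝ)^2 - 4*(n:ℝ) + 8) / 2)) * iteratedDeriv 2 v t
        + ((n:ℝ)^2 * ((n:ℝ) - 4)^2 / 16) * v t = v t ^ (((n:ℝ) + 4) / ((n:ℝ) - 4)))
    (hlim : ¬ (Filter.Tendsto v Filter.atTop (nhds 0) ∧
               Filter.Tendsto v Filter.atBot (nhds 0))) :
    {t : ℝ | deriv v t = 0}.Infinite := by
  have hn' : (5 : ℝ) ≤ n := by exact_mod_cast hn
  have hder : ∀ m : ℕ, (m : WithTop ℕ∞) < 4 → ∀ t,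
      HasDerivAt (iteratedDeriv m v) (iteratedDeriv (m + 1) v t) t := fun m hm t => by
    rw [iteratedDeriv_succ]
    exact (hreg.differentiable_iteratedDeriv m hm t).hasDerivAt
  have hA : 0 < ((n : ℝ) ^ 2 - 4 * n + 8) / 2 := by nlinarith
  have hsol : IsPositiveSolution (√(((n : ℝ) ^ 2 - 4 * n + 8) / 2))
      ((n : ℝ) ^ 2 * ((n : ℝ) - 4) ^ 2 / 16) (((n : ℝ) + 4) / ((n : ℝ) - 4)) v (deriv v)
      (iteratedDeriv 2 v) (iteratedDeriv 3 v) := by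
    refine ⟨hpos, ?_, ?_, hder 2 (by norm_num), fun t => ?_⟩
    · simpa using hder 0 (by norm_num)
    · simpa using hder 1 (by norm_num)
    · refine (hder 3 (by norm_num) t).congr_deriv ?_
      rw [Real.sq_sqrt hA.le]
      linarith [heq t]
  refine hsol.infinite_setOf_eq_zero (Real.sqrt_pos.2 hA) ?_ ?_ hlim
  · have : (0 : ℝ) < n - 4 := by linarith
    positivity
  · rw [lt_div_iff₀ (by linarith)]
    linarith
end

section
/- Let n ≥ 5 and let v ∈ C⁴(ℝ) be a nonconstant positive solution of equation (∗) such that the set {t ∈ ℝ : v'(t) = 0} is unbounded above and unbounded below. Then v(t₀) > l at every local maximum point t₀ of v, and v(s₀) < l at every local minimum point s₀ of v, where l = K₀^{(n-4)/8}. -/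
/-- A comparison principle for fourth-order differential inequalities written as a first-order
system: nonnegative initial data propagate to the first and second derivatives. -/
lemma nonneg_of_fourth_order_ineq {x0 x1 x2 x3 x4 : ℝ → ℝ} {a C T : ℝ}
    (h0 : ∀ t, HasDerivAt x0 (x1 t) t) (h1 : ∀ t, HasDerivAt x1 (x2 t) t)
    (h2 : ∀ t, HasDerivAt x2 (x3 t) t) (h3 : ∀ t, HasDerivAt x3 (x4 t) t)
    (ha : 0 ≤ a) (hC : 0 ≤ C)
    (hineq : ∀ t ∈ Set.Icc 0 T, a * x2 t - C * max (-x0 t) 0 ≤ x4 t)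
    (i0 : 0 ≤ x0 0) (i1 : 0 ≤ x1 0) (i2 : 0 ≤ x2 0) (i3 : 0 ≤ x3 0) :
    ∀ t ∈ Set.Icc 0 T, 0 ≤ x1 t ∧ 0 ≤ x2 t := by
  set k : ℝ := a + C + 1 with hk
  have hk1 : 1 ≤ k := by linarith
  have hk0 : 0 < k := by linarith
  have hkC : a * k ^ 2 + C ≤ k ^ 4 := by
    have h2' : 1 ≤ k ^ 2 := one_le_pow₀ hk1
    have h3' : k ≤ k ^ 2 := by nlinarith
    nlinarith [mul_le_mul_of_nonneg_right h3' (sq_nonneg k), mul_nonneg hC (sub_nonneg.2 h2')]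
  have key : ∀ ε > 0, ∀ t ∈ Set.Icc 0 T,
      0 < x1 t + ε * k * Real.exp (k * t) ∧ 0 < x2 t + ε * k ^ 2 * Real.exp (k * t) := by
    intro ε hε
    have hexp : ∀ t, HasDerivAt (fun s => Real.exp (k * s)) (k * Real.exp (k * t)) t := by
      intro t
      simpa [mul_comm] using ((hasDerivAt_id t).const_mul k).exp
    set y0 : ℝ → ℝ := fun t => x0 t + ε * Real.exp (k * t) with hy0
    set y1 : ℝ → ℝ := fun t => x1 t + ε * k * Real.exp (k * t) with hy1
    set y2 : ℝ → ℝ := fun t => x2 t + ε * k ^ 2 * Real.exp (k * t) with hy2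
    set y3 : ℝ → ℝ := fun t => x3 t + ε * k ^ 3 * Real.exp (k * t) with hy3
    have d0 : ∀ t, HasDerivAt y0 (y1 t) t := fun t =>
      ((h0 t).add ((hexp t).const_mul ε)).congr_deriv (by simp only [hy1]; ring)
    have d1 : ∀ t, HasDerivAt y1 (y2 t) t := fun t =>
      ((h1 t).add ((hexp t).const_mul (ε * k))).congr_deriv (by simp only [hy2]; ring)
    have d2 : ∀ t, HasDerivAt y2 (y3 t) t := fun t =>
      ((h2 t).add ((hexp t).const_mul (ε * k ^ 2))).congr_deriv (by simp only [hy3]; ring)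
    have d3 : ∀ t, HasDerivAt y3 (x4 t + ε * k ^ 4 * Real.exp (k * t)) t := fun t =>
      ((h3 t).add ((hexp t).const_mul (ε * k ^ 3))).congr_deriv (by ring)
    have c0 : Continuous y0 := continuous_iff_continuousAt.2 fun t => (d0 t).continuousAt
    have c1 : Continuous y1 := continuous_iff_continuousAt.2 fun t => (d1 t).continuousAt
    have c2 : Continuous y2 := continuous_iff_continuousAt.2 fun t => (d2 t).continuousAt
    have c3 : Continuous y3 := continuous_iff_continuousAt.2 fun t => (d3 t).continuousAt
    have p0 : 0 < y0 0 := by simp only [hy0, mul_zero, Real.exp_zero]; positivity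
    have p1 : 0 < y1 0 := by simp only [hy1, mul_zero, Real.exp_zero]; positivity
    have p2 : 0 < y2 0 := by simp only [hy2, mul_zero, Real.exp_zero]; positivity
    have p3 : 0 < y3 0 := by simp only [hy3, mul_zero, Real.exp_zero]; positivity
    set m : ℝ → ℝ := fun t => min (min (y0 t) (y1 t)) (min (y2 t) (y3 t)) with hm
    have hmc : Continuous m := by fun_prop
    have hmpos : ∀ t, 0 < m t ↔ (0 < y0 t ∧ 0 < y1 t) ∧ 0 < y2 t ∧ 0 < y3 t := by
      intro t; simp only [hm, lt_min_iff]
    have hall : ∀ t ∈ Set.Icc 0 T, 0 < m t := by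
      by_contra! hcon
      obtain ⟨b, hb, hmb⟩ := hcon
      have hcpt : IsCompact (Set.Icc 0 T ∩ {t | m t ≤ 0}) :=
        isCompact_Icc.inter_right (isClosed_le hmc continuous_const)
      obtain ⟨τ, ⟨hτT, hτm⟩, hτmin⟩ := hcpt.exists_isLeast ⟨b, hb, hmb⟩
      have hbefore : ∀ t, 0 ≤ t → t < τ → 0 < m t := by
        intro t ht htτ
        by_contra! hle
        exact absurd (hτmin ⟨⟨ht, htτ.le.trans hτT.2⟩, hle⟩) (not_le.2 htτ)
      have hstep : ∀ y y' : ℝ → ℝ, (∀ t, HasDerivAt y (y' t) t) →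
          (∀ t, 0 < t → t < τ → 0 ≤ y' t) → y 0 ≤ y τ := by
        intro y y' hy hy'
        refine monotoneOn_of_deriv_nonneg (convex_Icc 0 τ)
          (fun t _ => (hy t).continuousAt.continuousWithinAt)
          (fun t _ => (hy t).differentiableAt.differentiableWithinAt) ?_
          (Set.left_mem_Icc.2 hτT.1) (Set.right_mem_Icc.2 hτT.1) hτT.1
        intro t ht
        rw [interior_Icc] at ht
        rw [(hy t).deriv]
        exact hy' t ht.1 ht.2
      have q0 := hstep y0 y1 d0 fun t ht htτ => ((hmpos t).1 (hbefore t ht.le htτ)).1.2.le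
      have q1 := hstep y1 y2 d1 fun t ht htτ => ((hmpos t).1 (hbefore t ht.le htτ)).2.1.le
      have q2 := hstep y2 y3 d2 fun t ht htτ => ((hmpos t).1 (hbefore t ht.le htτ)).2.2.le
      have q3 := hstep y3 _ d3 fun t ht htτ => by
        obtain ⟨⟨r0, -⟩, r2, -⟩ := (hmpos t).1 (hbefore t ht.le htτ)
        have hE : 0 < Real.exp (k * t) := Real.exp_pos _
        have hx := hineq t ⟨ht.le, htτ.le.trans hτT.2⟩
        have hmax : max (-x0 t) 0 ≤ ε * Real.exp (k * t) :=
          max_le (by simp only [hy0] at r0; linarith) (by positivity)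
        have e1 := mul_le_mul_of_nonneg_left hmax hC
        have e2 := mul_nonneg ha r2.le
        simp only [hy2] at e2
        have e3 := mul_le_mul_of_nonneg_right hkC (mul_pos hε hE).le
        linarith
      exact absurd ((hmpos τ).2 ⟨⟨p0.trans_le q0, p1.trans_le q1⟩, p2.trans_le q2,
        p3.trans_le q3⟩) (not_lt.2 hτm)
    intro t ht
    have := (hmpos t).1 (hall t ht)
    exact ⟨this.1.2, this.2.1⟩
  have hlim : ∀ x b : ℝ, 0 < b → (∀ ε > 0, 0 < x + ε * b) → 0 ≤ x := by
    intro x b hb hx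
    by_contra! hneg
    have := hx (-x / b) (div_pos (neg_pos.2 hneg) hb)
    rw [div_mul_cancel₀ _ hb.ne'] at this
    linarith
  intro t ht
  have hE : 0 < Real.exp (k * t) := Real.exp_pos _
  exact ⟨hlim _ (k * Real.exp (k * t)) (by positivity) fun ε hε => by
      have := (key ε hε t ht).1; rwa [mul_assoc] at this,
    hlim _ (k ^ 2 * Real.exp (k * t)) (by positivity) fun ε hε => by
      have := (key ε hε t ht).2; rwa [mul_assoc] at this⟩

/-- If a function vanishes on `[0, ∞)`, so does its derivative. -/
lemma deriv_eq_zero_of_eq_zero_on_Ici {f f' : ℝ → ℝ} (hf : ∀ t, HasDerivAt f (f' t) t)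
    (h : ∀ t, 0 ≤ t → f t = 0) : ∀ t, 0 ≤ t → f' t = 0 := by
  intro t ht
  have hd : HasDerivWithinAt f 0 (Set.Ici t) t :=
    (hasDerivWithinAt_const t (Set.Ici t) (0 : ℝ)).congr
      (fun s hs => h s (ht.trans hs)) (h t ht)
  exact (uniqueDiffWithinAt_Ici t).eq_deriv _ (hf t).hasDerivWithinAt hd

/-- A solution of `v'''' = a v'' + f(v)` with nonnegative initial data (relative to the
equilibrium `l` and up to the sign `σ`) along the half-line in direction `τ` and with critical
points arbitrarily far in that direction is constant on the half-line. -/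
lemma deriv_eq_zero_on_halfline {v v1 v2 v3 v4 f : ℝ → ℝ} {a l σ τ t₀ : ℝ}
    (h0 : ∀ t, HasDerivAt v (v1 t) t) (h1 : ∀ t, HasDerivAt v1 (v2 t) t)
    (h2 : ∀ t, HasDerivAt v2 (v3 t) t) (h3 : ∀ t, HasDerivAt v3 (v4 t) t)
    (ha : 0 ≤ a) (hv4 : ∀ t, v4 t = a * v2 t + f (v t))
    (hf : LocallyLipschitz f) (hfl : f l = 0)
    (hσ : σ * σ = 1) (hτ : τ * τ = 1)
    (hsign : ∀ t, 0 ≤ σ * (v t - l) → 0 ≤ σ * f (v t))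
    (i0 : 0 ≤ σ * (v t₀ - l)) (i1 : v1 t₀ = 0) (i2 : 0 ≤ σ * v2 t₀) (i3 : 0 ≤ σ * τ * v3 t₀)
    (hcrit : ∀ T, ∃ t, T ≤ t ∧ v1 (t₀ + τ * t) = 0) :
    ∀ t, 0 ≤ t → v1 (t₀ + τ * t) = 0 ∧ v2 (t₀ + τ * t) = 0 ∧ v3 (t₀ + τ * t) = 0 := by
  have hσ0 : σ ≠ 0 := by rintro rfl; simp at hσ
  have hτ0 : τ ≠ 0 := by rintro rfl; simp at hτ
  have hline : ∀ t, HasDerivAt (fun s => t₀ + τ * s) τ t := fun t => by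
    simpa using ((hasDerivAt_id t).const_mul τ).const_add t₀
  have hcomp : ∀ {g g' : ℝ → ℝ}, (∀ t, HasDerivAt g (g' t) t) →
      ∀ t, HasDerivAt (fun s => g (t₀ + τ * s)) (τ * g' (t₀ + τ * t)) t := fun hg t =>
    ((hg (t₀ + τ * t)).comp t (hline t)).congr_deriv (mul_comm _ _)
  have e0 : ∀ t, HasDerivAt (fun s => σ * (v (t₀ + τ * s) - l)) (σ * τ * v1 (t₀ + τ * t)) t :=
    fun t => (((hcomp h0 t).sub_const l).const_mul σ).congr_deriv (by ring)
  have e1 : ∀ t, HasDerivAt (fun s => σ * τ * v1 (t₀ + τ * s)) (σ * v2 (t₀ + τ * t)) t :=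
    fun t => ((hcomp h1 t).const_mul (σ * τ)).congr_deriv (by
      linear_combination σ * v2 (t₀ + τ * t) * hτ)
  have e2 : ∀ t, HasDerivAt (fun s => σ * v2 (t₀ + τ * s)) (σ * τ * v3 (t₀ + τ * t)) t :=
    fun t => ((hcomp h2 t).const_mul σ).congr_deriv (by ring)
  have e3 : ∀ t, HasDerivAt (fun s => σ * τ * v3 (t₀ + τ * s)) (σ * v4 (t₀ + τ * t)) t :=
    fun t => ((hcomp h3 t).const_mul (σ * τ)).congr_deriv (by
      linear_combination σ * v4 (t₀ + τ * t) * hτ)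
  have hvc : Continuous v := continuous_iff_continuousAt.2 fun t => (h0 t).continuousAt
  have hnonneg : ∀ T, ∀ t ∈ Set.Icc 0 T,
      0 ≤ σ * τ * v1 (t₀ + τ * t) ∧ 0 ≤ σ * v2 (t₀ + τ * t) := by
    intro T
    have hcpt : IsCompact (insert l ((fun s => v (t₀ + τ * s)) '' Set.Icc 0 T)) :=
      (isCompact_Icc.image (by fun_prop)).insert l
    obtain ⟨C, hC⟩ := hf.locallyLipschitzOn.exists_lipschitzOnWith_of_compact hcpt
    refine nonneg_of_fourth_order_ineq (C := C) e0 e1 e2 e3 ha C.2 ?_ (by simpa using i0)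
      (by simp [i1]) (by simpa using i2) (by simpa using i3)
    intro t ht
    simp only [hv4 (t₀ + τ * t)]
    suffices -((C : ℝ) * max (-(σ * (v (t₀ + τ * t) - l))) 0) ≤ σ * f (v (t₀ + τ * t)) by
      linarith
    rcases le_total 0 (σ * (v (t₀ + τ * t) - l)) with hz | hz
    · rw [max_eq_right (by linarith)]
      simpa using hsign _ hz
    · rw [max_eq_left (by linarith)]
      have hd := hC.dist_le_mul _ (Set.mem_insert_of_mem _ (Set.mem_image_of_mem _ ht)) _
        (Set.mem_insert _ _)
      have hσabs : |σ| = 1 := by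
        rcases mul_self_eq_one_iff.1 hσ with rfl | rfl <;> simp
      rw [Real.dist_eq, Real.dist_eq, hfl, sub_zero] at hd
      have hl1 : |σ * f (v (t₀ + τ * t))| = |f (v (t₀ + τ * t))| := by
        rw [abs_mul, hσabs, one_mul]
      have hl2 : -(σ * (v (t₀ + τ * t) - l)) = |v (t₀ + τ * t) - l| := by
        rw [← abs_of_nonpos hz, abs_mul, hσabs, one_mul]
      rw [hl2]
      have := neg_abs_le (σ * f (v (t₀ + τ * t)))
      rw [hl1] at this
      linarith
  have z1 : ∀ t, 0 ≤ t → v1 (t₀ + τ * t) = 0 := by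
    intro t ht
    obtain ⟨T, hT, hT0⟩ := hcrit t
    have hmono : MonotoneOn (fun s => σ * τ * v1 (t₀ + τ * s)) (Set.Icc 0 T) := by
      refine monotoneOn_of_deriv_nonneg (convex_Icc 0 T)
        (fun s _ => (e1 s).continuousAt.continuousWithinAt)
        (fun s _ => (e1 s).differentiableAt.differentiableWithinAt) fun s hs => ?_
      rw [(e1 s).deriv]
      exact (hnonneg T s (interior_subset hs)).2
    have hle : σ * τ * v1 (t₀ + τ * t) ≤ σ * τ * v1 (t₀ + τ * T) :=
      hmono ⟨ht, hT⟩ ⟨ht.trans hT, le_rfl⟩ hT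
    rw [hT0, mul_zero] at hle
    have := le_antisymm hle (hnonneg T t ⟨ht, hT⟩).1
    simpa [hσ0, hτ0] using this
  have z2 : ∀ t, 0 ≤ t → v2 (t₀ + τ * t) = 0 := fun t ht => by
    simpa [hτ0] using deriv_eq_zero_of_eq_zero_on_Ici (hcomp h1) z1 t ht
  have z3 : ∀ t, 0 ≤ t → v3 (t₀ + τ * t) = 0 := fun t ht => by
    simpa [hτ0] using deriv_eq_zero_of_eq_zero_on_Ici (hcomp h2) z2 t ht
  exact fun t ht => ⟨z1 t ht, z2 t ht, z3 t ht⟩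

/-- A solution of `v'''' = a v'' + f(v)` with critical points unbounded in both directions has
vanishing derivative as soon as it has a critical point at which `v - l` and `v''` both have
the (weak) sign `σ`. -/
lemma deriv_eq_zero_of_critical_point {v v1 v2 v3 v4 f : ℝ → ℝ} {a l σ t₀ : ℝ}
    (h0 : ∀ t, HasDerivAt v (v1 t) t) (h1 : ∀ t, HasDerivAt v1 (v2 t) t)
    (h2 : ∀ t, HasDerivAt v2 (v3 t) t) (h3 : ∀ t, HasDerivAt v3 (v4 t) t)
    (ha : 0 ≤ a) (hv4 : ∀ t, v4 t = a * v2 t + f (v t))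
    (hf : LocallyLipschitz f) (hfl : f l = 0) (hσ : σ * σ = 1)
    (hsign : ∀ t, 0 ≤ σ * (v t - l) → 0 ≤ σ * f (v t))
    (i0 : 0 ≤ σ * (v t₀ - l)) (i1 : v1 t₀ = 0) (i2 : 0 ≤ σ * v2 t₀)
    (hup : ∀ T, ∃ t, T ≤ t ∧ v1 t = 0) (hdown : ∀ T, ∃ t, t ≤ T ∧ v1 t = 0) :
    ∀ t, v1 t = 0 := by
  have hdir : ∀ τ : ℝ, τ * τ = 1 → 0 ≤ σ * τ * v3 t₀ → ∀ t, 0 ≤ t →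
      v1 (t₀ + τ * t) = 0 ∧ v2 (t₀ + τ * t) = 0 ∧ v3 (t₀ + τ * t) = 0 := by
    intro τ hτ i3
    refine deriv_eq_zero_on_halfline h0 h1 h2 h3 ha hv4 hf hfl hσ hτ hsign i0 i1 i2 i3 ?_
    intro T
    rcases mul_self_eq_one_iff.1 hτ with rfl | rfl
    · obtain ⟨t, ht, hz⟩ := hup (t₀ + T)
      exact ⟨t - t₀, by linarith, by simpa using hz⟩
    · obtain ⟨t, ht, hz⟩ := hdown (t₀ - T)
      exact ⟨t₀ - t, by linarith, by simpa using hz⟩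
  have hv3 : v3 t₀ = 0 := by
    rcases le_total 0 (σ * v3 t₀) with h | h
    · simpa using (hdir 1 (by norm_num) (by linarith) 0 le_rfl).2.2
    · simpa using (hdir (-1) (by norm_num) (by linarith) 0 le_rfl).2.2
  intro t
  rcases le_total t₀ t with h | h
  · simpa using (hdir 1 (by norm_num) (by simp [hv3]) (t - t₀) (by linarith)).1
  · simpa using (hdir (-1) (by norm_num) (by simp [hv3]) (t₀ - t) (by linarith)).1

/-- The second-order necessary condition at a local minimum. -/
lemma IsLocalMin.second_deriv_nonneg {v v1 v2 : ℝ → ℝ} {s : ℝ}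
    (h0 : ∀ t, HasDerivAt v (v1 t) t) (h1 : ∀ t, HasDerivAt v1 (v2 t) t)
    (hmin : IsLocalMin v s) : 0 ≤ v2 s := by
  by_contra! hneg
  have hd : deriv v = v1 := funext fun t => (h0 t).deriv
  have hmax : IsLocalMax v s :=
    isLocalMax_of_deriv_deriv_neg (by rwa [hd, (h1 s).deriv])
      hmin.deriv_eq_zero (h0 s).continuousAt
  have hconst : v =ᶠ[nhds s] fun _ => v s := by
    filter_upwards [hmin, hmax] with t ht ht' using le_antisymm ht' ht
  have := hconst.deriv.deriv_eq
  rw [hd, (h1 s).deriv] at this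
  simp at this
  exact hneg.ne this

/-- The second-order necessary condition at a local maximum. -/
lemma IsLocalMax.second_deriv_nonpos {v v1 v2 : ℝ → ℝ} {s : ℝ}
    (h0 : ∀ t, HasDerivAt v (v1 t) t) (h1 : ∀ t, HasDerivAt v1 (v2 t) t)
    (hmax : IsLocalMax v s) : v2 s ≤ 0 := by
  have := IsLocalMin.second_deriv_nonneg (v := fun t => -v t) (fun t => (h0 t).neg)
    (fun t => (h1 t).neg) hmax.neg
  linarith


/-- For `n ≥ 5`, a nonconstant positive `C⁴` solution `v` of
`v'''' + K₂ v'' + K₀ v = v^((n+4)/(n-4))` whose set of critical points is unbounded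
above and below satisfies `v(t₀) > l` at every local maximum point and `v(s₀) < l` at
every local minimum point, where `l = K₀^((n-4)/8)`. -/
theorem local_extrema_vs_l (n : ℕ) (hn : 5 ≤ n) (v : ℝ → ℝ)
    (hreg : ContDiff ℝ 4 v) (hpos : ∀ t : ℝ, 0 < v t)
    (hnonconst : ∃ a b : ℝ, v a ≠ v b)
    (heq : ∀ t : ℝ,
      iteratedDeriv 4 v t + (-(((n:ℝ)^2 - 4*(n:ℝ) + 8) / 2)) * iteratedDeriv 2 v t
        + ((n:ℝ)^2 * ((n:ℝ) - 4)^2 / 16) * v t = v t ^ (((n:ℝ) + 4) / ((n:ℝ) - 4)))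
    (hup : ¬ BddAbove {t : ℝ | deriv v t = 0})
    (hdown : ¬ BddBelow {t : ℝ | deriv v t = 0}) :
    (∀ t₀ : ℝ, IsLocalMax v t₀ →
      ((n:ℝ)^2 * ((n:ℝ) - 4)^2 / 16) ^ (((n:ℝ) - 4) / 8) < v t₀) ∧
    (∀ s₀ : ℝ, IsLocalMin v s₀ →
      v s₀ < ((n:ℝ)^2 * ((n:ℝ) - 4)^2 / 16) ^ (((n:ℝ) - 4) / 8)) := by

  have hn' : (5 : ℝ) ≤ n := by exact_mod_cast hn
  have hn4 : 0 < (n : ℝ) - 4 := by linarith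
  set p : ℝ := ((n : ℝ) + 4) / ((n : ℝ) - 4) with hp
  set K : ℝ := (n : ℝ) ^ 2 * ((n : ℝ) - 4) ^ 2 / 16 with hK
  set l : ℝ := K ^ (((n : ℝ) - 4) / 8) with hl
  have hKpos : 0 < K := by positivity
  have hlpos : 0 < l := Real.rpow_pos_of_pos hKpos _
  have hp1 : p - 1 = 8 / ((n : ℝ) - 4) := by rw [hp]; field_simp; ring
  have hp1pos : 0 < p - 1 := by rw [hp1]; positivity
  have hlK : l ^ (p - 1) = K := by
    rw [hl, ← Real.rpow_mul hKpos.le, hp1]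
    have : ((n : ℝ) - 4) / 8 * (8 / ((n : ℝ) - 4)) = 1 := by field_simp
    rw [this, Real.rpow_one]
  have hfactor : ∀ x : ℝ, 0 < x → x ^ p - K * x = (x ^ (p - 1) - l ^ (p - 1)) * x := by
    intro x hx
    rw [hlK, sub_mul, Real.rpow_sub_one hx.ne', div_mul_cancel₀ _ hx.ne']
  have hf : LocallyLipschitz fun x : ℝ => x ^ p - K * x := by
    have : ContDiff ℝ 1 fun x : ℝ => x ^ p - K * x :=
      (Real.contDiff_rpow_const_of_le (by norm_num; linarith)).sub (contDiff_const.mul contDiff_id)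
    exact this.locallyLipschitz
  have hfl : l ^ p - K * l = 0 := by rw [hfactor l hlpos, sub_self, zero_mul]
  have hder : ∀ k < 4, ∀ t, HasDerivAt (iteratedDeriv k v) (iteratedDeriv (k + 1) v t) t := by
    intro k hk t
    rw [iteratedDeriv_succ]
    exact (hreg.differentiable_iteratedDeriv k (by exact_mod_cast hk) t).hasDerivAt
  have h0 : ∀ t, HasDerivAt v (iteratedDeriv 1 v t) t := by
    simpa using hder 0 (by norm_num)
  have h1 := hder 1 (by norm_num)
  have h2 := hder 2 (by norm_num)
  have h3 := hder 3 (by norm_num)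
  have hv1 : iteratedDeriv 1 v = deriv v := iteratedDeriv_one
  have hnotconst : ¬ ∀ t, iteratedDeriv 1 v t = 0 := by
    intro h
    obtain ⟨x, y, hxy⟩ := hnonconst
    exact hxy (is_const_of_deriv_eq_zero (fun t => (h0 t).differentiableAt)
      (fun t => by rw [← hv1]; exact h t) x y)
  have hup' : ∀ T, ∃ t, T ≤ t ∧ iteratedDeriv 1 v t = 0 := by
    intro T
    obtain ⟨t, ht, hT⟩ := not_bddAbove_iff.1 hup T
    exact ⟨t, hT.le, by rw [hv1]; exact ht⟩
  have hdown' : ∀ T, ∃ t, t ≤ T ∧ iteratedDeriv 1 v t = 0 := by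
    intro T
    obtain ⟨t, ht, hT⟩ := not_bddBelow_iff.1 hdown T
    exact ⟨t, hT.le, by rw [hv1]; exact ht⟩
  have ha : (0 : ℝ) ≤ ((n : ℝ) ^ 2 - 4 * n + 8) / 2 := by nlinarith
  have hv4 : ∀ t, iteratedDeriv 4 v t
      = ((n : ℝ) ^ 2 - 4 * n + 8) / 2 * iteratedDeriv 2 v t + (v t ^ p - K * v t) := by
    intro t
    linear_combination heq t
  refine ⟨fun t₀ hmax => ?_, fun s₀ hmin => ?_⟩
  · by_contra! hle
    refine hnotconst (deriv_eq_zero_of_critical_point (σ := -1) h0 h1 h2 h3 ha hv4 hf hfl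
      (by norm_num) (fun t ht => ?_) (by linarith) (hv1 ▸ hmax.deriv_eq_zero)
      (by linarith [hmax.second_deriv_nonpos h0 h1]) hup' hdown')
    have := Real.rpow_le_rpow (hpos t).le (by linarith : v t ≤ l) hp1pos.le
    simp only [hfactor _ (hpos t)]
    nlinarith [hpos t]
  · by_contra! hle
    refine hnotconst (deriv_eq_zero_of_critical_point (σ := 1) h0 h1 h2 h3 ha hv4 hf hfl
      (by norm_num) (fun t ht => ?_) (by linarith) (hv1 ▸ hmin.deriv_eq_zero)
      (by linarith [hmin.second_deriv_nonneg h0 h1]) hup' hdown')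
    have := Real.rpow_le_rpow hlpos.le (by linarith : l ≤ v t) hp1pos.le
    simp only [hfactor _ (hpos t)]
    nlinarith [hpos t]
end

section
/- Let n ≥ 5 and let v ∈ C⁴(ℝ) be a positive solution of equation (∗) such that v(t) → 0 as t → +∞ and v(t) → 0 as t → -∞. Then for every integer k ≥ 1, the k-th derivative satisfies v⁽ᵏ⁾(t) → 0 as t → +∞ and as t → -∞. -/
open Filter Topology Asymptotics

theorem tendsto_atTop_of_hasDerivAt_tendsto_atTop {f f' : ℝ → ℝ}
    (hf : ∀ t, HasDerivAt f (f' t) t) (h : Tendsto f' atTop atTop) :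
    Tendsto f atTop atTop := by
  obtain ⟨T, hT⟩ := eventually_atTop.1 (h.eventually_ge_atTop 1)
  have hmono : MonotoneOn (fun t => f t - t) (Set.Ici T) := by
    refine monotoneOn_of_hasDerivWithinAt_nonneg (f' := fun t => f' t - 1) (convex_Ici T)
      (fun t _ => ((hf t).sub (hasDerivAt_id t)).continuousAt.continuousWithinAt)
      (fun t _ => ((hf t).sub (hasDerivAt_id t)).hasDerivWithinAt) fun t ht => ?_
    rw [interior_Ici] at ht
    linarith [hT t (le_of_lt ht)]
  refine tendsto_atTop_mono' atTop ?_ (tendsto_atTop_add_const_right atTop (f T - T) tendsto_id)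
  filter_upwards [eventually_ge_atTop T] with t ht
  have := hmono (Set.mem_Ici.2 le_rfl) (Set.mem_Ici.2 ht) ht
  simp only [id] at *
  linarith

/-- A one-sided maximum principle on the line: a subsolution `u = α v'' + β v` of
`u'' - μ² u ≥ 0` with `v` bounded satisfies `u' + μ u ≤ 0`. -/
theorem add_mul_nonpos_of_subsolution {v₀ v₁ v₂ v₃ v₄ : ℝ → ℝ} {α β μ M : ℝ} (hμ : 0 < μ)
    (h₀ : ∀ t, HasDerivAt v₀ (v₁ t) t) (h₁ : ∀ t, HasDerivAt v₁ (v₂ t) t)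
    (h₂ : ∀ t, HasDerivAt v₂ (v₃ t) t) (h₃ : ∀ t, HasDerivAt v₃ (v₄ t) t)
    (hM : ∀ t, |v₀ t| ≤ M)
    (hsub : ∀ t, 0 ≤ (α * v₄ t + β * v₂ t) - μ ^ 2 * (α * v₂ t + β * v₀ t)) (t : ℝ) :
    (α * v₃ t + β * v₁ t) + μ * (α * v₂ t + β * v₀ t) ≤ 0 := by
  by_contra! hpos
  set s : ℝ → ℝ := fun t => (α * v₃ t + β * v₁ t) + μ * (α * v₂ t + β * v₀ t) with hs
  have hbdd (c : ℝ) (τ : ℝ) : -(|c| * M) ≤ c * v₀ τ := by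
    have : |c * v₀ τ| ≤ |c| * M := by
      rw [abs_mul]; exact mul_le_mul_of_nonneg_left (hM τ) (abs_nonneg c)
    exact (abs_le.1 this).1
  have hexp (τ : ℝ) : HasDerivAt (fun τ => Real.exp (-μ * τ)) (Real.exp (-μ * τ) * (-μ)) τ := by
    simpa using ((hasDerivAt_id τ).const_mul (-μ)).exp
  have hmono : Monotone fun τ => Real.exp (-μ * τ) * s τ := by
    refine monotone_of_hasDerivAt_nonneg (f' := fun τ => Real.exp (-μ * τ) *
      ((α * v₄ τ + β * v₂ τ) - μ ^ 2 * (α * v₂ τ + β * v₀ τ))) (fun τ => ?_)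
      fun τ => mul_nonneg (Real.exp_pos _).le (hsub τ)
    have hs' : HasDerivAt s ((α * v₄ τ + β * v₂ τ) + μ * (α * v₃ τ + β * v₁ τ)) τ :=
      (((h₃ τ).const_mul α).add ((h₁ τ).const_mul β)).add
        ((((h₂ τ).const_mul α).add ((h₀ τ).const_mul β)).const_mul μ)
    refine ((hexp τ).mul hs').congr_deriv ?_
    simp only [hs]
    ring
  have hs_top : Tendsto s atTop atTop := by
    have hE : Tendsto (fun τ => Real.exp (-μ * t) * s t * Real.exp (μ * τ)) atTop atTop :=
      (Real.tendsto_exp_atTop.comp (tendsto_id.const_mul_atTop hμ)).const_mul_atTop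
        (mul_pos (Real.exp_pos _) hpos)
    refine tendsto_atTop_mono' atTop ?_ hE
    filter_upwards [eventually_ge_atTop t] with τ hτ
    calc Real.exp (-μ * t) * s t * Real.exp (μ * τ)
        ≤ Real.exp (-μ * τ) * s τ * Real.exp (μ * τ) :=
          mul_le_mul_of_nonneg_right (hmono hτ) (Real.exp_pos _).le
      _ = s τ * Real.exp (-μ * τ + μ * τ) := by rw [Real.exp_add]; ring
      _ = s τ := by simp
  have hF : Tendsto (fun τ => α * v₂ τ + μ * α * v₁ τ + β * v₀ τ) atTop atTop := by
    refine tendsto_atTop_of_hasDerivAt_tendsto_atTop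
      (f' := fun τ => α * v₃ τ + μ * α * v₂ τ + β * v₁ τ)
      (fun τ => (((h₂ τ).const_mul α).add ((h₁ τ).const_mul (μ * α))).add ((h₀ τ).const_mul β)) ?_
    refine (tendsto_atTop_add_right_of_le atTop _ hs_top (hbdd (-(μ * β)))).congr fun τ => ?_
    simp only [hs]
    ring
  have hG : Tendsto (fun τ => α * v₁ τ + μ * α * v₀ τ) atTop atTop := by
    refine tendsto_atTop_of_hasDerivAt_tendsto_atTop (f' := fun τ => α * v₂ τ + μ * α * v₁ τ)
      (fun τ => ((h₁ τ).const_mul α).add ((h₀ τ).const_mul (μ * α))) ?_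
    refine (tendsto_atTop_add_right_of_le atTop _ hF (hbdd (-β))).congr fun τ => ?_
    ring
  have hH : Tendsto (fun τ => α * v₀ τ) atTop atTop := by
    refine tendsto_atTop_of_hasDerivAt_tendsto_atTop (fun τ => (h₀ τ).const_mul α) ?_
    refine (tendsto_atTop_add_right_of_le atTop _ hG (hbdd (-(μ * α)))).congr fun τ => ?_
    ring
  obtain ⟨τ, hτ⟩ := (hH.eventually_gt_atTop (|-α| * M)).exists
  linarith [hbdd (-α) τ]

/-- Maximum principle on the line: a subsolution `u = α v'' + β v` of `u'' - μ² u ≥ 0` with `v`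
bounded satisfies `|u'| ≤ -μ u`; in particular it is nonpositive. -/
theorem abs_deriv_le_of_subsolution {v₀ v₁ v₂ v₃ v₄ : ℝ → ℝ} {α β μ M : ℝ} (hμ : 0 < μ)
    (h₀ : ∀ t, HasDerivAt v₀ (v₁ t) t) (h₁ : ∀ t, HasDerivAt v₁ (v₂ t) t)
    (h₂ : ∀ t, HasDerivAt v₂ (v₃ t) t) (h₃ : ∀ t, HasDerivAt v₃ (v₄ t) t)
    (hM : ∀ t, |v₀ t| ≤ M)
    (hsub : ∀ t, 0 ≤ (α * v₄ t + β * v₂ t) - μ ^ 2 * (α * v₂ t + β * v₀ t)) (t : ℝ) :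
    |α * v₃ t + β * v₁ t| ≤ -(μ * (α * v₂ t + β * v₀ t)) := by
  have hfwd := add_mul_nonpos_of_subsolution hμ h₀ h₁ h₂ h₃ hM hsub t
  have hneg {f f' : ℝ → ℝ} (hf : ∀ t, HasDerivAt f (f' t) t) (τ : ℝ) :
      HasDerivAt (fun τ => f (-τ)) (-f' (-τ)) τ :=
    ((hf (-τ)).scomp τ (hasDerivAt_neg τ)).congr_deriv (by simp)
  have hbwd := add_mul_nonpos_of_subsolution (v₀ := fun τ => v₀ (-τ)) (v₁ := fun τ => -v₁ (-τ))
    (v₂ := fun τ => v₂ (-τ)) (v₃ := fun τ => -v₃ (-τ)) (v₄ := fun τ => v₄ (-τ)) hμ (hneg h₀)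
    (fun τ => (hneg h₁ τ).neg.congr_deriv (neg_neg _)) (hneg h₂)
    (fun τ => (hneg h₃ τ).neg.congr_deriv (neg_neg _)) (fun τ => hM (-τ)) (fun τ => hsub (-τ)) (-t)
  simp only [neg_neg] at hbwd
  rw [abs_le]
  constructor <;> linarith

theorem iteratedDeriv_rpow_isBigO {v : ℝ → ℝ} (hv : ∀ m : ℕ, ContDiff ℝ m v)
    (hpos : ∀ t, 0 < v t) {j : ℕ} (hj : ∀ i ≤ j, iteratedDeriv i v =O[⊤] v) (q : ℝ) :
    iteratedDeriv j (fun t => v t ^ q) =O[⊤] fun t => v t ^ q := by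
  induction j using Nat.strong_induction_on generalizing q with
  | _ j ih =>
    cases j with
    | zero => simpa using isBigO_refl (fun t => v t ^ q) ⊤
    | succ j =>
      have hd (t : ℝ) : HasDerivAt v (deriv v t) t :=
        ((hv 1).differentiable one_ne_zero t).hasDerivAt
      have hderiv : deriv (fun t => v t ^ q) = fun t => q * (v t ^ (q - 1) * deriv v t) := by
        funext t
        rw [((hd t).rpow_const (p := q) (Or.inl (hpos t).ne')).deriv]
        ring
      have hC (m : ℕ) : ContDiff ℝ m (deriv v) :=
        (contDiff_succ_iff_deriv.1 (by exact_mod_cast hv (m + 1))).2.2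
      have hsum : iteratedDeriv (j + 1) (fun t => v t ^ q) = fun t => q *
          ∑ i ∈ Finset.range (j + 1), ((j.choose i : ℝ) *
            iteratedDeriv i (fun t => v t ^ (q - 1)) t) * iteratedDeriv (j - i + 1) v t := by
        rw [iteratedDeriv_succ', hderiv]
        funext t
        rw [iteratedDeriv_const_mul_field, iteratedDeriv_fun_mul
          ((hv j).rpow_const_of_ne fun t => (hpos t).ne').contDiffAt (hC j).contDiffAt]
        simp only [iteratedDeriv_succ']
      rw [hsum]
      refine (IsBigO.fun_sum fun i hi => ?_).const_mul_left q
      have hi' : i ≤ j := Nat.lt_succ_iff.1 (Finset.mem_range.1 hi)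
      have hmul := ((ih i (by omega) (fun l hl => hj l (by omega)) (q - 1)).const_mul_left
        (j.choose i : ℝ)).mul (hj (j - i + 1) (by omega))
      refine hmul.congr_right fun t => ?_
      rw [← Real.rpow_add_one (hpos t).ne', sub_add_cancel]

/-- Bootstrapping: positive `C⁴` solutions are smooth. -/
theorem contDiff_of_iteratedDeriv_four_eq {v : ℝ → ℝ} {a b p : ℝ} (hreg : ContDiff ℝ 4 v)
    (hpos : ∀ t, 0 < v t)
    (heq : iteratedDeriv 4 v = fun t => v t ^ p - (a * iteratedDeriv 2 v t + b * v t)) (m : ℕ) :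
    ContDiff ℝ m v := by
  suffices h : ∀ m : ℕ, ContDiff ℝ (m + 4 : ℕ) v from
    (h m).of_le (by exact_mod_cast Nat.le_add_right m 4)
  clear m
  intro m
  induction m with
  | zero => exact_mod_cast hreg
  | succ m ih =>
    have hle {k l : ℕ} (hkl : k ≤ l) (h : ContDiff ℝ l v) : ContDiff ℝ k v :=
      h.of_le (by exact_mod_cast hkl)
    have h2 : ContDiff ℝ (m + 1 : ℕ) (iteratedDeriv 2 v) := by
      rw [iteratedDeriv_eq_iterate]
      exact (hle (k := m + 1 + 2) (by omega) ih).iterate_deriv' (m + 1) 2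
    have h4 : ContDiff ℝ (m + 1 : ℕ) (iteratedDeriv 4 v) := by
      rw [heq]
      have h0 := hle (k := m + 1) (by omega) ih
      exact (h0.rpow_const_of_ne fun t => (hpos t).ne').sub
        ((contDiff_const.mul h2).add (contDiff_const.mul h0))
    have hstep (i k : ℕ) (hi : i < 4) (h : ContDiff ℝ k (iteratedDeriv (i + 1) v)) :
        ContDiff ℝ (k + 1 : ℕ) (iteratedDeriv i v) := by
      push_cast
      refine contDiff_succ_iff_deriv.2 ⟨?_, by simp, by rwa [← iteratedDeriv_succ]⟩
      exact hreg.differentiable_iteratedDeriv i (by exact_mod_cast hi)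
    have := hstep 0 _ (by norm_num) (hstep 1 _ (by norm_num)
      (hstep 2 _ (by norm_num) (hstep 3 _ (by norm_num) h4)))
    rw [iteratedDeriv_zero] at this
    exact hle (by omega) this

/-- Derivatives up to order three of a bounded positive solution of
`(D² - μ²)(D² - ν²) v = v ^ p`, `p ≥ 1`, are dominated by the solution itself. -/
theorem iteratedDeriv_isBigO_of_le_three {v : ℝ → ℝ} {μ ν p M : ℝ} (hν : 0 < ν) (hμν : ν < μ)
    (hp : 1 ≤ p) (hreg : ContDiff ℝ 4 v) (hpos : ∀ t, 0 < v t) (hM : ∀ t, v t ≤ M)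
    (heq : iteratedDeriv 4 v = fun t => v t ^ p -
      (-(μ ^ 2 + ν ^ 2) * iteratedDeriv 2 v t + μ ^ 2 * ν ^ 2 * v t)) :
    iteratedDeriv 1 v =O[⊤] v ∧ iteratedDeriv 2 v =O[⊤] v ∧ iteratedDeriv 3 v =O[⊤] v := by
  have hμ : 0 < μ := hν.trans hμν
  have hd (i : ℕ) (hi : i < 4) (t : ℝ) :
      HasDerivAt (iteratedDeriv i v) (iteratedDeriv (i + 1) v t) t := by
    rw [iteratedDeriv_succ]
    exact (hreg.differentiable_iteratedDeriv i (by exact_mod_cast hi) t).hasDerivAt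
  have h₀ := hd 0 (by norm_num)
  have h₁ := hd 1 (by norm_num)
  have h₂ := hd 2 (by norm_num)
  have h₃ := hd 3 (by norm_num)
  have hM' (t : ℝ) : |iteratedDeriv 0 v t| ≤ M := by
    rw [iteratedDeriv_zero, abs_of_pos (hpos t)]; exact hM t
  norm_num only at h₀ h₁ h₂ h₃
  have hrpow (t : ℝ) : 0 < v t ^ p := Real.rpow_pos_of_pos (hpos t) p
  have hode (t : ℝ) := congrFun heq t
  have hw (t : ℝ) := abs_deriv_le_of_subsolution (α := 1) (β := -ν ^ 2) hμ h₀ h₁ h₂ h₃ hM'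
    (fun t => by rw [hode t, iteratedDeriv_zero]; linarith [hrpow t]) t
  simp only [iteratedDeriv_zero] at hw
  have hw_nonpos (t : ℝ) : iteratedDeriv 2 v t ≤ ν ^ 2 * v t := by
    have := (abs_nonneg _).trans (hw t)
    nlinarith
  have hv (t : ℝ) := abs_deriv_le_of_subsolution (α := 0) (β := -1) hν h₀ h₁ h₂ h₃ hM'
    (fun t => by rw [iteratedDeriv_zero]; linarith [hw_nonpos t]) t
  simp only [iteratedDeriv_zero] at hv
  have hgap : 0 < μ ^ 2 - ν ^ 2 := by nlinarith
  set C := M ^ (p - 1) / (μ ^ 2 - ν ^ 2) with hC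
  have hCgap : C * (μ ^ 2 - ν ^ 2) = M ^ (p - 1) := div_mul_cancel₀ _ hgap.ne'
  have hMpos : 0 < M := (hpos 0).trans_le (hM 0)
  have hCpos : 0 < C := div_pos (Real.rpow_pos_of_pos hMpos _) hgap
  have hpow (t : ℝ) : v t ^ p ≤ C * (μ ^ 2 - ν ^ 2) * v t := by
    rw [hCgap, show p = p - 1 + 1 by ring, Real.rpow_add_one (hpos t).ne', add_sub_cancel_right]
    exact mul_le_mul_of_nonneg_right
      (Real.rpow_le_rpow (hpos t).le (hM t) (by linarith)) (hpos t).le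
  have hW (t : ℝ) := abs_deriv_le_of_subsolution (α := -1) (β := ν ^ 2 - C) hμ h₀ h₁ h₂ h₃ hM'
    (fun t => by
      rw [hode t, iteratedDeriv_zero]
      nlinarith [hpow t, mul_nonneg hCpos.le (sub_nonneg.2 (hw_nonpos t))]) t
  simp only [iteratedDeriv_zero] at hW
  have hW_le (t : ℝ) : (ν ^ 2 - C) * v t ≤ iteratedDeriv 2 v t := by
    have := (abs_nonneg _).trans (hW t)
    nlinarith
  have hO₁ : iteratedDeriv 1 v =O[⊤] v := by
    refine isBigO_top.2 ⟨ν, fun t => ?_⟩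
    have := hv t
    rw [zero_mul, zero_add, zero_mul, zero_add, neg_one_mul, abs_neg] at this
    rw [Real.norm_eq_abs, Real.norm_of_nonneg (hpos t).le]
    linarith
  have hO₂ : iteratedDeriv 2 v =O[⊤] v := by
    refine isBigO_top.2 ⟨ν ^ 2 + C, fun t => ?_⟩
    rw [Real.norm_eq_abs, Real.norm_of_nonneg (hpos t).le, abs_le]
    have := mul_pos (pow_pos hν 2) (hpos t)
    have := mul_pos hCpos (hpos t)
    constructor <;> linarith [hW_le t, hw_nonpos t]
  refine ⟨hO₁, hO₂, ?_⟩
  have hO : (fun t => 1 * iteratedDeriv 3 v t + -ν ^ 2 * iteratedDeriv 1 v t) =O[⊤] v := by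
    refine isBigO_top.2 ⟨μ * C, fun t => ?_⟩
    rw [Real.norm_eq_abs, Real.norm_of_nonneg (hpos t).le]
    nlinarith [hw t, mul_le_mul_of_nonneg_left (hW_le t) hμ.le]
  refine (hO.add (hO₁.const_mul_left (ν ^ 2))).congr_left fun t => ?_
  ring

/-- All derivatives of a bounded positive solution of `(D² - μ²)(D² - ν²) v = v ^ p`, `p ≥ 1`,
are dominated by the solution itself. -/
theorem iteratedDeriv_isBigO {v : ℝ → ℝ} {μ ν p M : ℝ} (hν : 0 < ν) (hμν : ν < μ)
    (hp : 1 ≤ p) (hreg : ContDiff ℝ 4 v) (hpos : ∀ t, 0 < v t) (hM : ∀ t, v t ≤ M)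
    (heq : iteratedDeriv 4 v = fun t => v t ^ p -
      (-(μ ^ 2 + ν ^ 2) * iteratedDeriv 2 v t + μ ^ 2 * ν ^ 2 * v t)) (k : ℕ) :
    iteratedDeriv k v =O[⊤] v := by
  have hsmooth := contDiff_of_iteratedDeriv_four_eq hreg hpos heq
  obtain ⟨hO₁, hO₂, hO₃⟩ := iteratedDeriv_isBigO_of_le_three hν hμν hp hreg hpos hM heq
  have hpow : (fun t => v t ^ p) =O[⊤] v := by
    refine isBigO_top.2 ⟨M ^ (p - 1), fun t => ?_⟩
    rw [Real.norm_of_nonneg (Real.rpow_nonneg (hpos t).le p), Real.norm_of_nonneg (hpos t).le,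
      show p = p - 1 + 1 by ring, Real.rpow_add_one (hpos t).ne', add_sub_cancel_right]
    exact mul_le_mul_of_nonneg_right
      (Real.rpow_le_rpow (hpos t).le (hM t) (by linarith)) (hpos t).le
  have hadd (i j : ℕ) : iteratedDeriv i (iteratedDeriv j v) = iteratedDeriv (i + j) v := by
    simp only [iteratedDeriv_eq_iterate, Function.iterate_add_apply]
  induction k using Nat.strong_induction_on with
  | _ k ih =>
    match k, ih with
    | 0, _ => simpa using isBigO_refl v ⊤
    | 1, _ => exact hO₁
    | 2, _ => exact hO₂
    | 3, _ => exact hO₃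
    | j + 4, ih =>
      have h2 : ContDiff ℝ j (iteratedDeriv 2 v) := by
        rw [iteratedDeriv_eq_iterate]
        exact (hsmooth (j + 2)).iterate_deriv' j 2
      have hexpand : iteratedDeriv (j + 4) v = fun t => iteratedDeriv j (fun t => v t ^ p) t -
          (-(μ ^ 2 + ν ^ 2) * iteratedDeriv (j + 2) v t +
            μ ^ 2 * ν ^ 2 * iteratedDeriv j v t) := by
        rw [← hadd, ← hadd, heq]
        funext t
        have hv := hsmooth j
        rw [iteratedDeriv_fun_sub (hv.rpow_const_of_ne fun t => (hpos t).ne').contDiffAt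
          ((contDiff_const.mul h2).add (contDiff_const.mul hv)).contDiffAt,
          iteratedDeriv_fun_add (contDiff_const.mul h2).contDiffAt
            (contDiff_const.mul hv).contDiffAt,
          iteratedDeriv_const_mul_field, iteratedDeriv_const_mul_field]
      rw [hexpand]
      exact ((iteratedDeriv_rpow_isBigO hsmooth hpos (fun i hi => ih i (by omega)) p).trans
        hpow).sub (((ih (j + 2) (by omega)).const_mul_left _).add
          ((ih j (by omega)).const_mul_left _))


/-- For `n ≥ 5`, if a positive `C⁴` solution `v` of
`v'''' + K₂ v'' + K₀ v = v^((n+4)/(n-4))` tends to `0` at both `+∞` and `-∞`, then all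
its derivatives `v⁽ᵏ⁾`, `k ≥ 1`, tend to `0` at both `+∞` and `-∞`. -/
theorem derivatives_tend_to_zero (n : ℕ) (hn : 5 ≤ n) (v : ℝ → ℝ)
    (hreg : ContDiff ℝ 4 v) (hpos : ∀ t : ℝ, 0 < v t)
    (heq : ∀ t : ℝ,
      iteratedDeriv 4 v t + (-(((n:ℝ)^2 - 4*(n:ℝ) + 8) / 2)) * iteratedDeriv 2 v t
        + ((n:ℝ)^2 * ((n:ℝ) - 4)^2 / 16) * v t = v t ^ (((n:ℝ) + 4) / ((n:ℝ) - 4)))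
    (htop : Filter.Tendsto v Filter.atTop (nhds 0))
    (hbot : Filter.Tendsto v Filter.atBot (nhds 0)) :
    ∀ k : ℕ, 1 ≤ k →
      Filter.Tendsto (iteratedDeriv k v) Filter.atTop (nhds 0) ∧
      Filter.Tendsto (iteratedDeriv k v) Filter.atBot (nhds 0) := by
  intro k _
  have hn' : (5 : ℝ) ≤ n := by exact_mod_cast hn
  let V : ZeroAtInftyContinuousMap ℝ ℝ :=
    ⟨⟨v, hreg.continuous⟩, by
      rw [cocompact_eq_atBot_atTop]
      exact hbot.sup htop⟩
  obtain ⟨M, hM⟩ := V.isBounded_range.bddAbove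
  have hM' (t : ℝ) : v t ≤ M := hM ⟨t, rfl⟩
  have hp : (1 : ℝ) ≤ ((n : ℝ) + 4) / ((n : ℝ) - 4) := by
    rw [le_div_iff₀ (by linarith)]
    linarith
  have hO := iteratedDeriv_isBigO (μ := (n : ℝ) / 2) (ν := ((n : ℝ) - 4) / 2) (by linarith)
    (by linarith) hp hreg hpos hM' (by funext t; rw [← heq t]; ring) k
  exact ⟨(hO.mono le_top).trans_tendsto htop, (hO.mono le_top).trans_tendsto hbot⟩
end

section
/- Let n ≥ 5 and let v ∈ C⁴(ℝ) be a positive solution of equation (∗). Suppose v is monotone (nondecreasing or nonincreasing) on some interval (T, +∞) and v(t) → K₀^{(n-4)/8} as t → +∞. Then for every integer k ≥ 1, v⁽ᵏ⁾(t) → 0 as t → +∞. The analogous statement holds at -∞: if v is monotone on some interval (-∞, T) and v(t) → K₀^{(n-4)/8} as t → -∞, then v⁽ᵏ⁾(t) → 0 as t → -∞ for all k ≥ 1. -/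
open Filter Set Topology

/-- A function whose derivative is bounded by `E` on `[0, 1]` and which vanishes at `0` is bounded
by `E` on `[0, 1]`. -/
lemma abs_le_of_abs_deriv_le {f f' : ℝ → ℝ} {E : ℝ} (hf : ∀ s, HasDerivAt f (f' s) s)
    (h0 : f 0 = 0) (hE : ∀ s ∈ Icc (0 : ℝ) 1, |f' s| ≤ E) :
    ∀ s ∈ Icc (0 : ℝ) 1, |f s| ≤ E := by
  intro s hs
  have h := (convex_Icc (0 : ℝ) 1).norm_image_sub_le_of_norm_hasDerivWithin_le
    (fun x _ => (hf x).hasDerivWithinAt) hE (left_mem_Icc.2 zero_le_one) hs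
  rw [h0, sub_zero, sub_zero, Real.norm_eq_abs, Real.norm_eq_abs, abs_of_nonneg hs.1] at h
  have hE0 : 0 ≤ E := (abs_nonneg _).trans (hE s hs)
  exact h.trans (mul_le_of_le_one_right hE0 hs.2)

lemma abs_le_of_abs_second_deriv_le {f f' f'' : ℝ → ℝ} {E : ℝ}
    (hf : ∀ s, HasDerivAt f (f' s) s) (hf' : ∀ s, HasDerivAt f' (f'' s) s)
    (h0 : f 0 = 0) (h0' : f' 0 = 0) (hE : ∀ s ∈ Icc (0 : ℝ) 1, |f'' s| ≤ E) :
    ∀ s ∈ Icc (0 : ℝ) 1, |f s| ≤ E :=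
  abs_le_of_abs_deriv_le hf h0 (abs_le_of_abs_deriv_le hf' h0' hE)

/-- If `w` and `w'''' - a w''` are at most `ε` on `[t, t + 1]`, then `w'`, `w'' - a w` and
`w''' - a w'` are at most a constant times `ε` at `t`. -/
lemma derivs_bound {w w₁ w₂ w₃ w₄ : ℝ → ℝ} {a ε t : ℝ} (ha : 0 ≤ a)
    (h1 : ∀ s, HasDerivAt w (w₁ s) s) (h2 : ∀ s, HasDerivAt w₁ (w₂ s) s)
    (h3 : ∀ s, HasDerivAt w₂ (w₃ s) s) (h4 : ∀ s, HasDerivAt w₃ (w₄ s) s)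
    (hw : ∀ s, t ≤ s → |w s| ≤ ε) (hg : ∀ s, t ≤ s → |w₄ s - a * w₂ s| ≤ ε) :
    |w₁ t| ≤ 200 * ((a + 3) * ε) ∧ |w₂ t - a * w t| ≤ 200 * ((a + 3) * ε) ∧
      |w₃ t - a * w₁ t| ≤ 200 * ((a + 3) * ε) := by
  have shift : ∀ {f f' : ℝ → ℝ}, (∀ s, HasDerivAt f (f' s) s) →
      ∀ s, HasDerivAt (fun s => f (t + s)) (f' (t + s)) s :=
    fun hf s => (hf (t + s)).comp_const_add t s
  set A := w₂ t - a * w t with hA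
  set B := w₃ t - a * w₁ t with hB
  have hlin : ∀ b s : ℝ, HasDerivAt (fun s => b * s) b s := fun b s => by
    simpa using (hasDerivAt_id s).const_mul b
  have hh : ∀ s ∈ Icc (0 : ℝ) 1, |w₂ (t + s) - a * w (t + s) - A - B * s| ≤ ε := by
    refine abs_le_of_abs_second_deriv_le
      (f' := fun s => w₃ (t + s) - a * w₁ (t + s) - B)
      (f'' := fun s => w₄ (t + s) - a * w₂ (t + s)) ?_ ?_ (by simp [hA]) (by simp [hB]) ?_
    · intro s
      exact (((shift h3 s).sub ((shift h1 s).const_mul a)).sub_const A).sub (hlin B s)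
    · intro s
      exact ((shift h4 s).sub ((shift h2 s).const_mul a)).sub_const B
    · intro s hs
      exact hg _ (by linarith [hs.1])
  have hr : ∀ s ∈ Icc (0 : ℝ) 1,
      |w (t + s) - w t - w₁ t * s - A / 2 * s ^ 2 - B / 6 * s ^ 3| ≤ (a + 1) * ε := by
    have hsq : ∀ b s : ℝ, HasDerivAt (fun s => b / 2 * s ^ 2) (b * s) s := fun b s =>
      ((hasDerivAt_pow 2 s).const_mul (b / 2)).congr_deriv (by push_cast; ring)
    have hcub : ∀ b s : ℝ, HasDerivAt (fun s => b / 6 * s ^ 3) (b / 2 * s ^ 2) s := fun b s =>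
      ((hasDerivAt_pow 3 s).const_mul (b / 6)).congr_deriv (by push_cast; ring)
    refine abs_le_of_abs_second_deriv_le
      (f' := fun s => w₁ (t + s) - w₁ t - A * s - B / 2 * s ^ 2)
      (f'' := fun s => w₂ (t + s) - A - B * s) ?_ ?_ (by simp) (by simp) ?_
    · intro s
      exact ((((shift h1 s).sub_const _).sub (hlin _ s)).sub (hsq A s)).sub (hcub B s)
    · intro s
      exact (((shift h2 s).sub_const _).sub (hlin A s)).sub (hsq B s)
    · intro s hs
      have e1 := abs_le.1 (hh s hs)
      have e2 := abs_le.1 (hw (t + s) (by linarith [hs.1]))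
      rw [abs_le]
      constructor <;> nlinarith [e1.1, e1.2, mul_le_mul_of_nonneg_left e2.1 ha,
        mul_le_mul_of_nonneg_left e2.2 ha]
  have hp : ∀ s ∈ Icc (0 : ℝ) 1,
      |w₁ t * s + A / 2 * s ^ 2 + B / 6 * s ^ 3| ≤ (a + 3) * ε := by
    intro s hs
    have e1 := abs_le.1 (hr s hs)
    have e2 := abs_le.1 (hw (t + s) (by linarith [hs.1]))
    have e3 := abs_le.1 (hw t le_rfl)
    rw [abs_le]
    constructor <;> linarith [e1.1, e1.2, e2.1, e2.2, e3.1, e3.2]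
  have p1 := abs_le.1 (hp (1 / 3) (by norm_num))
  have p2 := abs_le.1 (hp (2 / 3) (by norm_num))
  have p3 := abs_le.1 (hp 1 (by norm_num))
  obtain ⟨p1, p1'⟩ := p1
  obtain ⟨p2, p2'⟩ := p2
  obtain ⟨p3, p3'⟩ := p3
  generalize (a + 3) * ε = E at *
  norm_num at p1 p1' p2 p2' p3 p3'
  refine ⟨abs_le.2 ⟨?_, ?_⟩, abs_le.2 ⟨?_, ?_⟩, abs_le.2 ⟨?_, ?_⟩⟩ <;> linarith

/-- If `w → 0` and `w'''' - a w'' → 0` at `+∞`, then the first four derivatives of `w` tend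
to `0` at `+∞`. -/
lemma tendsto_derivs_zero {w w₁ w₂ w₃ w₄ : ℝ → ℝ} {a : ℝ} (ha : 0 ≤ a)
    (h1 : ∀ s, HasDerivAt w (w₁ s) s) (h2 : ∀ s, HasDerivAt w₁ (w₂ s) s)
    (h3 : ∀ s, HasDerivAt w₂ (w₃ s) s) (h4 : ∀ s, HasDerivAt w₃ (w₄ s) s)
    (hw : Tendsto w atTop (𝓝 0)) (hg : Tendsto (fun s => w₄ s - a * w₂ s) atTop (𝓝 0)) :
    Tendsto w₁ atTop (𝓝 0) ∧ Tendsto w₂ atTop (𝓝 0) ∧ Tendsto w₃ atTop (𝓝 0) ∧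
      Tendsto w₄ atTop (𝓝 0) := by
  have key : ∀ δ > 0, ∃ T, ∀ t ≥ T,
      |w₁ t| < δ ∧ |w₂ t - a * w t| < δ ∧ |w₃ t - a * w₁ t| < δ := by
    intro δ hδ
    have hC : 0 < 200 * (a + 3) := by positivity
    obtain ⟨ε, hε, hεδ⟩ : ∃ ε > 0, 200 * ((a + 3) * ε) < δ := by
      refine ⟨δ / 2 / (200 * (a + 3)), by positivity, ?_⟩
      rw [← mul_assoc, mul_div_cancel₀ _ hC.ne']
      linarith
    obtain ⟨T₁, hT₁⟩ := Metric.tendsto_atTop.1 hw ε hε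
    obtain ⟨T₂, hT₂⟩ := Metric.tendsto_atTop.1 hg ε hε
    refine ⟨max T₁ T₂, fun t ht => ?_⟩
    have hb := derivs_bound ha h1 h2 h3 h4 (t := t) (ε := ε)
      (fun s hs => by simpa using (hT₁ s ((le_max_left _ _).trans (ht.le.trans hs))).le)
      (fun s hs => by simpa using (hT₂ s ((le_max_right _ _).trans (ht.le.trans hs))).le)
    exact ⟨hb.1.trans_lt hεδ, hb.2.1.trans_lt hεδ, hb.2.2.trans_lt hεδ⟩
  have t1 : Tendsto w₁ atTop (𝓝 0) := Metric.tendsto_atTop.2 fun δ hδ =>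
    (key δ hδ).imp fun T hT t ht => by simpa using (hT t ht).1
  have tA : Tendsto (fun t => w₂ t - a * w t) atTop (𝓝 0) := Metric.tendsto_atTop.2 fun δ hδ =>
    (key δ hδ).imp fun T hT t ht => by simpa using (hT t ht).2.1
  have tB : Tendsto (fun t => w₃ t - a * w₁ t) atTop (𝓝 0) := Metric.tendsto_atTop.2 fun δ hδ =>
    (key δ hδ).imp fun T hT t ht => by simpa using (hT t ht).2.2
  have t2 : Tendsto w₂ atTop (𝓝 0) := by simpa using tA.add (hw.const_mul a)
  have t3 : Tendsto w₃ atTop (𝓝 0) := by simpa using tB.add (t1.const_mul a)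
  have t4 : Tendsto w₄ atTop (𝓝 0) := by simpa using hg.add (t2.const_mul a)
  exact ⟨t1, t2, t3, t4⟩

/-- The function `f` is `m` times differentiable and it converges at `+∞` together with its first
`m` derivatives. -/
def DerivsConverge : ℕ → (ℝ → ℝ) → Prop
  | 0, f => ∃ c, Tendsto f atTop (𝓝 c)
  | m + 1, f => (∃ c, Tendsto f atTop (𝓝 c)) ∧ Differentiable ℝ f ∧ DerivsConverge m (deriv f)

namespace DerivsConverge

lemma tendsto {m : ℕ} {f : ℝ → ℝ} (hf : DerivsConverge m f) : ∃ c, Tendsto f atTop (𝓝 c) := by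
  cases m with
  | zero => exact hf
  | succ m => exact hf.1

lemma of_succ {m : ℕ} : ∀ {f : ℝ → ℝ}, DerivsConverge (m + 1) f → DerivsConverge m f := by
  induction m with
  | zero => exact fun hf => hf.1
  | succ m ih => exact fun hf => ⟨hf.1, hf.2.1, ih hf.2.2⟩

lemma add {m : ℕ} : ∀ {f g : ℝ → ℝ}, DerivsConverge m f → DerivsConverge m g →
    DerivsConverge m (fun t => f t + g t) := by
  induction m with
  | zero => exact fun ⟨c, hc⟩ ⟨d, hd⟩ => ⟨c + d, hc.add hd⟩
  | succ m ih =>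
    rintro f g ⟨⟨c, hc⟩, hf, hf'⟩ ⟨⟨d, hd⟩, hg, hg'⟩
    refine ⟨⟨c + d, hc.add hd⟩, hf.add hg, ?_⟩
    have : deriv (fun t => f t + g t) = fun t => deriv f t + deriv g t :=
      funext fun t => ((hf t).hasDerivAt.add (hg t).hasDerivAt).deriv
    rw [this]
    exact ih hf' hg'

lemma mul {m : ℕ} : ∀ {f g : ℝ → ℝ}, DerivsConverge m f → DerivsConverge m g →
    DerivsConverge m (fun t => f t * g t) := by
  induction m with
  | zero => exact fun ⟨c, hc⟩ ⟨d, hd⟩ => ⟨c * d, hc.mul hd⟩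
  | succ m ih =>
    intro f g hF hG
    have ⟨⟨c, hc⟩, hf, hf'⟩ := hF
    have ⟨⟨d, hd⟩, hg, hg'⟩ := hG
    refine ⟨⟨c * d, hc.mul hd⟩, hf.mul hg, ?_⟩
    have : deriv (fun t => f t * g t) = fun t => deriv f t * g t + f t * deriv g t :=
      funext fun t => ((hf t).hasDerivAt.mul (hg t).hasDerivAt).deriv
    rw [this]
    exact (ih hf' hG.of_succ).add (ih hF.of_succ hg')

lemma const (m : ℕ) : ∀ b : ℝ, DerivsConverge m (fun _ => b) := by
  induction m with
  | zero => exact fun b => ⟨b, tendsto_const_nhds⟩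
  | succ m ih =>
    refine fun b => ⟨⟨b, tendsto_const_nhds⟩, differentiable_const b, ?_⟩
    rw [deriv_const']
    exact ih 0

lemma rpow {m : ℕ} {f : ℝ → ℝ} (hpos : ∀ t, 0 < f t) {c : ℝ} (hc : 0 < c)
    (hfc : Tendsto f atTop (𝓝 c)) (hf : DerivsConverge m f) (q : ℝ) :
    DerivsConverge m (fun t => f t ^ q) := by
  induction m generalizing q with
  | zero => exact ⟨c ^ q, hfc.rpow_const (Or.inl hc.ne')⟩
  | succ m ih =>
    have hd : ∀ t, HasDerivAt (fun t => f t ^ q) (deriv f t * q * f t ^ (q - 1)) t :=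
      fun t => (hf.2.1 t).hasDerivAt.rpow_const (Or.inl (hpos t).ne')
    refine ⟨⟨c ^ q, hfc.rpow_const (Or.inl hc.ne')⟩, fun t => (hd t).differentiableAt, ?_⟩
    rw [show deriv (fun t => f t ^ q) = _ from funext fun t => (hd t).deriv]
    exact (hf.2.2.mul (const m q)).mul (ih hf.of_succ (q - 1))

end DerivsConverge

/-- If `f` and its derivative both converge at `+∞`, then the derivative tends to `0`. -/
lemma tendsto_deriv_zero {f : ℝ → ℝ} (hf : Differentiable ℝ f) {c d : ℝ}
    (hc : Tendsto f atTop (𝓝 c)) (hd : Tendsto (deriv f) atTop (𝓝 d)) :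
    Tendsto (deriv f) atTop (𝓝 0) := by
  have hmv : ∀ t : ℝ, ∃ ξ, t < ξ ∧ deriv f ξ = f (t + 1) - f t := fun t => by
    obtain ⟨ξ, hξ, h⟩ := exists_deriv_eq_slope f (lt_add_one t) hf.continuous.continuousOn
      hf.differentiableOn
    exact ⟨ξ, hξ.1, by simpa using h⟩
  choose ξ hξ hdξ using hmv
  have l1 : Tendsto (fun t => deriv f (ξ t)) atTop (𝓝 d) :=
    hd.comp (tendsto_atTop_mono (fun t => (hξ t).le) tendsto_id)
  have l2 : Tendsto (fun t => f (t + 1) - f t) atTop (𝓝 (c - c)) :=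
    (hc.comp (tendsto_atTop_add_const_right _ 1 tendsto_id)).sub hc
  rw [sub_self] at l2
  rwa [tendsto_nhds_unique l1 (l2.congr fun t => (hdξ t).symm)] at hd

lemma DerivsConverge.tendsto_iteratedDeriv {k : ℕ} {f : ℝ → ℝ} (hf : DerivsConverge (k + 1) f) :
    Tendsto (iteratedDeriv (k + 1) f) atTop (𝓝 0) := by
  induction k generalizing f with
  | zero =>
    obtain ⟨⟨c, hc⟩, hd, d, hd'⟩ := hf
    rw [iteratedDeriv_one]
    exact tendsto_deriv_zero hd hc hd'
  | succ k ih =>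
    rw [iteratedDeriv_succ']
    exact ih hf.2.2

/-- Every derivative of a positive solution of `v'''' - a v'' + b v = v ^ p` converging at `+∞` to
a positive equilibrium tends to `0`. -/
lemma tendsto_iteratedDeriv_of_tendsto_equilibrium {v : ℝ → ℝ} {a b c p : ℝ} (ha : 0 ≤ a)
    (hreg : ContDiff ℝ 4 v) (hpos : ∀ t, 0 < v t)
    (heq : ∀ t, iteratedDeriv 4 v t + (-a) * iteratedDeriv 2 v t + b * v t = v t ^ p)
    (hc : 0 < c) (hbc : c ^ p = b * c) (hv : Tendsto v atTop (𝓝 c)) (k : ℕ) (hk : 1 ≤ k) :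
    Tendsto (iteratedDeriv k v) atTop (𝓝 0) := by
  have hD : ∀ m : ℕ, m < 4 → Differentiable ℝ (iteratedDeriv m v) := fun m hm =>
    hreg.differentiable_iteratedDeriv m (by exact_mod_cast hm)
  have hder : ∀ m : ℕ, m < 4 → ∀ s,
      HasDerivAt (iteratedDeriv m v) (iteratedDeriv (m + 1) v s) s := fun m hm s => by
    rw [iteratedDeriv_succ]
    exact (hD m hm s).hasDerivAt
  have hw : Tendsto (fun t => v t - c) atTop (𝓝 0) := by simpa using hv.sub_const c
  have hg : Tendsto (fun s => iteratedDeriv 4 v s - a * iteratedDeriv 2 v s) atTop (𝓝 0) := by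
    have h := (hv.rpow_const (p := p) (Or.inl hc.ne')).sub (hv.const_mul b)
    rw [hbc, sub_self] at h
    exact h.congr fun t => by linarith [heq t]
  have h0 : ∀ s, HasDerivAt (fun t => v t - c) (iteratedDeriv 1 v s) s := fun s => by
    simpa [iteratedDeriv_zero] using (hder 0 (by norm_num) s).sub_const c
  obtain ⟨t1, t2, t3, t4⟩ := tendsto_derivs_zero ha h0 (hder 1 (by norm_num))
    (hder 2 (by norm_num)) (hder 3 (by norm_num)) hw hg
  have assemble : ∀ m, DerivsConverge m (iteratedDeriv 4 v) → DerivsConverge (m + 4) v := by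
    intro m h
    have e : ∀ j, deriv (iteratedDeriv j v) = iteratedDeriv (j + 1) v :=
      fun j => iteratedDeriv_succ.symm
    have s3 : DerivsConverge (m + 1) (iteratedDeriv 3 v) :=
      ⟨⟨0, t3⟩, hD 3 (by norm_num), by rw [e]; exact h⟩
    have s2 : DerivsConverge (m + 2) (iteratedDeriv 2 v) :=
      ⟨⟨0, t2⟩, hD 2 (by norm_num), by rw [e]; exact s3⟩
    have s1 : DerivsConverge (m + 3) (iteratedDeriv 1 v) :=
      ⟨⟨0, t1⟩, hD 1 (by norm_num), by rw [e]; exact s2⟩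
    exact ⟨⟨c, hv⟩, hreg.differentiable (by norm_num), by rw [← iteratedDeriv_one]; exact s1⟩
  have all : ∀ m, DerivsConverge (m + 4) v := by
    intro m
    induction m with
    | zero => exact assemble 0 ⟨0, t4⟩
    | succ m ih =>
      refine assemble (m + 1) ?_
      have i3 : DerivsConverge (m + 3) v := ih.of_succ
      have i1 : DerivsConverge (m + 1) v := i3.of_succ.of_succ
      have d2 : DerivsConverge (m + 1) (iteratedDeriv 2 v) := by
        rw [iteratedDeriv_succ, iteratedDeriv_one]
        exact i3.2.2.2.2
      have hfun : iteratedDeriv 4 v =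
          fun t => (a * iteratedDeriv 2 v t + (-b) * v t) + v t ^ p :=
        funext fun t => by linarith [heq t]
      rw [hfun]
      exact (((DerivsConverge.const _ a).mul d2).add ((DerivsConverge.const _ (-b)).mul i1)).add
        (i1.rpow hpos hc hv p)
  obtain ⟨j, rfl⟩ : ∃ j, k = j + 1 := ⟨k - 1, by omega⟩
  exact (all j).of_succ.of_succ.of_succ.tendsto_iteratedDeriv


/-- For `n ≥ 5`, if a positive `C⁴` solution `v` of
`v'''' + K₂ v'' + K₀ v = v^((n+4)/(n-4))` is eventually monotone at `+∞` (resp. `-∞`)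
and tends there to `K₀^((n-4)/8)`, then all its derivatives `v⁽ᵏ⁾`, `k ≥ 1`, tend to
`0` at `+∞` (resp. `-∞`). -/
theorem derivatives_tend_to_zero_monotone (n : ℕ) (hn : 5 ≤ n) (v : ℝ → ℝ)
    (hreg : ContDiff ℝ 4 v) (hpos : ∀ t : ℝ, 0 < v t)
    (heq : ∀ t : ℝ,
      iteratedDeriv 4 v t + (-(((n:ℝ)^2 - 4*(n:ℝ) + 8) / 2)) * iteratedDeriv 2 v t
        + ((n:ℝ)^2 * ((n:ℝ) - 4)^2 / 16) * v t = v t ^ (((n:ℝ) + 4) / ((n:ℝ) - 4))) :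
    ((∃ T : ℝ, MonotoneOn v (Set.Ioi T) ∨ AntitoneOn v (Set.Ioi T)) →
      Filter.Tendsto v Filter.atTop
        (nhds (((n:ℝ)^2 * ((n:ℝ) - 4)^2 / 16) ^ (((n:ℝ) - 4) / 8))) →
      ∀ k : ℕ, 1 ≤ k → Filter.Tendsto (iteratedDeriv k v) Filter.atTop (nhds 0)) ∧
    ((∃ T : ℝ, MonotoneOn v (Set.Iio T) ∨ AntitoneOn v (Set.Iio T)) →
      Filter.Tendsto v Filter.atBot
        (nhds (((n:ℝ)^2 * ((n:ℝ) - 4)^2 / 16) ^ (((n:ℝ) - 4) / 8))) →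
      ∀ k : ℕ, 1 ≤ k → Filter.Tendsto (iteratedDeriv k v) Filter.atBot (nhds 0)) := by
  have hn5 : (5 : ℝ) ≤ n := by exact_mod_cast hn
  have hn4 : (0 : ℝ) < (n : ℝ) - 4 := by linarith
  set b : ℝ := (n : ℝ) ^ 2 * ((n : ℝ) - 4) ^ 2 / 16 with hb
  have hb0 : 0 < b := by positivity
  have ha : (0 : ℝ) ≤ ((n : ℝ) ^ 2 - 4 * (n : ℝ) + 8) / 2 := by nlinarith
  have hc : 0 < b ^ (((n : ℝ) - 4) / 8) := Real.rpow_pos_of_pos hb0 _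
  have hbc : (b ^ (((n : ℝ) - 4) / 8)) ^ (((n : ℝ) + 4) / ((n : ℝ) - 4)) =
      b * b ^ (((n : ℝ) - 4) / 8) := by
    rw [← Real.rpow_mul hb0.le, ← Real.rpow_one_add' hb0.le (by positivity)]
    congr 1
    field_simp
    ring
  refine ⟨fun _ hv => tendsto_iteratedDeriv_of_tendsto_equilibrium ha hreg hpos heq hc hbc hv,
    fun _ hv k hk => ?_⟩
  have hneg : ∀ j t, iteratedDeriv j (fun s => v (-s)) t = (-1) ^ j * iteratedDeriv j v (-t) :=
    fun j t => by simpa using iteratedDeriv_comp_neg j v t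
  have hlim := tendsto_iteratedDeriv_of_tendsto_equilibrium (v := fun s => v (-s)) ha
    (hreg.comp contDiff_neg) (fun t => hpos (-t))
    (fun t => by simpa [hneg, Even.neg_one_pow (by decide : Even 4)] using heq (-t)) hc hbc (hv.comp tendsto_neg_atTop_atBot) k hk
  have hlim' := (hlim.comp tendsto_neg_atBot_atTop).const_mul ((-1 : ℝ) ^ k)
  rw [mul_zero] at hlim'
  refine hlim'.congr fun t => ?_
  rw [Function.comp_apply, hneg, neg_neg, ← mul_assoc, ← mul_pow]
  simp
end

section
/- Let n ≥ 5 and let v ∈ C⁴(ℝ) be a positive solution of equation (∗) with v(t) → 0 as t → +∞. Then v decays exponentially at the rate (n-4)/2: there exist constants C > 0 and T ∈ ℝ such that v(t) ≤ C e^{-((n-4)/2) t} for all t ≥ T. -/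
open Filter Topology

/-- Grönwall's inequality from below for `y' ≥ c y`. -/
lemma mul_exp_le_of_le_deriv {y y' : ℝ → ℝ} {c t₀ : ℝ}
    (hy : ∀ t, HasDerivAt y (y' t) t) (h : ∀ t, t₀ ≤ t → c * y t ≤ y' t) {t : ℝ} (ht : t₀ ≤ t) :
    y t₀ * Real.exp (c * (t - t₀)) ≤ y t := by
  have hd : ∀ s, HasDerivAt (fun s => Real.exp (-(c * s)) * y s)
      (Real.exp (-(c * s)) * (y' s - c * y s)) s := fun s => by
    have := ((((hasDerivAt_id s).const_mul c).neg.exp).mul (hy s))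
    refine this.congr_deriv ?_
    simp only [id, Pi.neg_apply]
    ring
  have hm : MonotoneOn (fun s => Real.exp (-(c * s)) * y s) (Set.Ici t₀) :=
    monotoneOn_of_hasDerivWithinAt_nonneg (convex_Ici t₀)
      (fun s _ => (hd s).continuousAt.continuousWithinAt)
      (fun s _ => (hd s).hasDerivWithinAt)
      (fun s hs => mul_nonneg (Real.exp_pos _).le
        (sub_nonneg.2 (h s (interior_subset hs))))
  have key := mul_le_mul_of_nonneg_left (hm (Set.mem_Ici.2 le_rfl) ht ht)
    (Real.exp_pos (c * t)).le
  have e1 : Real.exp (c * t) * (Real.exp (-(c * t)) * y t) = y t := by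
    rw [← mul_assoc, ← Real.exp_add]; simp
  have e2 : Real.exp (c * t) * (Real.exp (-(c * t₀)) * y t₀)
      = y t₀ * Real.exp (c * (t - t₀)) := by
    rw [← mul_assoc, ← Real.exp_add, mul_comm]; ring_nf
  simpa only [e1, e2] using key

/-- If `y' ≥ c y` with `c > 0` and `y` is positive somewhere, then `y → ∞`. -/
lemma tendsto_atTop_of_mul_le_deriv {y y' : ℝ → ℝ} {c t₀ : ℝ} (hc : 0 < c)
    (hy : ∀ t, HasDerivAt y (y' t) t) (h : ∀ t, t₀ ≤ t → c * y t ≤ y' t) (h₀ : 0 < y t₀) :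
    Tendsto y atTop atTop := by
  refine tendsto_atTop_mono' atTop
    ((eventually_ge_atTop t₀).mono fun t ht => mul_exp_le_of_le_deriv hy h ht) ?_
  exact (Real.tendsto_exp_atTop.comp ((tendsto_atTop_add_const_right _ (-t₀)
    tendsto_id).const_mul_atTop hc)).const_mul_atTop h₀

/-- If `y' + c y → ∞` with `c > 0`, then `y → ∞`. -/
lemma tendsto_atTop_of_deriv_add_mul {y y' : ℝ → ℝ} {c : ℝ} (hc : 0 < c)
    (hy : ∀ t, HasDerivAt y (y' t) t) (h : Tendsto (fun t => y' t + c * y t) atTop atTop) :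
    Tendsto y atTop atTop := by
  refine tendsto_atTop.2 fun K => ?_
  obtain ⟨t₁, ht₁⟩ := eventually_atTop.1 (tendsto_atTop.1 h (c * (K + 1)))
  have hlow : ∀ t, t₁ ≤ t →
      (y t₁ - (K + 1)) * Real.exp (-c * (t - t₁)) ≤ y t - (K + 1) := fun t ht =>
    mul_exp_le_of_le_deriv (y := fun t => y t - (K + 1)) (fun s => (hy s).sub_const _)
      (fun s hs => by linarith [ht₁ s hs]) ht
  have hlim : Tendsto (fun t => (y t₁ - (K + 1)) * Real.exp (-c * (t - t₁))) atTop (𝓝 0) := by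
    have := (Real.tendsto_exp_atBot.comp ((tendsto_atTop_add_const_right _ (-t₁)
      tendsto_id).const_mul_atTop_of_neg (neg_lt_zero.2 hc))).const_mul (y t₁ - (K + 1))
    simpa [Function.comp_def, sub_eq_add_neg] using this
  filter_upwards [eventually_ge_atTop t₁, hlim.eventually_const_lt neg_one_lt_zero] with t h1 h2
  linarith [hlow t h1]

/-- If `y' - a y` grows at least at the exponential rate `b > a > 0`, then `y → ∞`. -/
lemma tendsto_atTop_of_exp_le_deriv_sub {y y' : ℝ → ℝ} {a b k t₀ : ℝ} (ha : 0 < a) (hab : a < b)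
    (hk : 0 < k) (hy : ∀ t, HasDerivAt y (y' t) t)
    (h : ∀ t, t₀ ≤ t → k * Real.exp (b * (t - t₀)) ≤ y' t - a * y t) :
    Tendsto y atTop atTop := by
  set κ := k / (b - a) with hκ
  have hba : 0 < b - a := sub_pos.2 hab
  have hκk : κ * (b - a) = k := by rw [hκ]; field_simp
  have hκ0 : 0 < κ := div_pos hk hba
  have hexp : ∀ c s, HasDerivAt (fun s => Real.exp (c * (s - t₀)))
      (c * Real.exp (c * (s - t₀))) s := fun c s => by
    have := (((hasDerivAt_id s).sub_const t₀).const_mul c).exp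
    refine this.congr_deriv ?_
    simp only [id]
    ring
  have hlow : ∀ t, t₀ ≤ t → (y t₀ - κ) * Real.exp (a * (t - t₀)) ≤
      y t - κ * Real.exp (b * (t - t₀)) := fun t ht => by
    have := mul_exp_le_of_le_deriv (y := fun t => y t - κ * Real.exp (b * (t - t₀)))
      (c := a) (fun s => (hy s).sub ((hexp b s).const_mul κ))
      (fun s hs => by
        have h1 := h s hs
        rw [← hκk] at h1
        linarith) ht
    simpa using this
  have hba' : Tendsto (fun t => (y t₀ - κ) + κ * Real.exp ((b - a) * (t - t₀))) atTop atTop :=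
    tendsto_atTop_add_const_left _ _ ((Real.tendsto_exp_atTop.comp
      ((tendsto_atTop_add_const_right _ (-t₀) tendsto_id).const_mul_atTop hba)).const_mul_atTop hκ0)
  have ha' : Tendsto (fun t => Real.exp (a * (t - t₀))) atTop atTop :=
    Real.tendsto_exp_atTop.comp
      ((tendsto_atTop_add_const_right _ (-t₀) tendsto_id).const_mul_atTop ha)
  refine tendsto_atTop_mono' atTop ((eventually_ge_atTop t₀).mono fun t ht => ?_)
    (ha'.atTop_mul_atTop₀ hba')
  have e : Real.exp (b * (t - t₀)) = Real.exp (a * (t - t₀)) * Real.exp ((b - a) * (t - t₀)) := by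
    rw [← Real.exp_add]; ring_nf
  have := hlow t ht
  rw [e] at this
  linarith

/-- A bounded solution of `(D² - a²)(D² - b²) v ≤ 0` on a half-line, where `0 < a < b`,
is `O(exp (-a t))` from above. -/
lemma le_exp_of_bounded_of_nonpos {v v₁ v₂ v₃ v₄ : ℝ → ℝ} {a b T M : ℝ} (ha : 0 < a) (hab : a < b)
    (h₀ : ∀ t, HasDerivAt v (v₁ t) t) (h₁ : ∀ t, HasDerivAt v₁ (v₂ t) t)
    (h₂ : ∀ t, HasDerivAt v₂ (v₃ t) t) (h₃ : ∀ t, HasDerivAt v₃ (v₄ t) t)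
    (hbdd : ∀ t, T ≤ t → |v t| ≤ M)
    (hL : ∀ t, T ≤ t → v₄ t - (a ^ 2 + b ^ 2) * v₂ t + a ^ 2 * b ^ 2 * v t ≤ 0) :
    ∃ C, 0 < C ∧ ∀ t, T ≤ t → v t ≤ C * Real.exp (-a * t) := by
  have hb : 0 < b := ha.trans hab
  have hba : 0 < b - a := sub_pos.2 hab
  -- the successive factors `y₁ = (D + a) v`, `y₂ = (D + b) y₁`, `y₃ = (D - a) y₂`
  set y₁ : ℝ → ℝ := fun t => v₁ t + a * v t with hy₁
  set y₂ : ℝ → ℝ := fun t => v₂ t + (a + b) * v₁ t + a * b * v t with hy₂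
  set y₃ : ℝ → ℝ := fun t => v₃ t + b * v₂ t - a ^ 2 * v₁ t - a ^ 2 * b * v t with hy₃
  have d₁ : ∀ t, HasDerivAt y₁ (v₂ t + a * v₁ t) t := fun t => (h₁ t).add ((h₀ t).const_mul a)
  have d₂ : ∀ t, HasDerivAt y₂ (v₃ t + (a + b) * v₂ t + a * b * v₁ t) t := fun t =>
    ((h₂ t).add ((h₁ t).const_mul _)).add ((h₀ t).const_mul _)
  have d₃ : ∀ t, HasDerivAt y₃ (v₄ t + b * v₃ t - a ^ 2 * v₂ t - a ^ 2 * b * v₁ t) t := fun t =>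
    (((h₃ t).add ((h₂ t).const_mul _)).sub ((h₁ t).const_mul _)).sub ((h₀ t).const_mul _)
  have not_atTop : ∀ u : ℝ → ℝ, (∀ t, T ≤ t → u t ≤ M) → ¬ Tendsto u atTop atTop := by
    intro u hu hlim
    obtain ⟨t, ht1, ht2⟩ := ((eventually_ge_atTop T).and (hlim.eventually_gt_atTop M)).exists
    exact absurd (hu t ht1) (not_le.2 ht2)
  have hy₃0 : ∀ t, T ≤ t → 0 ≤ y₃ t := by
    intro t₀ ht₀
    by_contra! hneg
    have g₂ : Tendsto (fun t => -y₂ t) atTop atTop := by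
      refine tendsto_atTop_of_exp_le_deriv_sub (t₀ := t₀) ha hab (neg_pos.2 hneg)
        (fun t => (d₂ t).neg) fun t ht => ?_
      have := mul_exp_le_of_le_deriv (y := fun t => -y₃ t) (c := b) (fun t => (d₃ t).neg)
        (fun s hs => by
          have := hL s (ht₀.trans hs)
          simp only [hy₃]
          linarith) ht
      refine this.trans (le_of_eq ?_)
      simp only [hy₂, hy₃]
      ring
    have g₁ : Tendsto (fun t => -y₁ t) atTop atTop := by
      refine tendsto_atTop_of_deriv_add_mul hb (fun t => (d₁ t).neg) (g₂.congr fun t => ?_)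
      simp only [hy₁, hy₂]
      ring
    refine not_atTop _ (fun t ht => (neg_le_abs _).trans (hbdd t ht))
      (tendsto_atTop_of_deriv_add_mul ha (fun t => (h₀ t).neg) (g₁.congr fun t => ?_))
    simp only [hy₁]
    ring
  have hy₂0 : ∀ t, T ≤ t → y₂ t ≤ 0 := by
    intro t₀ ht₀
    by_contra! hp
    have g₂ : Tendsto y₂ atTop atTop :=
      tendsto_atTop_of_mul_le_deriv ha d₂ (fun t ht => by
        have := hy₃0 t (ht₀.trans ht)
        simp only [hy₂, hy₃] at this ⊢
        linarith) hp
    have g₁ : Tendsto y₁ atTop atTop := by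
      refine tendsto_atTop_of_deriv_add_mul hb d₁ (g₂.congr fun t => ?_)
      simp only [hy₁, hy₂]
      ring
    exact not_atTop _ (fun t ht => (le_abs_self _).trans (hbdd t ht))
      (tendsto_atTop_of_deriv_add_mul ha h₀ g₁)
  have hy₁le : ∀ t, T ≤ t → y₁ t ≤ |y₁ T| * Real.exp (-b * (t - T)) := by
    intro t ht
    have := mul_exp_le_of_le_deriv (y := fun t => -y₁ t) (c := -b) (fun t => (d₁ t).neg)
      (fun s hs => by
        have := hy₂0 s hs
        simp only [hy₁, hy₂] at this ⊢
        linarith) ht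
    have h2 := mul_le_mul_of_nonneg_right (le_abs_self (y₁ T)) (Real.exp_pos (-b * (t - T))).le
    linarith
  set k := |y₁ T| / (b - a) with hk
  have hkk : k * (b - a) = |y₁ T| := by rw [hk]; field_simp
  have hk0 : 0 ≤ k := div_nonneg (abs_nonneg _) hba.le
  have hexp : ∀ s, HasDerivAt (fun s => Real.exp (-b * (s - T)))
      (-b * Real.exp (-b * (s - T))) s := fun s => by
    have := (((hasDerivAt_id s).sub_const T).const_mul (-b)).exp
    refine this.congr_deriv ?_
    simp only [id]
    ring
  refine ⟨(|v T + k| + 1) * Real.exp (a * T), by positivity, fun t ht => ?_⟩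
  have := mul_exp_le_of_le_deriv (y := fun t => -(v t + k * Real.exp (-b * (t - T)))) (c := -a)
    (fun t => ((h₀ t).add ((hexp t).const_mul k)).neg)
    (fun s hs => by
      have := hy₁le s hs
      rw [← hkk] at this
      simp only [hy₁] at this
      linarith) ht
  simp only [sub_self, mul_zero, Real.exp_zero, mul_one] at this
  have e : Real.exp (-a * (t - T)) = Real.exp (a * T) * Real.exp (-a * t) := by
    rw [← Real.exp_add]; ring_nf
  have h3 := mul_le_mul_of_nonneg_right ((le_abs_self (v T + k)).trans (le_add_of_nonneg_right
    zero_le_one)) (Real.exp_pos (-a * (t - T))).le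
  have h4 := mul_nonneg hk0 (Real.exp_pos (-b * (t - T))).le
  calc v t ≤ (|v T + k| + 1) * Real.exp (-a * (t - T)) := by linarith
    _ = _ := by rw [e, mul_assoc]

/-- A positive decaying solution of `(D² - a²)(D² - (a + 2)²) v = v ^ ((a + 4) / a)`
is `O(exp (-a t))`. -/
lemma exp_decay_of_hasDerivAt {v v₁ v₂ v₃ v₄ : ℝ → ℝ} {a : ℝ} (ha : 0 < a)
    (h₀ : ∀ t, HasDerivAt v (v₁ t) t) (h₁ : ∀ t, HasDerivAt v₁ (v₂ t) t)
    (h₂ : ∀ t, HasDerivAt v₂ (v₃ t) t) (h₃ : ∀ t, HasDerivAt v₃ (v₄ t) t)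
    (hpos : ∀ t, 0 < v t)
    (heq : ∀ t, v₄ t - (a ^ 2 + (a + 2) ^ 2) * v₂ t + a ^ 2 * (a + 2) ^ 2 * v t
      = v t ^ ((a + 4) / a))
    (hlim : Tendsto v atTop (𝓝 0)) :
    ∃ C, 0 < C ∧ ∃ T, ∀ t, T ≤ t → v t ≤ C * Real.exp (-a * t) := by
  -- the rate `α < a` is chosen so that the nonlinearity then decays at rate `a + 1`
  set α := a * (a + 1) / (a + 4) with hα
  have hα0 : 0 < α := by positivity
  have hαa : α < a := by
    rw [hα, div_lt_iff₀ (by positivity)]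
    nlinarith
  have hα2 : α ^ 2 < a ^ 2 := by gcongr
  have hβ2 : 0 < a ^ 2 + (a + 2) ^ 2 - α ^ 2 := by nlinarith [sq_nonneg (a + 2)]
  set β := √(a ^ 2 + (a + 2) ^ 2 - α ^ 2) with hβ
  have hβsq : β ^ 2 = a ^ 2 + (a + 2) ^ 2 - α ^ 2 := Real.sq_sqrt hβ2.le
  have hαβ : α < β := by
    rw [hβ]
    apply Real.lt_sqrt_of_sq_lt
    nlinarith
  have hε : 0 < (a ^ 2 - α ^ 2) * ((a + 2) ^ 2 - α ^ 2) := mul_pos (by linarith) (by nlinarith)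
  have hpow : Tendsto (fun t => v t ^ (4 / a)) atTop (𝓝 0) := by
    have := hlim.rpow_const (p := 4 / a) (Or.inr (by positivity))
    rwa [Real.zero_rpow (by positivity)] at this
  obtain ⟨T, hT⟩ := eventually_atTop.1 ((hpow.eventually_lt_const hε).and
    (hlim.eventually_lt_const one_pos))
  obtain ⟨C, hC, hvC⟩ := le_exp_of_bounded_of_nonpos (T := T) (M := 1) hα0 hαβ h₀ h₁ h₂ h₃
    (fun t ht => by rw [abs_of_pos (hpos t)]; exact (hT t ht).2.le)
    (fun t ht => by
      have e : v t ^ ((a + 4) / a) = v t * v t ^ (4 / a) := by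
        rw [show (a + 4) / a = 1 + 4 / a by field_simp, Real.rpow_add (hpos t), Real.rpow_one]
      have h1 := heq t
      have h2 := mul_le_mul_of_nonneg_left (hT t ht).1.le (hpos t).le
      rw [← e, ← h1] at h2
      rw [hβsq]
      linarith)
  have hf : ∀ t, T ≤ t → v t ^ ((a + 4) / a) ≤ C ^ ((a + 4) / a) * Real.exp (-(a + 1) * t) := by
    intro t ht
    refine (Real.rpow_le_rpow (hpos t).le (hvC t ht) (by positivity)).trans (le_of_eq ?_)
    rw [Real.mul_rpow hC.le (Real.exp_pos _).le, ← Real.exp_mul]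
    congr 2
    rw [hα]
    field_simp
  set m := (2 * a + 1) * (2 * a + 3) with hm
  have hm0 : 0 < m := by positivity
  set k := C ^ ((a + 4) / a) / m with hk
  have hkm : C ^ ((a + 4) / a) = k * m := by rw [hk]; field_simp
  have hk0 : 0 ≤ k := by positivity
  have hexp : ∀ c s, HasDerivAt (fun s => c * Real.exp (-(a + 1) * s))
      (c * (-(a + 1)) * Real.exp (-(a + 1) * s)) s := fun c s => by
    have := (((hasDerivAt_id s).const_mul (-(a + 1))).exp).const_mul c
    refine this.congr_deriv ?_
    simp only [id]
    ring
  obtain ⟨C', hC', hv⟩ := le_exp_of_bounded_of_nonpos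
    (v := fun t => v t + k * Real.exp (-(a + 1) * t)) (a := a) (b := a + 2) (T := T)
    (M := 1 + k * Real.exp (-(a + 1) * T)) ha
    (by linarith) (fun t => (h₀ t).add (hexp _ t)) (fun t => (h₁ t).add (hexp _ t))
    (fun t => (h₂ t).add (hexp _ t)) (fun t => (h₃ t).add (hexp _ t))
    (fun t ht => by
      have h1 : 0 ≤ k * Real.exp (-(a + 1) * t) := mul_nonneg hk0 (Real.exp_pos _).le
      rw [abs_of_nonneg (add_nonneg (hpos t).le h1)]
      refine add_le_add (hT t ht).2.le (mul_le_mul_of_nonneg_left (Real.exp_le_exp.2 ?_) hk0)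
      nlinarith)
    (fun t ht => by
      have h1 := hf t ht
      rw [hkm, ← heq t, hm] at h1
      linarith)
  refine ⟨C', hC', T, fun t ht => le_trans ?_ (hv t ht)⟩
  exact le_add_of_nonneg_right (mul_nonneg hk0 (Real.exp_pos _).le)

/-- For `n ≥ 5`, a positive `C⁴` solution `v` of
`v'''' + K₂ v'' + K₀ v = v^((n+4)/(n-4))` with `v(t) → 0` as `t → +∞` decays
exponentially at rate `(n-4)/2`. -/
theorem exponential_decay (n : ℕ) (hn : 5 ≤ n) (v : ℝ → ℝ)
    (hreg : ContDiff ℝ 4 v) (hpos : ∀ t : ℝ, 0 < v t)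
    (heq : ∀ t : ℝ,
      iteratedDeriv 4 v t + (-(((n:ℝ)^2 - 4*(n:ℝ) + 8) / 2)) * iteratedDeriv 2 v t
        + ((n:ℝ)^2 * ((n:ℝ) - 4)^2 / 16) * v t = v t ^ (((n:ℝ) + 4) / ((n:ℝ) - 4)))
    (hlim : Filter.Tendsto v Filter.atTop (nhds 0)) :
    ∃ C : ℝ, 0 < C ∧ ∃ T : ℝ, ∀ t : ℝ, T ≤ t →
      v t ≤ C * Real.exp (-(((n:ℝ) - 4) / 2) * t) := by
  have hn' : (5 : ℝ) ≤ n := by exact_mod_cast hn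
  have hd : ∀ k : ℕ, k < 4 → ∀ t, HasDerivAt (iteratedDeriv k v) (iteratedDeriv (k + 1) v t) t := by
    intro k hk t
    rw [iteratedDeriv_succ]
    exact (hreg.differentiable_iteratedDeriv k (by exact_mod_cast hk) t).hasDerivAt
  have h0 := hd 0 (by norm_num)
  rw [iteratedDeriv_zero] at h0
  refine exp_decay_of_hasDerivAt (by linarith) h0 (hd 1 (by norm_num)) (hd 2 (by norm_num))
    (hd 3 (by norm_num)) hpos (fun t => ?_) hlim
  have hexp : (((n : ℝ) - 4) / 2 + 4) / (((n : ℝ) - 4) / 2) = ((n : ℝ) + 4) / ((n : ℝ) - 4) := by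
    have : (n : ℝ) - 4 ≠ 0 := by linarith
    field_simp
    ring
  rw [hexp, ← heq t]
  ring
end
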